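/- arXiv:1808.01579 — 3 statements merged into one kernel-verified Lean document; each statement's English description precedes it below -/
import Mathlib

section
/- Let F be a field of characteristic not 2 containing an element i with i² = −1. Let A ∈ GL_n(F) and let r ≥ n be an integer such that i^r · det A = 1 or i^r · det A = −1. Then the matrix A ⊕ (i I_r) ∈ GL_{n+r}(F) can be written as a product of three matrices of GL_{n+r}(F), one of which is an involution and two of which are U2-matrices, with the three factors in any prescribed order. -/
universe u

namespace TwoUnipotents

section Basic

variable {F : Type u} [Field F]
variable {V W V' W' Z : Type u} [AddCommGroup V] [Module F V] [AddCommGroup W] [Module F W]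
  [AddCommGroup V'] [Module F V'] [AddCommGroup W'] [Module F W'] [AddCommGroup Z] [Module F Z]

/-- `t` is a product of two unipotent endomorphisms of index `2`. -/
def IsUU (t : Module.End F V) : Prop :=
  ∃ a b : Module.End F V, (a - 1) * (a - 1) = 0 ∧ (b - 1) * (b - 1) = 0 ∧ t = a * b

/-- `f` is a product of an involution and two unipotent endomorphisms of index `2`. -/
def IsSUU (f : Module.End F V) : Prop :=
  ∃ s t : Module.End F V, s * s = 1 ∧ IsUU t ∧ f = s * t

/-- Similarity of endomorphisms of possibly different spaces. -/
def Sim (f : Module.End F V) (g : Module.End F W) : Prop :=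
  ∃ φ : V ≃ₗ[F] W, ∀ x, φ (f x) = g (φ x)

theorem Sim.refl (f : Module.End F V) : Sim f f := ⟨LinearEquiv.refl F V, fun _ => rfl⟩

theorem Sim.symm {f : Module.End F V} {g : Module.End F W} (h : Sim f g) : Sim g f := by
  obtain ⟨φ, h⟩ := h
  refine ⟨φ.symm, fun x => ?_⟩
  rw [LinearEquiv.symm_apply_eq, h, LinearEquiv.apply_symm_apply]

theorem Sim.trans {f : Module.End F V} {g : Module.End F W} {k : Module.End F Z}
    (h : Sim f g) (h' : Sim g k) : Sim f k := by
  obtain ⟨φ, h⟩ := h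
  obtain ⟨ψ, h'⟩ := h'
  exact ⟨φ.trans ψ, fun x => by simp [h, h']⟩

theorem Sim.prodMap {f : Module.End F V} {g : Module.End F W} {f' : Module.End F V'}
    {g' : Module.End F W'} (h : Sim f g) (h' : Sim f' g') :
    Sim (f.prodMap f' : Module.End F (V × V')) (g.prodMap g' : Module.End F (W × W')) := by
  obtain ⟨φ, h⟩ := h
  obtain ⟨ψ, h'⟩ := h'
  exact ⟨φ.prodCongr ψ, fun x => by simp [h, h']⟩

theorem Sim.prodComm (f : Module.End F V) (g : Module.End F W) :
    Sim (f.prodMap g : Module.End F (V × W)) (g.prodMap f : Module.End F (W × V)) :=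
  ⟨LinearEquiv.prodComm F V W, fun x => by simp⟩

theorem Sim.prodAssoc (f : Module.End F V) (g : Module.End F W) (k : Module.End F Z) :
    Sim ((f.prodMap g : Module.End F (V × W)).prodMap k : Module.End F ((V × W) × Z))
      (f.prodMap (g.prodMap k : Module.End F (W × Z)) : Module.End F (V × W × Z)) :=
  ⟨LinearEquiv.prodAssoc F V W Z, fun x => by simp⟩

theorem Sim.prodProdProdComm (f : Module.End F V) (g : Module.End F W) (f' : Module.End F V')
    (g' : Module.End F W') :
    Sim ((f.prodMap g : Module.End F (V × W)).prodMap (f'.prodMap g' : Module.End F (V' × W')) :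
        Module.End F ((V × W) × V' × W'))
      ((f.prodMap f' : Module.End F (V × V')).prodMap (g.prodMap g' : Module.End F (W × W')) :
        Module.End F ((V × V') × W × W')) :=
  ⟨LinearEquiv.prodProdProdComm F V W V' W', fun x => by simp⟩

theorem Sim.of_conj {f g : Module.End F V} {p q : Module.End F V} (hpq : p * q = 1)
    (hqp : q * p = 1) (h : p * f = g * p) : Sim f g :=
  ⟨LinearEquiv.ofLinearMap p q hpq hqp, fun x => by
    simpa using LinearMap.congr_fun h x⟩

theorem Sim.smul_one [FiniteDimensional F V] [FiniteDimensional F W]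
    (h : Module.finrank F V = Module.finrank F W) (c : F) :
    Sim (c • (1 : Module.End F V)) (c • (1 : Module.End F W)) :=
  ⟨LinearEquiv.ofFinrankEq V W h, fun x => by simp⟩

theorem smul_one_prod (c : F) :
    c • (1 : Module.End F (V × W)) =
      ((c • (1 : Module.End F V)).prodMap (c • (1 : Module.End F W)) : Module.End F (V × W)) := by
  ext x <;> simp

theorem Sim.neg {f : Module.End F V} {g : Module.End F W} (h : Sim f g) : Sim (-f) (-g) := by
  obtain ⟨φ, h⟩ := h
  exact ⟨φ, fun x => by simp [h]⟩

theorem Sim.smul {f : Module.End F V} {g : Module.End F W} (h : Sim f g) (c : F) :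
    Sim (c • f) (c • g) := by
  obtain ⟨φ, h⟩ := h
  exact ⟨φ, fun x => by simp [h]⟩

theorem neg_prodMap (f : Module.End F V) (g : Module.End F W) :
    -(f.prodMap g : Module.End F (V × W)) = ((-f).prodMap (-g) : Module.End F (V × W)) := by
  ext x <;> simp

theorem conj_eq {f : Module.End F V} {g : Module.End F W} {φ : V ≃ₗ[F] W}
    (h : ∀ x, φ (f x) = g (φ x)) : g = φ.conjRingEquiv f := by
  ext x
  simp [h]

theorem IsUU.sim {f : Module.End F V} {g : Module.End F W} (h : Sim f g) (hf : IsUU f) :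
    IsUU g := by
  obtain ⟨φ, h⟩ := h
  obtain ⟨a, b, ha, hb, rfl⟩ := hf
  refine ⟨φ.conjRingEquiv a, φ.conjRingEquiv b, ?_, ?_, ?_⟩
  · rw [← map_one φ.conjRingEquiv, ← map_sub, ← map_mul, ha, map_zero]
  · rw [← map_one φ.conjRingEquiv, ← map_sub, ← map_mul, hb, map_zero]
  · rw [← map_mul, ← conj_eq h]

theorem IsSUU.sim {f : Module.End F V} {g : Module.End F W} (h : Sim f g) (hf : IsSUU f) :
    IsSUU g := by
  obtain ⟨φ, h⟩ := h
  obtain ⟨s, t, hs, ht, rfl⟩ := hf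
  refine ⟨φ.conjRingEquiv s, φ.conjRingEquiv t, ?_, ht.sim ⟨φ, fun x => ?_⟩, ?_⟩
  · rw [← map_mul, hs, map_one]
  · simp
  · rw [← map_mul, ← conj_eq h]

theorem IsUU.prodMap {f : Module.End F V} {g : Module.End F W} (hf : IsUU f) (hg : IsUU g) :
    IsUU (f.prodMap g : Module.End F (V × W)) := by
  obtain ⟨a, b, ha, hb, rfl⟩ := hf
  obtain ⟨a', b', ha', hb', rfl⟩ := hg
  refine ⟨a.prodMap a', b.prodMap b', ?_, ?_, ?_⟩
  · have : (a.prodMap a' - 1 : Module.End F (V × W)) = (a - 1).prodMap (a' - 1) := by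
      ext x <;> simp
    rw [this, LinearMap.prodMap_mul, ha, ha', LinearMap.prodMap_zero]
  · have : (b.prodMap b' - 1 : Module.End F (V × W)) = (b - 1).prodMap (b' - 1) := by
      ext x <;> simp
    rw [this, LinearMap.prodMap_mul, hb, hb', LinearMap.prodMap_zero]
  · rw [LinearMap.prodMap_mul]

theorem IsSUU.prodMap {f : Module.End F V} {g : Module.End F W} (hf : IsSUU f)
    (hg : IsSUU g) : IsSUU (f.prodMap g : Module.End F (V × W)) := by
  obtain ⟨s, t, hs, ht, rfl⟩ := hf
  obtain ⟨s', t', hs', ht', rfl⟩ := hg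
  refine ⟨s.prodMap s', t.prodMap t', ?_, ht.prodMap ht', ?_⟩
  · rw [LinearMap.prodMap_mul, hs, hs', LinearMap.prodMap_one]
  · rw [LinearMap.prodMap_mul]

theorem IsUU.one : IsUU (1 : Module.End F V) := ⟨1, 1, by simp, by simp, by simp⟩

theorem IsSUU.of_neg {s t : Module.End F V} (hs : s * s = 1) (ht : IsUU (-t)) :
    IsSUU (s * t) := ⟨-s, -t, by simpa using hs, ht, by simp⟩

/-- The endomorphism of `V × W` with block matrix `[[a, b], [c, d]]`. -/
def blk (a : Module.End F V) (b : W →ₗ[F] V) (c : V →ₗ[F] W) (d : Module.End F W) :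
    Module.End F (V × W) :=
  (a.coprod b).prod (c.coprod d)

@[simp] theorem blk_apply (a : Module.End F V) (b : W →ₗ[F] V) (c : V →ₗ[F] W)
    (d : Module.End F W) (x : V × W) : blk a b c d x = (a x.1 + b x.2, c x.1 + d x.2) := rfl

theorem blk_mul (a : Module.End F V) (b : W →ₗ[F] V) (c : V →ₗ[F] W) (d : Module.End F W)
    (a' : Module.End F V) (b' : W →ₗ[F] V) (c' : V →ₗ[F] W) (d' : Module.End F W) :
    blk a b c d * blk a' b' c' d' =
      blk (a * a' + b ∘ₗ c') (a ∘ₗ b' + b ∘ₗ d') (c ∘ₗ a' + d ∘ₗ c') (c ∘ₗ b' + d * d') := by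
  refine LinearMap.ext fun x => Prod.ext ?_ ?_ <;> simp <;> abel

theorem blk_one : blk (1 : Module.End F V) 0 0 (1 : Module.End F W) = 1 := by
  refine LinearMap.ext fun x => Prod.ext ?_ ?_ <;> simp

theorem blk_zero : blk (0 : Module.End F V) 0 0 (0 : Module.End F W) = 0 := by
  refine LinearMap.ext fun x => Prod.ext ?_ ?_ <;> simp

theorem blk_sub (a : Module.End F V) (b : W →ₗ[F] V) (c : V →ₗ[F] W) (d : Module.End F W)
    (a' : Module.End F V) (b' : W →ₗ[F] V) (c' : V →ₗ[F] W) (d' : Module.End F W) :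
    blk a b c d - blk a' b' c' d' = blk (a - a') (b - b') (c - c') (d - d') := by
  refine LinearMap.ext fun x => Prod.ext ?_ ?_ <;> simp <;> abel

theorem blk_smul (r : F) (a : Module.End F V) (b : W →ₗ[F] V) (c : V →ₗ[F] W)
    (d : Module.End F W) :
    r • blk a b c d = blk (r • a) (r • b) (r • c) (r • d) := by
  refine LinearMap.ext fun x => Prod.ext ?_ ?_ <;> simp

theorem blk_diag (a : Module.End F V) (d : Module.End F W) :
    blk a 0 0 d = (a.prodMap d : Module.End F (V × W)) := by
  refine LinearMap.ext fun x => Prod.ext ?_ ?_ <;> simp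

end Basic

section Blocks

variable {F : Type u} [Field F]
variable {V W Z : Type u} [AddCommGroup V] [Module F V] [AddCommGroup W] [Module F W]
  [AddCommGroup Z] [Module F Z]

theorem IsUU.prodMap_inv {E E' : Module.End F V} (h : E * E' = 1) (h' : E' * E = 1)
    (hu : IsUnit (1 + E)) : IsUU (E.prodMap E' : Module.End F (V × V)) := by
  obtain ⟨⟨e, κ, hk, hk'⟩, rfl : e = 1 + E⟩ := hu
  obtain ⟨g, hg⟩ : ∃ g, g = 1 - κ - κ := ⟨_, rfl⟩
  have h1 : E * g = E - 1 - g := by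
    have : E * κ = 1 - κ := by rw [← hk]; noncomm_ring
    rw [hg, mul_sub, mul_sub, this]; noncomm_ring
  have h2 : g * E = E - 1 - g := by
    have : κ * E = 1 - κ := by rw [← hk']; noncomm_ring
    rw [hg, sub_mul, sub_mul, this]; noncomm_ring
  have h3 : E' * g = 1 - E' - g := by
    have : E' * (E * g) = E' * (E - 1 - g) := by rw [h1]
    rw [← mul_assoc, h', one_mul, mul_sub, mul_sub, h', mul_one] at this
    rw [eq_sub_iff_add_eq] at this ⊢
    rw [add_comm, this]
  have h4 : g * E' = 1 - E' - g := by
    have : (g * E) * E' = (E - 1 - g) * E' := by rw [h2]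
    rw [mul_assoc, h, mul_one, sub_mul, sub_mul, h, one_mul] at this
    rw [eq_sub_iff_add_eq] at this ⊢
    rw [add_comm, this]
  have h1' : ∀ x, E * (g * x) = E * x - x - g * x := fun x => by
    rw [← mul_assoc, h1, sub_mul, sub_mul, one_mul]
  have h3' : ∀ x, E' * (g * x) = x - E' * x - g * x := fun x => by
    rw [← mul_assoc, h3, sub_mul, sub_mul, one_mul]
  refine ⟨blk (1 + g) (-E) (E' * (g * g)) (1 - g), blk (1 + g) 1 (-(g * g)) (1 - g), ?_, ?_, ?_⟩
  · rw [← blk_one, blk_sub, blk_mul, ← blk_zero]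
    congr 1 <;> simp only [← Module.End.mul_eq_comp, mul_add, add_mul, mul_sub, sub_mul, mul_one,
      one_mul, mul_assoc, neg_mul, mul_neg, h1, h2, h3, h4, h1', h3', h, h',
      sub_zero] <;> abel
  · rw [← blk_one, blk_sub, blk_mul, ← blk_zero]
    congr 1 <;> simp only [← Module.End.mul_eq_comp, mul_add, add_mul, mul_sub, sub_mul, mul_one,
      one_mul, mul_assoc, neg_mul, mul_neg, sub_zero] <;> abel
  · rw [blk_mul, ← blk_diag]
    congr 1 <;> simp only [← Module.End.mul_eq_comp, mul_add, add_mul, mul_sub, sub_mul, mul_one,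
      one_mul, mul_assoc, neg_mul, mul_neg, h1, h3, h1', h3'] <;> abel

theorem IsUU.companion (k k' Z : Module.End F V) (h : k * k' = 1) (h' : k' * k = 1) :
    IsUU (blk 0 (-k') k Z) := by
  have h5 : ∀ x, k * (k' * x) = x := fun x => by rw [← mul_assoc, h, one_mul]
  -- `[[0, -k'], [k, Z]] = [[2 - k' Z k, -k'], [k - Z (2 - ..), Z]] * [[1, 0], [k (2 - Z), 1]]`
  refine ⟨blk (2 - k' * Z * k) (-k') (k - Z * (2 * k - Z * k)) Z,
    blk 1 0 (2 * k - Z * k) 1, ?_, ?_, ?_⟩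
  · rw [← blk_one, blk_sub, blk_mul, ← blk_zero]
    congr 1 <;> simp only [← Module.End.mul_eq_comp, mul_add, add_mul, mul_sub, sub_mul, mul_one,
      one_mul, mul_assoc, neg_mul, mul_neg, h, h', h5, ← one_add_one_eq_two,
      sub_zero] <;> abel
  · rw [← blk_one, blk_sub, blk_mul, ← blk_zero]
    congr 1 <;> simp
  · rw [blk_mul]
    congr 1 <;> simp only [← Module.End.mul_eq_comp, mul_add, add_mul, mul_sub, mul_one,
      one_mul, mul_assoc, neg_mul, h', ← one_add_one_eq_two, mul_zero] <;> abel

end Blocks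

section Factor

variable {F : Type u} [Field F]
variable {V W Z : Type u} [AddCommGroup V] [Module F V] [AddCommGroup W] [Module F W]
  [AddCommGroup Z] [Module F Z]

theorem Sim.upper {e : Module.End F V} {f : W →ₗ[F] V} {t : Module.End F W} (y : W →ₗ[F] V)
    (h : e ∘ₗ y - y ∘ₗ t = f) :
    Sim (blk e f 0 t) (e.prodMap t : Module.End F (V × W)) := by
  rw [← blk_diag]
  refine Sim.of_conj (p := blk 1 y 0 1) (q := blk 1 (-y) 0 1) ?_ ?_ ?_
  · rw [blk_mul, ← blk_one]; congr 1 <;> refine LinearMap.ext fun x => ?_ <;> simp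
  · rw [blk_mul, ← blk_one]; congr 1 <;> refine LinearMap.ext fun x => ?_ <;> simp
  · rw [blk_mul, blk_mul, ← h]; congr 1 <;> refine LinearMap.ext fun x => ?_ <;> simp

theorem Sim.lower {e : Module.End F V} {f : V →ₗ[F] W} {t : Module.End F W} (y : V →ₗ[F] W)
    (h : t ∘ₗ y - y ∘ₗ e = f) :
    Sim (blk e 0 f t) (e.prodMap t : Module.End F (V × W)) := by
  rw [← blk_diag]
  refine Sim.of_conj (p := blk 1 0 y 1) (q := blk 1 0 (-y) 1) ?_ ?_ ?_
  · rw [blk_mul, ← blk_one]; congr 1 <;> refine LinearMap.ext fun x => ?_ <;> simp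
  · rw [blk_mul, ← blk_one]; congr 1 <;> refine LinearMap.ext fun x => ?_ <;> simp
  · rw [blk_mul, blk_mul, ← h]; congr 1 <;> refine LinearMap.ext fun x => ?_ <;> simp

theorem exists_sylvester_left (n : Module.End F V) {u u' : Module.End F W} (hu : u' * u = 1)
    (N : ℕ) : ∀ f : W →ₗ[F] V, (n ^ N) ∘ₗ f = 0 → ∃ y : W →ₗ[F] V, n ∘ₗ y - y ∘ₗ u = f := by
  induction N with
  | zero => exact fun f hf => ⟨0, by simpa [Module.End.one_eq_id, eq_comm] using hf⟩
  | succ N ih =>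
    intro f hf
    obtain ⟨y, hy⟩ := ih (n ∘ₗ f ∘ₗ u') (by
      rw [← LinearMap.comp_assoc, ← Module.End.mul_eq_comp, ← pow_succ, ← LinearMap.comp_assoc,
        hf, LinearMap.zero_comp])
    refine ⟨y - f ∘ₗ u', ?_⟩
    refine LinearMap.ext fun x => ?_
    have h1 := LinearMap.congr_fun hy x
    have h2 := LinearMap.congr_fun hu x
    simp only [LinearMap.sub_apply, LinearMap.comp_apply, Module.End.mul_apply,
      Module.End.one_apply, map_sub] at h1 h2 ⊢
    rw [h2, sub_sub_sub_comm, h1]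
    abel

theorem exists_sylvester_right (n : Module.End F V) {u u' : Module.End F W} (hu : u * u' = 1)
    (N : ℕ) : ∀ f : V →ₗ[F] W, f ∘ₗ (n ^ N) = 0 → ∃ y : V →ₗ[F] W, u ∘ₗ y - y ∘ₗ n = f := by
  induction N with
  | zero => exact fun f hf => ⟨0, by simpa [Module.End.one_eq_id, eq_comm] using hf⟩
  | succ N ih =>
    intro f hf
    obtain ⟨y, hy⟩ := ih (u' ∘ₗ f ∘ₗ n) (by
      rw [LinearMap.comp_assoc, LinearMap.comp_assoc, ← Module.End.mul_eq_comp n, ← pow_succ',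
        hf, LinearMap.comp_zero])
    refine ⟨y + u' ∘ₗ f, ?_⟩
    refine LinearMap.ext fun x => ?_
    have h1 := LinearMap.congr_fun hy x
    have h2 := LinearMap.congr_fun hu (f x)
    simp only [LinearMap.sub_apply, LinearMap.add_apply, LinearMap.comp_apply,
      Module.End.mul_apply, Module.End.one_apply, map_add] at h1 h2 ⊢
    rw [h2, add_sub_add_comm, h1]
    abel

theorem Sim.upper_of_pow {e : Module.End F V} (f : W →ₗ[F] V) {t : Module.End F W} (c : F)
    {N : ℕ} (he : (e - c • 1) ^ N = 0) (ht : IsUnit (t - c • 1)) :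
    Sim (blk e f 0 t) (e.prodMap t : Module.End F (V × W)) := by
  obtain ⟨⟨u, u', h1, h2⟩, rfl : u = _⟩ := ht
  obtain ⟨y, hy⟩ := exists_sylvester_left (e - c • 1) h2 N f (by rw [he]; simp)
  refine Sim.upper y ?_
  rw [← hy]
  ext x
  simp

theorem Sim.lower_of_pow {e : Module.End F V} (f : V →ₗ[F] W) {t : Module.End F W} (c : F)
    {N : ℕ} (he : (e - c • 1) ^ N = 0) (ht : IsUnit (t - c • 1)) :
    Sim (blk e 0 f t) (e.prodMap t : Module.End F (V × W)) := by
  obtain ⟨⟨u, u', h1, h2⟩, rfl : u = _⟩ := ht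
  obtain ⟨y, hy⟩ := exists_sylvester_right (e - c • 1) h1 N f (by rw [he]; simp)
  refine Sim.lower y ?_
  rw [← hy]
  ext x
  simp

theorem Sim.expand {i : F} {A e : Module.End F V} {f : W →ₗ[F] V} {P : V →ₗ[F] W}
    (hA : A = e + f ∘ₗ P) (hi : IsUnit (A - i • 1)) :
    Sim (A.prodMap (i • 1) : Module.End F (V × W))
      (blk e f (P ∘ₗ (e - i • 1)) (P ∘ₗ f + i • 1)) := by
  obtain ⟨⟨u, u', h1, h2⟩, hu : u = _⟩ := hi
  refine (Sim.upper (f := f) (u' ∘ₗ f) ?_).symm.trans ?_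
  · refine LinearMap.ext fun x => ?_
    have h := LinearMap.congr_fun h1 (f x)
    simp only [hu, Module.End.mul_apply, LinearMap.sub_apply, LinearMap.smul_apply,
      Module.End.one_apply] at h
    simpa using h
  · refine Sim.of_conj (p := blk 1 0 P 1) (q := blk 1 0 (-P) 1) ?_ ?_ ?_
    · rw [blk_mul, ← blk_one]; congr 1 <;> refine LinearMap.ext fun x => ?_ <;> simp
    · rw [blk_mul, ← blk_one]; congr 1 <;> refine LinearMap.ext fun x => ?_ <;> simp
    · rw [blk_mul, blk_mul, hA]
      congr 1 <;> refine LinearMap.ext fun x => ?_ <;> simp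

theorem exists_factor {i : F} {A e e' : Module.End F V} {f : W →ₗ[F] V}
    {P : V →ₗ[F] W} {σ : Module.End F W} (he : e' * e = 1) (hA : A = e + f ∘ₗ P)
    (hi : IsUnit (A - i • 1)) (hσ : σ * σ = 1) (hP : σ ∘ₗ P = -P) :
    ∃ s : Module.End F (V × W), s * s = 1 ∧
      Sim (A.prodMap (i • 1) : Module.End F (V × W))
        (s * blk e f 0 (i • (σ * (1 + P ∘ₗ e' ∘ₗ f)))) := by
  have hσ' : ∀ x, σ (σ x) = x := LinearMap.congr_fun hσ
  have hP' : ∀ x, σ (P x) = -P x := LinearMap.congr_fun hP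
  have he' : ∀ x, e' (e x) = x := LinearMap.congr_fun he
  refine ⟨blk 1 0 (P ∘ₗ (1 - i • e')) σ, ?_, ?_⟩
  · rw [blk_mul, ← blk_one]
    congr 1 <;> refine LinearMap.ext fun x => ?_ <;> simp [hσ', hP']
  · refine (Sim.expand hA hi).trans ?_
    rw [blk_mul]
    convert Sim.refl _ using 2 <;> refine LinearMap.ext fun x => ?_ <;>
      simp [hσ', hP', he']

theorem IsSUU.of_conj {i : F} (hii : i * i = -1) {A e e' k k' : Module.End F V}
    (he : e' * e = 1) (hee : e * e' = 1) (hk : k * k' = 1) (hk' : k' * k = 1)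
    (hi : IsUnit (A - i • 1)) (h : e' * A = i • (k * e' * k')) :
    IsSUU (A.prodMap (i • 1) : Module.End F (V × V)) := by
  have he1 : ∀ x, e' (e x) = x := LinearMap.congr_fun he
  have he2 : ∀ x, e (e' x) = x := LinearMap.congr_fun hee
  have hk1 : ∀ x, k' (k x) = x := LinearMap.congr_fun hk'
  have hk2 : ∀ x, k (k' x) = x := LinearMap.congr_fun hk
  have h1 : ∀ x, k (e' (k' x)) = -i • e' (A x) := fun x => by
    have := LinearMap.congr_fun h x
    simp only [Module.End.mul_apply, LinearMap.smul_apply] at this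
    rw [this, smul_smul, neg_mul, hii, neg_neg, one_smul]
  refine IsSUU.sim (Sim.expand (e := e) (f := A - e) (P := 1)
    (by rw [Module.End.one_eq_id]; simp) hi).symm ?_
  obtain ⟨p, hp⟩ : ∃ p, p = 1 - i • e' := ⟨_, rfl⟩
  refine ⟨blk (-(e * k' * p)) (e * k') (k * e' - p * e * k' * p) (p * e * k'),
    blk 0 (-k') k (k * (e' * A - 1) - p * k'), ?_, IsUU.companion _ _ _ hk hk', ?_⟩
  · rw [blk_mul, ← blk_one]
    congr 1 <;> refine LinearMap.ext fun x => ?_ <;> simp [he1, he2, hk1, hk2]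
  · rw [blk_mul]
    congr 1 <;> refine LinearMap.ext fun x => ?_
    · simp [hk1]
    · simp [hk1, he2]
    · simp [hk1, hp, he1]
    · have h2 : p (A x) - p (e x) = A x - e x - i • e' (A x) + i • x := by
        simp [hp, he1]
        abel
      simp [hk1, he2, h1]
      linear_combination (norm := module) -h2

end Factor

section Regular

variable {F : Type u} [Field F]
variable {V W : Type u} [AddCommGroup V] [Module F V] [AddCommGroup W] [Module F W]

theorem linearIndependent_pow_apply {N : Module.End F V} {m : ℕ} (h : N ^ (m + 1) = 0) {v : V}
    (hv : (N ^ m) v ≠ 0) : LinearIndependent F fun j : Fin (m + 1) => (N ^ (j : ℕ)) v := by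
  rw [Fintype.linearIndependent_iff]
  intro g hg j
  induction j using WellFoundedLT.induction with
  | ind j ih =>
    have := congrArg (N ^ (m - (j : ℕ))) hg
    rw [map_sum, map_zero, Finset.sum_eq_single j] at this
    · rw [map_smul, ← Module.End.mul_apply, ← pow_add,
        Nat.sub_add_cancel (Nat.lt_succ_iff.1 j.2)] at this
      exact (smul_eq_zero.1 this).resolve_right hv
    · intro b _ hb
      rcases lt_or_gt_of_ne hb with hb | hb
      · simp [ih b hb]
      · have hle : m + 1 ≤ m - (j : ℕ) + b := by have := j.2; have : (j : ℕ) < b := hb; omega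
        rw [map_smul, ← Module.End.mul_apply, ← pow_add, ← Nat.sub_add_cancel hle, pow_add, h,
          mul_zero, LinearMap.zero_apply, smul_zero]
    · simp

/-- `N` is a nilpotent endomorphism with a single Jordan block, of size `m + 1`. -/
def IsJordan (m : ℕ) (N : Module.End F V) : Prop :=
  Module.finrank F V = m + 1 ∧ N ^ (m + 1) = 0 ∧ N ^ m ≠ 0

theorem IsJordan.sim {m : ℕ} {N : Module.End F V} {N' : Module.End F W} (h : IsJordan m N)
    (h' : IsJordan m N') : Sim N N' := by
  obtain ⟨hd, hN, hm⟩ := h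
  obtain ⟨hd', hN', hm'⟩ := h'
  obtain ⟨v, hv⟩ : ∃ v, (N ^ m) v ≠ 0 := by
    by_contra! hc; exact hm (LinearMap.ext hc)
  obtain ⟨w, hw⟩ : ∃ w, (N' ^ m) w ≠ 0 := by
    by_contra! hc; exact hm' (LinearMap.ext hc)
  let b := basisOfLinearIndependentOfCardEqFinrank (linearIndependent_pow_apply hN hv)
    (by simp [hd])
  let b' := basisOfLinearIndependentOfCardEqFinrank (linearIndependent_pow_apply hN' hw)
    (by simp [hd'])
  have hb : ∀ j : Fin (m + 1), b j = (N ^ (j : ℕ)) v := fun j => by simp [b]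
  have hb' : ∀ j : Fin (m + 1), b' j = (N' ^ (j : ℕ)) w := fun j => by simp [b']
  have key : ∀ j : ℕ, j ≤ m → b.equiv b' (Equiv.refl _) ((N ^ j) v) = (N' ^ j) w := by
    intro j hj
    rw [← hb ⟨j, Nat.lt_succ_of_le hj⟩, Module.Basis.equiv_apply, Equiv.refl_apply, hb']
  refine ⟨b.equiv b' (Equiv.refl _), fun x => ?_⟩
  suffices (b.equiv b' (Equiv.refl _)).toLinearMap ∘ₗ N =
      N' ∘ₗ (b.equiv b' (Equiv.refl _)).toLinearMap from LinearMap.congr_fun this x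
  refine b.ext fun j => ?_
  simp only [LinearMap.comp_apply, LinearEquiv.coe_coe]
  rw [hb, key _ (Nat.lt_succ_iff.1 j.2), ← Module.End.mul_apply, ← Module.End.mul_apply,
    ← pow_succ', ← pow_succ']
  rcases (Nat.lt_succ_iff.1 j.2).lt_or_eq with h | h
  · exact key _ h
  · rw [h, hN, hN']; simp

theorem IsJordan.sim_of_sub {m : ℕ} {c : F} {U : Module.End F V} {U' : Module.End F W}
    (h : IsJordan m (U - c • 1)) (h' : IsJordan m (U' - c • 1)) : Sim U U' := by
  obtain ⟨φ, hφ⟩ := h.sim h'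
  exact ⟨φ, fun x => by simpa using hφ x⟩

theorem IsJordan.inv {m : ℕ} {c c' : F} (hc : c' * c = 1) {U U' : Module.End F V}
    (h : IsJordan m (U - c • 1)) (hU : U * U' = 1) (hU' : U' * U = 1) :
    IsJordan m (U' - c' • 1) := by
  obtain ⟨hd, hN, hm⟩ := h
  have hcomm : Commute (-(c' • U')) (U - c • 1) := by
    refine Commute.neg_left (Commute.smul_left ?_ _)
    refine Commute.sub_right (hU'.trans hU.symm) ?_
    exact Commute.smul_right (Commute.one_right _) _
  have key : U' - c' • 1 = -(c' • U') * (U - c • 1) := by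
    rw [neg_mul, smul_mul_assoc, mul_sub, hU', mul_smul_comm, mul_one, smul_sub, smul_smul, hc,
      one_smul]
    abel
  refine ⟨hd, by rw [key, hcomm.mul_pow, hN, mul_zero], fun h0 => hm ?_⟩
  rw [key, hcomm.mul_pow] at h0
  have hunit : (-(c • U)) * (-(c' • U')) = 1 := by
    rw [neg_mul_neg, smul_mul_smul_comm, hU, mul_comm, hc, one_smul]
  have hunit' : (-(c' • U')) * (-(c • U)) = 1 := by
    rw [neg_mul_neg, smul_mul_smul_comm, hU', hc, one_smul]
  have := (show Commute (-(c • U)) (-(c' • U')) from hunit.trans hunit'.symm).mul_pow m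
  rw [hunit, one_pow] at this
  calc (U - c • 1) ^ m = (-(c • U)) ^ m * ((-(c' • U')) ^ m * (U - c • 1) ^ m) := by
        rw [← mul_assoc, ← this, one_mul]
    _ = 0 := by rw [h0, mul_zero]

theorem isUnit_of_sub_pow {c d : F} (hcd : c ≠ d) {U : Module.End F V} {m : ℕ}
    (h : (U - c • 1) ^ m = 0) : IsUnit (U - d • 1) := by
  have hn : IsNilpotent (U - c • 1) := ⟨m, h⟩
  have hu : IsUnit ((c - d) • (1 : Module.End F V)) :=
    ⟨⟨(c - d) • 1, (c - d)⁻¹ • 1, by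
      rw [smul_mul_smul_comm, mul_inv_cancel₀ (sub_ne_zero.2 hcd), one_smul, one_mul], by
      rw [smul_mul_smul_comm, inv_mul_cancel₀ (sub_ne_zero.2 hcd), one_smul, one_mul]⟩, rfl⟩
  have := hn.isUnit_add_left_of_commute hu (Commute.smul_right (Commute.one_right _) _)
  have e : U - d • 1 = (c - d) • 1 + (U - c • 1) := by rw [sub_smul]; abel
  rw [e]
  exact this

end Regular

section Nonscalar

variable {F : Type u} [Field F]
variable {V W : Type u} [AddCommGroup V] [Module F V] [AddCommGroup W] [Module F W]

theorem blk_lower_pow (a : Module.End F V) (l : V →ₗ[F] W) (k : ℕ) :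
    blk a 0 l 0 ^ (k + 1) = blk (a ^ (k + 1)) 0 (l ∘ₗ a ^ k) 0 := by
  induction k with
  | zero => simp only [pow_zero, zero_add, pow_one]; rfl
  | succ k ih =>
    rw [pow_succ, ih, blk_mul]
    congr 1 <;> refine LinearMap.ext fun x => ?_ <;> simp [pow_succ]

theorem blk_upper_pow (a : Module.End F V) (c : W →ₗ[F] V) (k : ℕ) :
    blk a c 0 0 ^ (k + 1) = blk (a ^ (k + 1)) ((a ^ k) ∘ₗ c) 0 0 := by
  induction k with
  | zero => simp only [pow_zero, zero_add, pow_one]; rfl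
  | succ k ih =>
    rw [pow_succ', ih, blk_mul]
    congr 1 <;> refine LinearMap.ext fun x => ?_ <;> simp [pow_succ']

theorem isUnit_smul_one {c : F} (hc : c ≠ 0) : IsUnit (c • (1 : Module.End F V)) :=
  ⟨⟨c • 1, c⁻¹ • 1, by
    rw [smul_mul_smul_comm, mul_inv_cancel₀ hc, one_smul, one_mul], by
    rw [smul_mul_smul_comm, inv_mul_cancel₀ hc, one_smul, one_mul]⟩, rfl⟩

theorem IsJordan.of_lower [FiniteDimensional F W] {m : ℕ} (hW : Module.finrank F W = m + 1)
    {L : Module.End F W} {l : W →ₗ[F] F}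
    (h : IsJordan (m + 1) (blk L 0 l (1 : Module.End F F) - (1 : F) • 1)) :
    IsJordan m (L - (1 : F) • 1) := by
  obtain ⟨-, h0, h1⟩ := h
  have e : blk L 0 l (1 : Module.End F F) - (1 : F) • 1 = blk (L - (1 : F) • 1) 0 l 0 := by
    rw [← blk_one, blk_smul, blk_sub]; congr 1 <;> simp
  rw [e, blk_lower_pow] at h0 h1
  have h2 : (L - (1 : F) • 1) ^ (m + 1 + 1) = 0 := by
    refine LinearMap.ext fun x => ?_
    simpa using congrArg Prod.fst (LinearMap.congr_fun h0 (x, 0))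
  have h3 : (L - (1 : F) • 1) ^ (m + 1) = 0 := by
    have := (show IsNilpotent (L - (1 : F) • 1) from ⟨_, h2⟩)
    have h5 := (L - (1 : F) • 1).aeval_self_charpoly
    rwa [this.charpoly_eq_X_pow_finrank, map_pow, Polynomial.aeval_X, hW] at h5
  refine ⟨hW, h3, fun h4 => h1 ?_⟩
  rw [h3, h4, LinearMap.comp_zero, blk_zero]

theorem exists_isJordan_upper [FiniteDimensional F W] {m : ℕ} {R : Module.End F W}
    (h : IsJordan m (R - (1 : F) • 1)) :
    ∃ κ : F →ₗ[F] W, IsJordan (m + 1) (blk R κ 0 (1 : Module.End F F) - (1 : F) • 1) := by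
  obtain ⟨hd, h0, h1⟩ := h
  obtain ⟨v, hv⟩ : ∃ v, ((R - (1 : F) • 1) ^ m) v ≠ 0 := by
    by_contra! hc; exact h1 (LinearMap.ext hc)
  refine ⟨LinearMap.toSpanSingleton F W v, ?_⟩
  have e : blk R (LinearMap.toSpanSingleton F W v) 0 (1 : Module.End F F) - (1 : F) • 1 =
      blk (R - (1 : F) • 1) (LinearMap.toSpanSingleton F W v) 0 0 := by
    rw [← blk_one, blk_smul, blk_sub]; congr 1 <;> simp
  rw [e]
  refine ⟨by simp [hd], ?_, fun h => hv ?_⟩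
  · rw [blk_upper_pow, h0, LinearMap.zero_comp, pow_succ, h0, zero_mul, blk_zero]
  · rw [blk_upper_pow] at h
    simpa using congrArg Prod.fst (LinearMap.congr_fun h (0, 1))

theorem Sim.inv {f f' : Module.End F V} {g g' : Module.End F W} (h : Sim f g)
    (hf : f * f' = 1) (hg : g' * g = 1) : Sim f' g' := by
  obtain ⟨φ, h⟩ := h
  refine ⟨φ, fun x => ?_⟩
  have h1 : f (f' x) = x := LinearMap.congr_fun hf x
  have h2 : g' (g (φ (f' x))) = φ (f' x) := LinearMap.congr_fun hg _
  rw [← h2, ← h, h1]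

theorem Sim.exists_conj {f g : Module.End F V} (h : Sim f g) :
    ∃ k k' : Module.End F V, k * k' = 1 ∧ k' * k = 1 ∧ g = k * f * k' := by
  obtain ⟨φ, h⟩ := h
  refine ⟨φ.toLinearMap, φ.symm.toLinearMap, ?_, ?_, ?_⟩ <;> refine LinearMap.ext fun x => ?_ <;>
    simp [h]

theorem IsSUU.of_sim_mul {f : Module.End F V} {s t : Module.End F W} (h : Sim f (s * t))
    (hs : s * s = 1) (ht : IsUU t ∨ IsUU (-t)) : IsSUU f := by
  refine IsSUU.sim h.symm ?_
  rcases ht with ht | ht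
  · exact ⟨s, t, hs, ht, rfl⟩
  · exact IsSUU.of_neg hs ht

theorem smul_sub_smul_one_pow {U : Module.End F V} {k : ℕ} (h : (U - (1 : F) • 1) ^ k = 0)
    (j : F) : (j • U - j • 1) ^ k = 0 := by
  have e : j • U - j • 1 = j • (U - (1 : F) • 1) := by
    refine LinearMap.ext fun x => ?_
    simp [smul_sub]
  rw [e, smul_pow, h, smul_zero]

theorem isUnit_smul_one_sub {c d : F} (h : c ≠ d) :
    IsUnit (c • 1 - d • 1 : Module.End F V) := by
  have e : (c • 1 - d • 1 : Module.End F V) = (c - d) • 1 := by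
    refine LinearMap.ext fun x => ?_
    simp [sub_smul]
  rw [e]
  exact isUnit_smul_one (sub_ne_zero.2 h)

theorem isUnit_one_add {U : Module.End F V} (h : IsUnit (U - (-1 : F) • 1)) :
    IsUnit (1 + U) := by
  have e : U - (-1 : F) • 1 = 1 + U := by
    refine LinearMap.ext fun x => ?_
    simp [add_comm]
  rwa [e] at h

theorem neg_smul_end (c : F) (f : Module.End F V) : -(c • f) = (-c) • f :=
  LinearMap.ext fun x => by simp

theorem Sim.isUnit_sub {f : Module.End F V} {g : Module.End F W} (h : Sim f g) {c : F}
    (hg : IsUnit (g - c • 1)) : IsUnit (f - c • 1) := by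
  obtain ⟨φ, h⟩ := h.symm
  have : f - c • 1 = φ.conjRingEquiv (g - c • 1) := conj_eq fun x => by simp [h]
  rw [this]
  exact hg.map φ.conjRingEquiv

theorem isUnit_prodMap_sub {f : Module.End F V} {g : Module.End F W} {c : F}
    (hf : IsUnit (f - c • 1)) (hg : IsUnit (g - c • 1)) :
    IsUnit ((f.prodMap g : Module.End F (V × W)) - c • 1) := by
  obtain ⟨⟨a, a', ha, ha'⟩, h1 : a = _⟩ := hf
  obtain ⟨⟨b, b', hb, hb'⟩, h2 : b = _⟩ := hg
  have : (f.prodMap g : Module.End F (V × W)) - c • 1 = a.prodMap b := by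
    rw [h1, h2]
    refine LinearMap.ext fun x => Prod.ext ?_ ?_ <;> simp
  rw [this]
  refine ⟨⟨a.prodMap b, a'.prodMap b', ?_, ?_⟩, rfl⟩
  · rw [LinearMap.prodMap_mul, ha, hb, LinearMap.prodMap_one]
  · rw [LinearMap.prodMap_mul, ha', hb', LinearMap.prodMap_one]

/-- A factorization of `C` into a unipotent lower-triangular matrix and an upper-triangular one,
as regular as possible. -/
structure IsRegularFactorization (m : ℕ) (C : Module.End F (W × F)) (L R : Module.End F W)
    (l : W →ₗ[F] F) (c : F →ₗ[F] W) (ρ : F) : Prop where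
  eq : C = blk L 0 l 1 * blk R c 0 (ρ • 1)
  left : IsJordan (m + 1) (blk L 0 l (1 : Module.End F F) - (1 : F) • 1)
  right : IsJordan m (R - (1 : F) • 1)

variable {i : F} {m : ℕ} {C : Module.End F (W × F)} {L R : Module.End F W}
  {l : W →ₗ[F] F} {c : F →ₗ[F] W} {ρ : F}

theorem exists_inv_of_unit {c : F} (hc : c ≠ 0) {U : Module.End F V} {k : ℕ}
    (h : (U - c • 1) ^ k = 0) : ∃ U', U * U' = 1 ∧ U' * U = 1 := by
  obtain ⟨⟨a, a', h1, h2⟩, rfl : a = _⟩ := isUnit_of_sub_pow hc h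
  exact ⟨a', by simpa using h1, by simpa using h2⟩

theorem IsRegularFactorization.isSUU_one [FiniteDimensional F W] (h2 : (2 : F) ≠ 0)
    (hii : i * i = -1)
    (h : IsRegularFactorization m C L R l c 1) (hu : IsUnit (i • C - i • 1)) :
    IsSUU ((i • C).prodMap (i • 1) : Module.End F ((W × F) × (W × F))) := by
  have hL := IsJordan.of_lower h.right.1 h.left
  have hne : (-1 : F) ≠ 1 := fun h => h2 (by linear_combination -h)
  have hu' : IsUnit ((-1 : Module.End F F) - (1 : F) • 1) := by
    have : (-1 : Module.End F F) - (1 : F) • 1 = (-2 : F) • 1 := by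
      refine LinearMap.ext fun x => ?_
      simp only [LinearMap.sub_apply, LinearMap.neg_apply, LinearMap.smul_apply,
        Module.End.one_apply, smul_eq_mul]
      ring
    rw [this]
    exact isUnit_smul_one (neg_ne_zero.2 h2)
  have sL := Sim.lower_of_pow l (1 : F) hL.2.1 hu'
  have sR := Sim.upper_of_pow c (1 : F) h.right.2.1 hu'
  obtain ⟨L', hL1, hL2⟩ := exists_inv_of_unit one_ne_zero hL.2.1
  obtain ⟨M, hM1, hM2⟩ := exists_inv_of_unit one_ne_zero h.left.2.1
  have hd : (blk 1 0 0 (-1) * blk 1 0 0 (-1) : Module.End F (W × F)) = 1 := by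
    rw [blk_mul, ← blk_one]; congr 1 <;> refine LinearMap.ext fun x => ?_ <;> simp
  have eL : blk L 0 l (-1) = blk L 0 l 1 * blk 1 0 0 (-1) := by
    rw [blk_mul]; congr 1 <;> refine LinearMap.ext fun x => ?_ <;> simp
  have eR : blk R c 0 (-1) = blk 1 0 0 (-1) * blk R c 0 ((1 : F) • 1) := by
    rw [blk_mul]; congr 1 <;> refine LinearMap.ext fun x => ?_ <;> simp
  have i1 : blk L 0 l (-1) * (blk 1 0 0 (-1) * M) = 1 := by
    rw [eL, mul_assoc, ← mul_assoc (blk 1 0 0 (-1)), hd, one_mul, hM1]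
  have i2 : (blk 1 0 0 (-1) * M) * blk L 0 l (-1) = 1 := by
    rw [eL, mul_assoc, ← mul_assoc M, hM2, one_mul, hd]
  have i3 : (L'.prodMap (-1) : Module.End F (W × F)) * L.prodMap (-1) = 1 := by
    rw [LinearMap.prodMap_mul, hL2]
    refine LinearMap.ext fun x => ?_
    simp
  have s3 := (hL.inv (c' := 1) (one_mul 1) hL1 hL2).sim_of_sub h.right
  obtain ⟨k, k', hk, hk', hkk⟩ :=
    (((sL.inv i1 i3).trans (s3.prodMap (Sim.refl _))).trans sR.symm).exists_conj
  refine IsSUU.of_conj hii (e := blk L 0 l (-1)) i2 i1 hk hk' hu ?_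
  rw [← hkk, mul_smul_comm, h.eq, eR, mul_assoc, ← mul_assoc M, hM2, one_mul]

theorem IsRegularFactorization.isSUU_neg_one [FiniteDimensional F W] (h2 : (2 : F) ≠ 0)
    (hii : i * i = -1)
    (h : IsRegularFactorization m C L R l c (-1)) (hu : IsUnit (i • C - i • 1)) :
    IsSUU ((i • C).prodMap (i • 1) : Module.End F ((W × F) × (W × F))) := by
  obtain ⟨κ, hκ⟩ := exists_isJordan_upper h.right
  obtain ⟨M, hM1, hM2⟩ := exists_inv_of_unit one_ne_zero h.left.2.1
  have hne : (-i : F) ≠ i := fun h => h2 (by linear_combination 2 * hii + i * h)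
  have hne' : (-i : F) ≠ -1 := fun h => h2 (by linear_combination hii + (i + 1) * h)
  have hM : ∀ x, M (blk L 0 l 1 x) = x := LinearMap.congr_fun hM2
  have hE : (-i • blk L 0 l 1 - (-i) • 1 : Module.End F (W × F)) ^ (m + 1 + 1) = 0 :=
    smul_sub_smul_one_pow h.left.2.1 _
  obtain ⟨s, hs, hsim⟩ := exists_factor (i := i) (A := i • C) (e := -i • blk L 0 l 1) (e' := i • M)
    (f := i • (blk L 0 l 1 ∘ₗ blk 1 0 0 0)) (P := blk R c 0 ((-1 : F) • 1) + 1)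
    (σ := blk (-1) κ 0 1) (by
      rw [smul_mul_smul_comm, mul_neg, hii, neg_neg, one_smul, hM2]) (by
      rw [h.eq]
      refine LinearMap.ext fun x => Prod.ext ?_ ?_
      · simp
      · simp
        ring) hu (by
      rw [blk_mul, ← blk_one]; congr 1 <;> refine LinearMap.ext fun x => ?_ <;> simp) (by
      refine LinearMap.ext fun x => Prod.ext ?_ ?_ <;> simp)
  refine IsSUU.of_sim_mul hsim hs (Or.inl ?_)
  have ht : (blk (-1) κ 0 1 * (1 + (blk R c 0 ((-1 : F) • 1) + 1) ∘ₗ (i • M) ∘ₗ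
      (i • (blk L 0 l 1 ∘ₗ blk 1 0 0 0))) : Module.End F (W × F)) = blk R κ 0 1 := by
    have : (i • M) ∘ₗ (i • (blk L 0 l 1 ∘ₗ blk 1 0 0 0)) =
        (-blk 1 0 0 0 : Module.End F (W × F)) := by
      refine LinearMap.ext fun x => ?_
      simp only [LinearMap.comp_apply, LinearMap.smul_apply, map_smul, hM, smul_smul, hii]
      simp
    rw [this]
    refine LinearMap.ext fun x => Prod.ext ?_ ?_ <;> simp
  rw [ht]
  have hT : (i • blk R κ 0 1 - i • 1 : Module.End F (W × F)) ^ (m + 1 + 1) = 0 :=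
    smul_sub_smul_one_pow hκ.2.1 _
  refine IsUU.sim (Sim.upper_of_pow _ (-i) hE (isUnit_of_sub_pow hne.symm hT)).symm ?_
  refine IsUU.sim ((Sim.refl _).prodMap
    (((h.left.inv (c' := 1) (one_mul 1) hM1 hM2).sim_of_sub hκ).smul i)) ?_
  refine IsUU.prodMap_inv ?_ ?_ ?_
  · rw [smul_mul_smul_comm, neg_mul, hii, neg_neg, one_smul, hM1]
  · rw [smul_mul_smul_comm, mul_neg, hii, neg_neg, one_smul, hM2]
  · exact isUnit_one_add (isUnit_of_sub_pow hne' hE)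

theorem IsRegularFactorization.sim_odd (hρ : ρ ≠ 1) (κ : F →ₗ[F] W)
    (hκ : IsJordan (m + 1) (blk R κ 0 (1 : Module.End F F) - (1 : F) • 1)) :
    Sim (blk (blk R c 0 (ρ • 1)) (LinearMap.inl F W F ∘ₗ κ) 0 1 : Module.End F ((W × F) × F))
      ((blk R κ 0 1 : Module.End F (W × F)).prodMap (ρ • 1) : Module.End F ((W × F) × F)) := by
  have hu : IsUnit ((ρ • 1 : Module.End F F) - (1 : F) • 1) := isUnit_smul_one_sub hρ
  refine Sim.trans ?_ (Sim.upper_of_pow (LinearMap.inl F W F ∘ₗ c) 1 hκ.2.1 hu)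
  refine ⟨(LinearEquiv.prodAssoc F W F F).trans
    (((LinearEquiv.refl F W).prodCongr (LinearEquiv.prodComm F F F)).trans
      (LinearEquiv.prodAssoc F W F F).symm), fun x => ?_⟩
  have h3 : ∀ y : W × F × F, (LinearEquiv.prodAssoc F W F F).symm y = ((y.1, y.2.1), y.2.2) :=
    fun _ => rfl
  simp [h3]
  abel

theorem IsRegularFactorization.isSUU_odd [FiniteDimensional F W] (h2 : (2 : F) ≠ 0)
    (hii : i * i = -1) (hρ : ρ = i ∨ ρ = -i)
    (h : IsRegularFactorization m C L R l c ρ) (hu : IsUnit (i • C - i • 1)) :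
    IsSUU ((i • C).prodMap (i • 1) : Module.End F ((W × F) × ((W × F) × F))) := by
  obtain ⟨κ, hκ⟩ := exists_isJordan_upper h.right
  obtain ⟨M, hM1, hM2⟩ := exists_inv_of_unit one_ne_zero h.left.2.1
  have hne : (-i : F) ≠ i := fun h => h2 (by linear_combination 2 * hii + i * h)
  have hne1 : (-i : F) ≠ -1 := fun h => h2 (by linear_combination hii + (i + 1) * h)
  have hne2 : (i : F) ≠ -1 := fun h => h2 (by linear_combination hii - (i - 1) * h)
  have hρ1 : ρ ≠ 1 := by
    rcases hρ with rfl | rfl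
    · exact fun h => hne1 (by rw [h])
    · exact fun h => hne2 (by rw [← h, neg_neg])
  have hiρ : i * ρ = -1 ∨ i * ρ = 1 := by
    rcases hρ with rfl | rfl
    · exact Or.inl hii
    · exact Or.inr (by linear_combination -hii)
  have hM : ∀ x, M (blk L 0 l 1 x) = x := LinearMap.congr_fun hM2
  have hE : ∀ j : F, (j • blk L 0 l 1 - j • 1 : Module.End F (W × F)) ^ (m + 1 + 1) = 0 :=
    smul_sub_smul_one_pow h.left.2.1
  obtain ⟨s, hs, hsim⟩ := exists_factor (i := i) (A := i • C) (e := -i • blk L 0 l 1) (e' := i • M)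
    (f := (i • C + i • blk L 0 l 1) ∘ₗ LinearMap.fst F (W × F) F) (P := LinearMap.inl F (W × F) F)
    (σ := blk (-1) (LinearMap.inl F W F ∘ₗ κ) 0 1) (by
      rw [smul_mul_smul_comm, mul_neg, hii, neg_neg, one_smul, hM2]) (by
      refine LinearMap.ext fun x => ?_
      simp only [LinearMap.add_apply, LinearMap.smul_apply, LinearMap.comp_apply,
        LinearMap.fst_apply, LinearMap.inl_apply, neg_smul]
      abel) hu (by
      refine LinearMap.ext fun x => Prod.ext (Prod.ext ?_ ?_) ?_ <;> simp) (by
      refine LinearMap.ext fun x => Prod.ext ?_ ?_ <;> simp)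
  refine IsSUU.of_sim_mul hsim hs ?_
  have ht : (blk (-1) (LinearMap.inl F W F ∘ₗ κ) 0 1 * (1 + LinearMap.inl F (W × F) F ∘ₗ
      (i • M) ∘ₗ ((i • C + i • blk L 0 l 1) ∘ₗ LinearMap.fst F (W × F) F)) :
        Module.End F ((W × F) × F)) =
      blk (blk R c 0 (ρ • 1)) (LinearMap.inl F W F ∘ₗ κ) 0 1 := by
    have : (i • M) ∘ₗ ((i • C + i • blk L 0 l 1) ∘ₗ LinearMap.fst F (W × F) F) =
        (-blk R c 0 (ρ • 1) - 1) ∘ₗ LinearMap.fst F (W × F) F := by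
      refine LinearMap.ext fun x => ?_
      simp only [LinearMap.comp_apply, LinearMap.smul_apply, LinearMap.add_apply, map_add, h.eq,
        Module.End.mul_apply, map_smul, hM, smul_smul, hii, LinearMap.sub_apply,
        LinearMap.neg_apply, Module.End.one_apply, neg_smul, one_smul]
      abel
    rw [this]
    refine LinearMap.ext fun x => Prod.ext (Prod.ext ?_ ?_) ?_ <;> simp
  rw [ht]
  have hT := smul_sub_smul_one_pow hκ.2.1 i
  have hiρ' : i * ρ ≠ -i := by
    rcases hiρ with h | h <;> rw [h]
    · exact fun h => hne1 h.symm
    · exact fun h => hne2 (by rw [h, neg_neg])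
  have hsim2 := (IsRegularFactorization.sim_odd (c := c) hρ1 κ hκ).smul i
  have e : i • ((blk R κ 0 1 : Module.End F (W × F)).prodMap (ρ • 1) :
      Module.End F ((W × F) × F)) = (i • blk R κ 0 1 : Module.End F (W × F)).prodMap
        ((i * ρ) • 1) := by
    refine LinearMap.ext fun x => ?_
    simp [mul_assoc]
  rw [e] at hsim2
  have hsimT := (Sim.upper_of_pow ((i • C + i • blk L 0 l 1) ∘ₗ LinearMap.fst F (W × F) F) (-i)
    (hE (-i)) (hsim2.isUnit_sub (isUnit_prodMap_sub (isUnit_of_sub_pow hne.symm hT)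
      (isUnit_smul_one_sub hiρ')))).trans (((Sim.refl _).prodMap hsim2).trans
        (Sim.prodAssoc _ _ _).symm)
  have hinv := ((h.left.inv (c' := 1) (one_mul 1) hM1 hM2).sim_of_sub hκ).symm
  have hsimT := hsimT.trans (((Sim.refl _).prodMap (hinv.smul i)).prodMap (Sim.refl _))
  rcases hiρ with hiρ | hiρ
  · refine Or.inr (IsUU.sim hsimT.symm.neg ?_)
    rw [neg_prodMap, neg_prodMap, hiρ, neg_smul_end, neg_smul_end, neg_smul_end, neg_neg, neg_neg,
      one_smul]
    refine IsUU.prodMap (IsUU.prodMap_inv ?_ ?_ (isUnit_one_add (isUnit_of_sub_pow hne2 (hE i))))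
      IsUU.one
    · rw [smul_mul_smul_comm, mul_neg, hii, neg_neg, one_smul, hM1]
    · rw [smul_mul_smul_comm, neg_mul, hii, neg_neg, one_smul, hM2]
  · refine Or.inl (IsUU.sim hsimT.symm ?_)
    rw [hiρ, one_smul]
    refine IsUU.prodMap (IsUU.prodMap_inv ?_ ?_ (isUnit_one_add (isUnit_of_sub_pow hne1 (hE _))))
      IsUU.one
    · rw [smul_mul_smul_comm, neg_mul, hii, neg_neg, one_smul, hM1]
    · rw [smul_mul_smul_comm, mul_neg, hii, neg_neg, one_smul, hM2]

end Nonscalar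

section Avoid

variable {F : Type u} [Field F] {V : Type u} [AddCommGroup V] [Module F V]

theorem exists_avoid_of_distinct {α : Type*} {P Q R : α → Prop}
    (hP : ∀ s t, P s → P t → s = t) (hQ : ∀ s t, Q s → Q t → s = t)
    (hR : ∀ s t, R s → R t → s = t) {a b c d : α} (ab : a ≠ b) (ac : a ≠ c) (ad : a ≠ d)
    (bc : b ≠ c) (bd : b ≠ d) (cd : c ≠ d) :
    ∃ t, (t = a ∨ t = b ∨ t = c ∨ t = d) ∧ ¬ P t ∧ ¬ Q t ∧ ¬ R t := by
  by_contra H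
  have h : ∀ t, (t = a ∨ t = b ∨ t = c ∨ t = d) → P t ∨ Q t ∨ R t := by
    intro t ht
    by_contra! h
    exact H ⟨t, ht, h⟩
  have h1 := h a (by simp)
  have h2 := h b (by simp)
  have h3 := h c (by simp)
  have h4 := h d (by simp)
  clear H h
  grind

theorem exists_avoid_scalar {i : F} (h2 : (2 : F) ≠ 0) (hii : i * i = -1) {P Q R : F → Prop}
    (hP : ∀ s t, P s → P t → s = t) (hQ : ∀ s t, Q s → Q t → s = t)
    (hR : ∀ s t, R s → R t → s = t) : ∃ t, t ≠ 0 ∧ ¬ P t ∧ ¬ Q t ∧ ¬ R t := by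
  have i0 : i ≠ 0 := by
    rintro rfl
    simp at hii
  have n1 : (1 : F) ≠ -1 := fun h => h2 (by linear_combination h)
  have n2 : (1 : F) ≠ i := fun h => h2 (by linear_combination hii + (1 + i) * h)
  have n3 : (1 : F) ≠ -i := fun h => h2 (by linear_combination hii + (1 - i) * h)
  have n4 : (-1 : F) ≠ i := fun h => h2 (by linear_combination hii + (i - 1) * h)
  have n5 : (-1 : F) ≠ -i := fun h => n2 (neg_injective h)
  have n6 : i ≠ -i := fun h => h2 (by linear_combination 2 * hii - i * h)
  obtain ⟨t, ht, h⟩ := exists_avoid_of_distinct hP hQ hR n1 n2 n3 n4 n5 n6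
  refine ⟨t, ?_, h⟩
  rcases ht with rfl | rfl | rfl | rfl
  · exact one_ne_zero
  · exact neg_ne_zero.2 one_ne_zero
  · exact i0
  · exact neg_ne_zero.2 i0

theorem eq_of_add_smul_mem {S : Submodule F V} {w x : V} (hw : w ∉ S) {s t : F}
    (hs : x + s • w ∈ S) (ht : x + t • w ∈ S) : s = t := by
  by_contra h
  have h1 := S.sub_mem hs ht
  rw [add_sub_add_left_eq_sub, ← sub_smul] at h1
  exact hw ((S.smul_mem_iff (sub_ne_zero.2 h)).1 h1)

theorem exists_avoid_step {i : F} (h2 : (2 : F) ≠ 0) (hii : i * i = -1) {S T U : Submodule F V}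
    {w : V} (hS : w ∉ S) (hT : w ∉ T) (hU : U ≠ ⊤) : ∃ x, x ∉ S ∧ x ∉ T ∧ x ∉ U := by
  by_cases hw : w ∈ U
  · obtain ⟨x, -, hx⟩ := SetLike.exists_of_lt (lt_top_iff_ne_top.2 hU)
    obtain ⟨t, -, h1, h3, -⟩ := exists_avoid_scalar h2 hii (P := fun t => x + t • w ∈ S)
      (Q := fun t => x + t • w ∈ T) (R := fun _ => False)
      (fun _ _ => eq_of_add_smul_mem hS) (fun _ _ => eq_of_add_smul_mem hT) (by simp)
    exact ⟨_, h1, h3, fun h => hx ((Submodule.add_mem_iff_left _ (U.smul_mem t hw)).1 h)⟩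
  · exact ⟨w, hS, hT, hw⟩

theorem exists_avoid {i : F} (h2 : (2 : F) ≠ 0) (hii : i * i = -1) {S T U : Submodule F V}
    (hS : S ≠ ⊤) (hT : T ≠ ⊤) (hU : U ≠ ⊤) : ∃ x, x ∉ S ∧ x ∉ T ∧ x ∉ U := by
  obtain ⟨x, -, hx⟩ := SetLike.exists_of_lt (lt_top_iff_ne_top.2 hS)
  obtain ⟨y, h1, -, h3⟩ := exists_avoid_step h2 hii hx hx hT
  exact exists_avoid_step h2 hii h1 h3 hU

theorem exists_functional {i : F} (h2 : (2 : F) ≠ 0) (hii : i * i = -1) {d x y z : V}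
    (hx : x ∉ F ∙ d) (hy : y ∉ F ∙ d) (hz : z ∉ F ∙ d) :
    ∃ f : V →ₗ[F] F, f d = 0 ∧ f x = 1 ∧ f y ≠ 0 ∧ f z ≠ 0 := by
  have key : ∀ x : V, x ∉ F ∙ d →
      (LinearMap.ker ((Module.Dual.eval F V x) ∘ₗ (F ∙ d).dualAnnihilator.subtype)) ≠ ⊤ := by
    intro x hx h
    obtain ⟨f, hf, hd⟩ := Submodule.exists_le_ker_of_notMem hx
    have hm : f ∈ (F ∙ d).dualAnnihilator :=
      (Submodule.mem_dualAnnihilator _).2 fun w hw => hd hw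
    have : (⟨f, hm⟩ : (F ∙ d).dualAnnihilator) ∈
        LinearMap.ker ((Module.Dual.eval F V x) ∘ₗ (F ∙ d).dualAnnihilator.subtype) := by
      rw [h]; trivial
    exact hf (by simpa using this)
  obtain ⟨f, hfx, hfy, hfz⟩ := exists_avoid (V := (F ∙ d).dualAnnihilator) h2 hii (key x hx)
    (key y hy) (key z hz)
  obtain ⟨f, hf⟩ := f
  have hfx : f x ≠ 0 := by simpa using hfx
  have hfy : f y ≠ 0 := by simpa using hfy
  have hfz : f z ≠ 0 := by simpa using hfz
  refine ⟨(f x)⁻¹ • f, ?_, ?_, ?_, ?_⟩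
  · simp [(Submodule.mem_dualAnnihilator _).1 hf d (Submodule.mem_span_singleton_self d)]
  · simp [hfx]
  · simp [hfx, hfy]
  · simp [hfx, hfz]

theorem exists_smul_of_forall_eigenvector {D : Module.End F V}
    (h : ∀ x, ∃ c : F, D x = c • x) : ∃ c : F, D = c • 1 := by
  choose c hc using h
  by_cases hV : ∀ x : V, x = 0
  · exact ⟨0, LinearMap.ext fun x => by simp [hV (D x)]⟩
  push Not at hV
  obtain ⟨z, hz⟩ := hV
  refine ⟨c z, LinearMap.ext fun x => ?_⟩
  rw [LinearMap.smul_apply, Module.End.one_apply]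
  by_cases hx : ∃ a : F, x = a • z
  · obtain ⟨a, rfl⟩ := hx
    rw [map_smul, hc, smul_comm]
  have e : (c (x + z) - c x) • x = (c z - c (x + z)) • z := by
    have h1 := hc (x + z)
    rw [map_add, hc x, hc z] at h1
    linear_combination (norm := module) -h1
  have e1 : c (x + z) - c x = 0 := by
    by_contra h0
    refine hx ⟨(c (x + z) - c x)⁻¹ * (c z - c (x + z)), ?_⟩
    rw [mul_smul, ← e, smul_smul, inv_mul_cancel₀ h0, one_smul]
  rw [e1, zero_smul, eq_comm, smul_eq_zero_iff_left hz] at e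
  rw [hc x, sub_eq_zero.1 e, sub_eq_zero.1 e1]

/-- A vector suitable for splitting off one dimension. -/
theorem exists_good_vector [FiniteDimensional F V] {i : F} (h2 : (2 : F) ≠ 0) (hii : i * i = -1)
    {D : Module.End F V} {u : V →ₗ[F] F} (hu : u ≠ 0) {v : V}
    (hv : ¬ LinearMap.range D ≤ F ∙ v) {z : V} (hz : ∀ c : F, D z ≠ c • z) :
    ∃ w, u w ≠ 0 ∧ D w ∉ F ∙ v ∧ (∀ c : F, D w ≠ c • w) ∧
      (LinearMap.ker D ≠ ⊥ → w ∉ LinearMap.range D) := by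
  have hS : LinearMap.ker u ≠ ⊤ := fun h => hu (LinearMap.ker_eq_top.1 h)
  have hT : (F ∙ v).comap D ≠ ⊤ := fun h => hv (LinearMap.range_le_iff_comap.2 h)
  by_cases hD : LinearMap.ker D = ⊥
  · obtain ⟨g, hg1, hg2, -⟩ := exists_avoid h2 hii hS hT hT
    by_cases hg : ∀ c : F, D g ≠ c • g
    · exact ⟨g, hg1, hg2, hg, fun h => (h hD).elim⟩
    push Not at hg
    obtain ⟨γ, hγ⟩ := hg
    have hg0 : g ≠ 0 := by
      rintro rfl
      exact hg1 (zero_mem _)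
    have hzg : ∀ a : F, z ≠ a • g := by
      rintro a rfl
      exact hz γ (by rw [map_smul, hγ, smul_comm])
    obtain ⟨t, -, ht1, ht2, ht3⟩ := exists_avoid_scalar h2 hii
      (P := fun t => z + t • g ∈ LinearMap.ker u) (Q := fun t => z + t • g ∈ (F ∙ v).comap D)
      (R := fun t => ∃ c : F, D (z + t • g) = c • (z + t • g))
      (fun _ _ => eq_of_add_smul_mem hg1) (fun _ _ => eq_of_add_smul_mem hg2) (by
        rintro s t ⟨c, hc⟩ ⟨d, hd⟩
        rw [map_add, map_smul, hγ] at hc hd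
        have e : (c - d) • z = (t * (d - γ) - s * (c - γ)) • g := by
          linear_combination (norm := module) hd - hc
        have e1 : c - d = 0 := by
          by_contra h0
          refine hzg ((c - d)⁻¹ * (t * (d - γ) - s * (c - γ))) ?_
          rw [mul_smul, ← e, smul_smul, inv_mul_cancel₀ h0, one_smul]
        rw [e1, zero_smul, eq_comm, smul_eq_zero_iff_left hg0] at e
        have e2 : (t - s) * (c - γ) = 0 := by linear_combination e + t * e1
        rcases mul_eq_zero.1 e2 with h | h
        · exact (sub_eq_zero.1 h).symm
        · refine absurd ?_ (hz c)
          rw [← sub_eq_zero.1 h] at hc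
          linear_combination (norm := module) hc)
    exact ⟨_, ht1, ht2, fun c hc => ht3 ⟨c, hc⟩, fun h => (h hD).elim⟩
  · obtain ⟨w, h1, h3, h4⟩ := exists_avoid h2 hii hS hT (U := LinearMap.range D)
      (fun h => hD (LinearMap.ker_eq_bot_iff_range_eq_top.2 h))
    refine ⟨w, h1, h3, fun c hc => ?_, fun _ => h4⟩
    by_cases hc0 : c = 0
    · exact h3 (by simp [hc, hc0])
    · exact h4 ⟨c⁻¹ • w, by rw [map_smul, hc, smul_smul, inv_mul_cancel₀ hc0, one_smul]⟩

end Avoid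

section Regular

variable {F : Type u} [Field F] {V V' Y Z : Type u} [AddCommGroup V] [Module F V]
  [AddCommGroup V'] [Module F V'] [AddCommGroup Y] [Module F Y] [AddCommGroup Z] [Module F Z]

/-- `C` is a product of a lower and an upper block triangular endomorphism on `W × F` for which
`φ v` is a cyclic vector of the lower factor and `u` is a cyclic functional of the unipotent part
of the upper factor. -/
def HasRegularFactorization (m : ℕ) (C : Module.End F V) (u : V →ₗ[F] F) (v : V) : Prop :=
  ∃ (W : Type u) (_ : AddCommGroup W) (_ : Module F W) (_ : FiniteDimensional F W)
    (φ : V ≃ₗ[F] W × F) (L R : Module.End F W) (l : W →ₗ[F] F) (c : F →ₗ[F] W) (ρ : F),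
    Module.finrank F W = m + 1 ∧
    (∀ x, φ (C x) = (blk L 0 l 1 * blk R c 0 (ρ • 1) : Module.End F (W × F)) (φ x)) ∧
    (blk L 0 l 1 - 1 : Module.End F (W × F)) ^ (m + 2) = 0 ∧
    ((blk L 0 l 1 - 1 : Module.End F (W × F)) ^ (m + 1)) (φ v) ≠ 0 ∧
    (R - 1) ^ (m + 1) = 0 ∧ ∃ x, u (φ.symm (((R - 1) ^ m) x, 0)) ≠ 0

theorem HasRegularFactorization.exists_isRegularFactorization {m : ℕ} {C : Module.End F V}
    {u : V →ₗ[F] F} {v : V} (h : HasRegularFactorization m C u v) :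
    ∃ (W : Type u) (_ : AddCommGroup W) (_ : Module F W) (_ : FiniteDimensional F W)
      (C' : Module.End F (W × F)) (L R : Module.End F W) (l : W →ₗ[F] F) (c : F →ₗ[F] W) (ρ : F),
      Sim C C' ∧ IsRegularFactorization m C' L R l c ρ := by
  obtain ⟨W, _, _, _, φ, L, R, l, c, ρ, hW, hC, hL, hv, hR, x, hx⟩ := h
  refine ⟨W, _, _, ‹_›, _, L, R, l, c, ρ, ⟨φ, hC⟩, rfl, ⟨?_, ?_, ?_⟩, ⟨hW, ?_, ?_⟩⟩
  · simp [hW]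
  · rw [one_smul]; exact hL
  · rw [one_smul]
    intro h
    exact hv (by rw [h, LinearMap.zero_apply])
  · rw [one_smul]; exact hR
  · rw [one_smul]
    intro h
    refine hx ?_
    rw [h, LinearMap.zero_apply]
    exact (congrArg u (map_zero φ.symm)).trans (map_zero u)

theorem HasRegularFactorization.of_equiv {m : ℕ} {C : Module.End F V} {C' : Module.End F V'}
    {u : V →ₗ[F] F} {v : V} (ψ : V ≃ₗ[F] V') (hψ : ∀ x, ψ (C x) = C' (ψ x))
    (h : HasRegularFactorization m C' (u ∘ₗ ψ.symm) (ψ v)) : HasRegularFactorization m C u v := by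
  obtain ⟨W, _, _, _, φ, L, R, l, c, ρ, hW, hC, hL, hv, hR, x, hx⟩ := h
  refine ⟨W, _, _, ‹_›, ψ.trans φ, L, R, l, c, ρ, hW, fun x => ?_, hL, hv, hR, x, hx⟩
  simp only [LinearEquiv.trans_apply, hψ, hC]

theorem pow_succ_apply_left {N : Module.End F Z} {N' : Module.End F Y} {v : Y}
    (θ : (F × Y) ≃ₗ[F] Z) (h : ∀ a y, N (θ (a, y)) = θ (0, a • v + N' y)) (k : ℕ) (a : F) (y : Y) :
    (N ^ (k + 1)) (θ (a, y)) = θ (0, (N' ^ k) (a • v + N' y)) := by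
  induction k with
  | zero => simp [h]
  | succ k ih => rw [pow_succ' N, Module.End.mul_apply, ih, h, zero_smul, zero_add,
      pow_succ' N', Module.End.mul_apply]

theorem pow_succ_apply_right {N : Module.End F (F × Y)} {N' : Module.End F Y} {f : Y →ₗ[F] F}
    (h : ∀ a y, N (a, y) = (f y, N' y)) (k : ℕ) (a : F) (y : Y) :
    (N ^ (k + 1)) (a, y) = (f ((N' ^ k) y), (N' ^ (k + 1)) y) := by
  induction k with
  | zero => simp [h]
  | succ k ih => rw [pow_succ' N, Module.End.mul_apply, ih, h, pow_succ' N' (k + 1),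
      Module.End.mul_apply]

theorem HasRegularFactorization.step {m : ℕ} {C' : Module.End F V'} {f : V' →ₗ[F] F} {v' : V'}
    {C : Module.End F (F × V')} (hC : ∀ a y, C (a, y) = (a + f y, (a + f y) • v' + C' y))
    {u : F × V' →ₗ[F] F} (hu : u (1, 0) ≠ 0) {v : F × V'} (hv : v.1 ≠ 0)
    (h : HasRegularFactorization m C' f v') : HasRegularFactorization (m + 1) C u v := by
  obtain ⟨W, _, _, _, φ, L, R, l, c, ρ, hW, hC', hL, hv', hR, x, hx⟩ := h
  let θ : (F × (W × F)) ≃ₗ[F] (F × W) × F := (LinearEquiv.prodAssoc F F W F).symm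
  have hθ : ∀ y, θ y = ((y.1, y.2.1), y.2.2) := fun _ => rfl
  let ψ : (F × V') ≃ₗ[F] (F × W) × F := ((LinearEquiv.refl F F).prodCongr φ).trans θ
  have hψ : ∀ y, ψ y = ((y.1, (φ y.2).1), (φ y.2).2) := fun _ => rfl
  have hψs : ∀ y, ψ.symm ((y : (F × W) × F)) = (y.1.1, φ.symm (y.1.2, y.2)) := fun _ => rfl
  let L₂ : Module.End F (F × W) := blk 1 0 (LinearMap.toSpanSingleton F W (φ v').1) L
  let l₂ : F × W →ₗ[F] F := (LinearMap.toSpanSingleton F F (φ v').2).coprod l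
  let R₂ : Module.End F (F × W) := blk 1 (f ∘ₗ φ.symm ∘ₗ LinearMap.inl F W F) 0 R
  let c₂ : F →ₗ[F] F × W := (f ∘ₗ φ.symm ∘ₗ LinearMap.inr F W F).prod c
  have hN : ∀ a y, (blk L₂ 0 l₂ 1 - 1 : Module.End F ((F × W) × F)) (θ (a, y)) =
      θ (0, a • φ v' + (blk L 0 l 1 - 1 : Module.End F (W × F)) y) := by
    rintro a ⟨y, s⟩
    simp [hθ, L₂, l₂, add_sub_assoc]
  have hN' : ∀ a y, (R₂ - 1) (a, y) = ((f ∘ₗ φ.symm ∘ₗ LinearMap.inl F W F) y, (R - 1) y) := by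
    intro a y
    simp [R₂]
  refine ⟨F × W, _, _, inferInstance, ψ, L₂, R₂, l₂, c₂, ρ, ?_, ?_, ?_, ?_, ?_, ?_⟩
  · simp [hW, add_comm]
  · rintro ⟨a, y⟩
    have e := hC' y
    have e2 : f y = f (φ.symm ((φ y).1, 0)) + f (φ.symm (0, (φ y).2)) := by
      rw [← map_add, ← map_add, Prod.mk_add_mk, add_zero, zero_add, Prod.mk.eta,
        LinearEquiv.symm_apply_apply]
    rw [hC, hψ, hψ]
    simp only [map_add, map_smul, e]
    generalize hs : f y = s at *
    refine Prod.ext (Prod.ext ?_ ?_) ?_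
    · simp [L₂, l₂, R₂, c₂, e2, add_assoc]
    · simp [L₂, l₂, R₂, c₂, e2, add_smul, add_assoc]
    · simp [L₂, l₂, R₂, c₂, e2, add_mul, add_assoc]
  · refine LinearMap.ext fun z => ?_
    obtain ⟨⟨a, y⟩, rfl⟩ := θ.surjective z
    rw [pow_succ_apply_left θ hN (m + 1 + 1), hL]
    exact map_zero θ
  · rw [show ψ v = θ (v.1, φ v.2) from rfl, pow_succ_apply_left θ hN (m + 1), map_add, map_smul,
      ← Module.End.mul_apply, ← pow_succ, hL, LinearMap.zero_apply, add_zero]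
    intro h
    rw [LinearEquiv.map_eq_zero_iff, Prod.mk_eq_zero, smul_eq_zero_iff_right hv] at h
    exact hv' h.2
  · refine LinearMap.ext fun z => ?_
    rw [← Prod.mk.eta (p := z), pow_succ_apply_right hN' (m + 1), pow_succ' _ (m + 1), hR, mul_zero]
    simp only [LinearMap.zero_apply, LinearMap.comp_apply, LinearMap.inl_apply,
      LinearEquiv.coe_coe]
    rw [← Prod.zero_eq_mk, map_zero, map_zero]
    rfl
  · refine ⟨(0, x), ?_⟩
    rw [pow_succ_apply_right hN' m, hR, hψs]
    have : ∀ s : F, u (s, 0) = s * u (1, 0) := fun s => by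
      rw [← smul_eq_mul, ← map_smul, Prod.smul_mk, smul_eq_mul, mul_one, smul_zero]
    simp only [LinearMap.zero_apply, LinearMap.comp_apply, LinearMap.inl_apply,
      LinearEquiv.coe_coe]
    rw [← Prod.zero_eq_mk, map_zero, this]
    exact mul_ne_zero hx hu

theorem HasRegularFactorization.base (e : V' ≃ₗ[F] F) {C' : Module.End F V'} {f : V' →ₗ[F] F}
    {v' : V'}
    {C : Module.End F (F × V')} (hC : ∀ a y, C (a, y) = (a + f y, (a + f y) • v' + C' y))
    {u : F × V' →ₗ[F] F} (hu : u (1, 0) ≠ 0) {v : F × V'} (hv : v.1 ≠ 0)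
    (hv' : v' ≠ 0) : HasRegularFactorization 0 C u v := by
  obtain ⟨ρ, hρ⟩ : ∃ ρ : F, ∀ y, e (C' y) = ρ * e y := by
    refine ⟨e (C' (e.symm 1)), fun y => ?_⟩
    have : y = e y • e.symm 1 := by
      rw [← map_smul, smul_eq_mul, mul_one, LinearEquiv.symm_apply_apply]
    conv_lhs => rw [this]
    rw [map_smul, map_smul, smul_eq_mul, mul_comm]
  refine ⟨F, _, _, inferInstance, (LinearEquiv.refl F F).prodCongr e, 1, 1,
    LinearMap.toSpanSingleton F F (e v'), f ∘ₗ e.symm, ρ, by simp, ?_, ?_, ?_, by simp, 1, ?_⟩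
  · rintro ⟨a, y⟩
    simp [hC, hρ, add_mul]
  · refine LinearMap.ext fun z => ?_
    refine Prod.ext ?_ ?_ <;> simp [pow_two]
  · simp [hv', hv]
  · simpa [LinearEquiv.prodCongr_symm] using hu

end Regular

section Splitting

variable {F : Type u} [Field F] {V : Type u} [AddCommGroup V] [Module F V]

theorem ker_ne_bot_of_finrank_lt {W : Type u} [AddCommGroup W] [Module F W]
    [FiniteDimensional F V] [FiniteDimensional F W]
    (f : V →ₗ[F] W) (h : Module.finrank F W < Module.finrank F V) : ∃ x, x ≠ 0 ∧ f x = 0 := by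
  obtain ⟨x, hx, hx0⟩ := (Submodule.ne_bot_iff _).1 (LinearMap.ker_ne_bot_of_finrank_lt h)
  exact ⟨x, hx0, hx⟩

theorem exists_compression {C : Module.End F V} {f : V →ₗ[F] F} {w : V} (hw : f w = 1)
    (hd : f ((C - 1) w) = 0) : ∃ C' : Module.End F (LinearMap.ker f),
      ∀ y, (C' y : V) = C y - f ((C - 1) y) • C w := by
  refine ⟨((C - LinearMap.toSpanSingleton F V (C w) ∘ₗ f ∘ₗ (C - 1)) ∘ₗ
    (LinearMap.ker f).subtype).codRestrict _ ?_, fun y => ?_⟩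
  · rintro ⟨y, hy⟩
    have hy : f y = 0 := hy
    have : f (C w) = 1 := by simpa [hw, sub_eq_zero] using hd
    simp [this, hy]
  · simp

theorem exists_splitting {f : V →ₗ[F] F} {w : V} (hw : f w = 1) :
    ∃ ψ : V ≃ₗ[F] F × LinearMap.ker f, (∀ x, (ψ x).1 = f x) ∧
      (∀ x, ((ψ x).2 : V) = x - f x • w) := by
  have hm : ∀ x, x - f x • w ∈ LinearMap.ker f := fun x => by simp [hw]
  refine ⟨LinearEquiv.ofLinearMap
    (f.prod ((LinearMap.id - LinearMap.toSpanSingleton F V w ∘ₗ f).codRestrict _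
      fun x => by simpa using hm x))
    ((LinearMap.toSpanSingleton F V w).coprod (LinearMap.ker f).subtype) ?_ ?_, ?_, ?_⟩
  · refine LinearMap.ext fun ⟨a, y, hy⟩ => Prod.ext ?_ (Subtype.ext ?_)
    · simpa [hw] using hy
    · have hy : f y = 0 := hy
      simp [hw, hy]
  · refine LinearMap.ext fun x => ?_
    simp
  · intro x; rfl
  · intro x; rfl

theorem splitting_apply {C : Module.End F V} {f : V →ₗ[F] F} {w : V} (hw : f w = 1)
    (hd : f ((C - 1) w) = 0) {C' : Module.End F (LinearMap.ker f)}
    (hC' : ∀ y, (C' y : V) = C y - f ((C - 1) y) • C w) {ψ : V ≃ₗ[F] F × LinearMap.ker f}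
    (h1 : ∀ x, (ψ x).1 = f x) (h2 : ∀ x, ((ψ x).2 : V) = x - f x • w) (v' : LinearMap.ker f)
    (hv' : (v' : V) = (C - 1) w) (x : V) :
    ψ (C x) = ((ψ x).1 + f ((C - 1) (ψ x).2), ((ψ x).1 + f ((C - 1) (ψ x).2)) • v' +
      C' (ψ x).2) := by
  have hw' : f (C w) = 1 := by simpa [hw, sub_eq_zero] using hd
  have e : f ((C - 1) (ψ x).2) = f (C x) - f x := by
    simp [h2, hw, hw']
  refine Prod.ext ?_ (Subtype.ext ?_)
  · simp only [e, h1]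
    ring
  · rw [h2]
    simp only [Submodule.coe_add, Submodule.coe_smul, hC', hv', h1, h2, LinearMap.sub_apply,
      Module.End.one_apply, map_sub, map_smul, hw, hw', smul_eq_mul]
    module

/-- If the compressions of `C` along two functionals which differ on `ker (f - g)` by a functional
vanishing on `w` and `C w` are both scalar, then `C` is not injective. -/
theorem not_both_scalar [FiniteDimensional F V] (h3 : 3 ≤ Module.finrank F V) {D : Module.End F V}
    (hC : ∀ x, D x = -x → x = 0) {f g : V →ₗ[F] F} {w : V} (hw : f w = 1) (hd : f (D w) = 0)
    (hD : D w ≠ 0) (hg : g w = 0) (hgd : g (D w) = 0) (hg0 : g ≠ 0) {γ δ : F}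
    (hγ : ∀ y, f y = 0 → D y - f (D y) • (w + D w) = γ • y)
    (hδ : ∀ y, (f + g) y = 0 → D y - (f + g) (D y) • (w + D w) = δ • y) : False := by
  obtain ⟨y₀, hy₀⟩ : ∃ y, g y ≠ 0 := by
    by_contra! h
    exact hg0 (LinearMap.ext h)
  obtain ⟨y, hy, hgy⟩ : ∃ y, f y = 0 ∧ g y = 1 := by
    refine ⟨(g y₀)⁻¹ • (y₀ - f y₀ • w), ?_, ?_⟩
    · simp [hw]
    · simp [hg, hy₀]
  have e1 := hγ y hy
  have e2 := hδ (y - w) (by simp [hy, hgy, hg, hw])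
  have e3 := congrArg g e1
  have e4 := congrArg g e2
  have e5 := congrArg f e1
  have e6 := congrArg f e2
  simp only [map_sub, map_smul, map_add, LinearMap.add_apply, smul_eq_mul, hw, hd, hg, hgd, hy,
    hgy] at e1 e2 e3 e4 e5 e6
  have e7 : γ = δ := by linear_combination e4 - e3
  subst e7
  have e8 : g (D y) = γ := by linear_combination e3
  have e9 : (1 + γ) • D w = 0 := by
    rw [e8] at e2
    linear_combination (norm := module) e1 - e2
  have e10 : γ = -1 := by
    have := (smul_eq_zero_iff_left hD).1 e9
    linear_combination this
  obtain ⟨x, hx0, hx⟩ := ker_ne_bot_of_finrank_lt (f.prod (f ∘ₗ D)) (by simp; lia)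
  have hx1 : f x = 0 := congrArg Prod.fst hx
  have hx2 : f (D x) = 0 := congrArg Prod.snd hx
  refine hx0 (hC x ?_)
  have := hγ x hx1
  rw [hx2, zero_smul, sub_zero, e10, neg_smul, one_smul] at this
  exact this

theorem exists_nonscalar_functional [FiniteDimensional F V] {i : F} (h2 : (2 : F) ≠ 0)
    (hii : i * i = -1) (h3 : 3 ≤ Module.finrank F V) {D : Module.End F V}
    (hC : ∀ x, D x = -x → x = 0) {w v y : V} (hv : v ∉ F ∙ D w) (hw : w ∉ F ∙ D w)
    (hy : D y ∉ F ∙ D w) (hD : D w ≠ 0) :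
    ∃ f : V →ₗ[F] F, f w = 1 ∧ f (D w) = 0 ∧ f v ≠ 0 ∧ f (D y) ≠ 0 ∧
      ¬ ∃ γ : F, ∀ y, f y = 0 → D y - f (D y) • (w + D w) = γ • y := by
  obtain ⟨f, hd, hw1, hfv, hfy⟩ := exists_functional h2 hii hw hv hy
  by_cases hs : ∃ γ : F, ∀ y, f y = 0 → D y - f (D y) • (w + D w) = γ • y
  swap
  · exact ⟨f, hw1, hd, hfv, hfy, hs⟩
  obtain ⟨γ, hγ⟩ := hs
  obtain ⟨g, hg0, hg⟩ := ker_ne_bot_of_finrank_lt (V := Module.Dual F V)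
    ((Module.Dual.eval F V w).prod (Module.Dual.eval F V (D w))) (by
      rw [Subspace.dual_finrank_eq]; simp; lia)
  have hg1 : g w = 0 := congrArg Prod.fst hg
  have hg2 : g (D w) = 0 := congrArg Prod.snd hg
  have key : ∀ x, f x ≠ 0 → ∀ s t : F, f x + s * g x = 0 → f x + t * g x = 0 → s = t := by
    intro x hx s t hs ht
    have : g x ≠ 0 := by
      intro h
      simp [h, hx] at hs
    exact mul_right_cancel₀ this (by linear_combination hs - ht)
  obtain ⟨t, ht, h4, h5, -⟩ := exists_avoid_scalar h2 hii (R := fun _ => False)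
    (key _ hfv) (key _ hfy) (by simp)
  refine ⟨f + t • g, by simp [hw1, hg1], by simp [hd, hg2], by simpa using h4, by simpa using h5,
    ?_⟩
  rintro ⟨δ, hδ⟩
  exact not_both_scalar h3 hC hw1 hd hD (g := t • g) (by simp [hg1]) (by simp [hg2])
    (smul_ne_zero ht hg0) hγ hδ

theorem notMem_span_comm {x y : V} (hx : x ≠ 0) (h : y ∉ F ∙ x) : x ∉ F ∙ y := by
  intro hxy
  obtain ⟨a, rfl⟩ := Submodule.mem_span_singleton.1 hxy
  have ha : a ≠ 0 := by
    rintro rfl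
    simp at hx
  exact h (Submodule.mem_span_singleton.2 ⟨a⁻¹, by rw [smul_smul, inv_mul_cancel₀ ha, one_smul]⟩)

theorem notMem_span_of_good {D : Module.End F V} {u : V →ₗ[F] F} {v w : V} (huw : u w ≠ 0)
    (hv : v ≠ 0) (hw1 : D w ∉ F ∙ v) (hw2 : ∀ c : F, D w ≠ c • w) :
    D w ≠ 0 ∧ w ∉ F ∙ D w ∧ v ∉ F ∙ D w := by
  refine ⟨fun h => hw1 (h ▸ zero_mem _), notMem_span_comm ?_ fun h => ?_, notMem_span_comm hv hw1⟩
  · rintro rfl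
    exact huw (map_zero u)
  · obtain ⟨c, hc⟩ := Submodule.mem_span_singleton.1 h
    exact hw2 c hc.symm

theorem HasRegularFactorization.of_splitting {m : ℕ} {C : Module.End F V} {u f : V →ₗ[F] F}
    {v w : V} (hw : f w = 1)
    (hd : f ((C - 1) w) = 0) {C' : Module.End F (LinearMap.ker f)}
    (hC' : ∀ y, (C' y : V) = C y - f ((C - 1) y) • C w) {ψ : V ≃ₗ[F] F × LinearMap.ker f}
    (h1 : ∀ x, (ψ x).1 = f x) (h2 : ∀ x, ((ψ x).2 : V) = x - f x • w) (huw : u w ≠ 0)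
    (hfv : f v ≠ 0)
    (H : ∀ {C'' : Module.End F (F × LinearMap.ker f)}
      (_ : ∀ a y, C'' (a, y) = (a + (f ∘ₗ (C - 1) ∘ₗ (LinearMap.ker f).subtype) y,
        (a + (f ∘ₗ (C - 1) ∘ₗ (LinearMap.ker f).subtype) y) •
          (⟨(C - 1) w, hd⟩ : LinearMap.ker f) + C' y))
      {u' : F × LinearMap.ker f →ₗ[F] F} (_ : u' (1, 0) ≠ 0) {v' : F × LinearMap.ker f}
      (_ : v'.1 ≠ 0), HasRegularFactorization m C'' u' v') :
    HasRegularFactorization m C u v := by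
  have e := splitting_apply hw hd hC' h1 h2 ⟨(C - 1) w, hd⟩ rfl
  have hψ : ψ.symm (1, 0) = w := by
    rw [LinearEquiv.symm_apply_eq]
    exact Prod.ext (by simp [h1, hw]) (Subtype.ext (by simp [h2, hw]))
  refine HasRegularFactorization.of_equiv (C' := ψ.conjRingEquiv C) ψ (fun x => by simp)
    (H (fun a y => ?_) ?_ ?_)
  · rw [LinearEquiv.conjRingEquiv_apply_apply, e, LinearEquiv.apply_symm_apply]
    rfl
  · simpa [hψ] using huw
  · rw [h1]; exact hfv

theorem exists_hasRegularFactorization {i : F} (h2 : (2 : F) ≠ 0) (hii : i * i = -1) (m : ℕ) :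
    ∀ (V : Type u) [AddCommGroup V] [Module F V] [FiniteDimensional F V] (C : Module.End F V)
      (u : V →ₗ[F] F) (v : V), Module.finrank F V = m + 2 → (∀ x, C x = 0 → x = 0) →
      Module.finrank F (LinearMap.ker (C - 1)) ≤ 1 → (∃ z, ∀ c : F, (C - 1) z ≠ c • z) →
      u ≠ 0 → v ≠ 0 → ¬ LinearMap.range (C - 1) ≤ F ∙ v → HasRegularFactorization m C u v := by
  induction m with
  | zero =>
    intro V _ _ _ C u v hV hC hk ⟨z, hz⟩ hu hv hr
    obtain ⟨w, huw, hw1, hw2, -⟩ := exists_good_vector h2 hii hu hr hz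
    obtain ⟨hD, hw3, hvD⟩ := notMem_span_of_good huw hv hw1 hw2
    obtain ⟨f, hd, hfw, hfv, -⟩ := exists_functional h2 hii hw3
      hvD hvD
    obtain ⟨C', hC'⟩ := exists_compression hfw hd
    obtain ⟨ψ, hψ1, hψ2⟩ := exists_splitting hfw
    have hker : Module.finrank F (LinearMap.ker f) = Module.finrank F F := by
      have := ψ.finrank_eq
      rw [Module.finrank_prod, hV, Module.finrank_self] at this
      rw [Module.finrank_self]
      lia
    exact HasRegularFactorization.of_splitting hfw hd hC' hψ1 hψ2 huw hfv
      fun hC _ hu _ hv => HasRegularFactorization.base (LinearEquiv.ofFinrankEq _ _ hker) hC hu hv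
        fun h => hD (congrArg Subtype.val h)
  | succ m ih =>
    intro V _ _ _ C u v hV hC hk ⟨z, hz⟩ hu hv hr
    obtain ⟨w, huw, hw1, hw2, hw4⟩ := exists_good_vector h2 hii hu hr hz
    obtain ⟨hD, hw3, hvD⟩ := notMem_span_of_good huw hv hw1 hw2
    obtain ⟨y₀, hy₀⟩ : ∃ y, (C - 1) y ∉ F ∙ (C - 1) w := by
      by_contra! h
      have h1 : LinearMap.range (C - 1) ≤ F ∙ (C - 1) w := by
        rintro _ ⟨y, rfl⟩
        exact h y
      have h3 := Submodule.finrank_mono h1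
      rw [finrank_span_singleton hD] at h3
      have := LinearMap.finrank_range_add_finrank_ker (C - 1)
      lia
    obtain ⟨f, hfw, hd, hfv, hfy, hns⟩ := exists_nonscalar_functional h2 hii (by lia)
      (D := C - 1) (fun x hx => hC x (by simpa using hx)) hvD
      hw3 hy₀ hD
    obtain ⟨C', hC'⟩ := exists_compression hfw hd
    obtain ⟨ψ, hψ1, hψ2⟩ := exists_splitting hfw
    have hker : Module.finrank F (LinearMap.ker f) = m + 2 := by
      have := ψ.finrank_eq
      rw [Module.finrank_prod, hV, Module.finrank_self] at this
      lia
    have hCw : C w = w + (C - 1) w := by simp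
    have hD' : ∀ y, ((C' - 1) y : LinearMap.ker f) =
        ((C - 1) y : V) - f ((C - 1) y) • (w + (C - 1) w) := by
      intro y
      rw [← hCw]
      simp only [LinearMap.sub_apply, Submodule.coe_sub, hC', Module.End.one_apply]
      abel
    have hf0 : f ∘ₗ (C - 1) ∘ₗ (LinearMap.ker f).subtype ≠ 0 := by
      intro h
      have := LinearMap.congr_fun h ⟨y₀ - f y₀ • w, by simp [hfw]⟩
      rw [LinearMap.comp_apply, LinearMap.comp_apply, Submodule.subtype_apply, map_sub, map_smul,
        map_sub, map_smul, hd, smul_zero, sub_zero] at this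
      exact hfy this
    have hih := ih (LinearMap.ker f) C' (f ∘ₗ (C - 1) ∘ₗ (LinearMap.ker f).subtype)
      ⟨(C - 1) w, hd⟩ hker ?_ ?_ ?_ hf0 (fun h => hD (congrArg Subtype.val h)) ?_
    rotate_left
    · intro y hy
      have h0 : C y - f ((C - 1) y) • C w = 0 := by rw [← hC', hy]; rfl
      rw [← map_smul, ← map_sub] at h0
      have h3 := sub_eq_zero.1 (hC _ h0)
      have h4 : f ((C - 1) y) = 0 := by
        have h5 : f y = 0 := y.2
        have h6 := congrArg f h3
        rw [h5, map_smul, hfw] at h6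
        simpa using h6.symm
      rw [h4, zero_smul] at h3
      exact Subtype.ext h3
    · by_cases hDk : LinearMap.ker (C - 1) = ⊥
      · have hm : ∀ y : LinearMap.ker (C' - 1),
            (C - 1) ((y : LinearMap.ker f) : V) ∈ F ∙ (w + (C - 1) w) := by
          intro y
          have h0 := hD' y
          rw [LinearMap.mem_ker.1 y.2] at h0
          exact Submodule.mem_span_singleton.2 ⟨_, (sub_eq_zero.1 h0.symm).symm⟩
        have hinj := LinearMap.finrank_le_finrank_of_injective
          (f := (((C - 1) ∘ₗ (LinearMap.ker f).subtype ∘ₗ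
            (LinearMap.ker (C' - 1)).subtype).codRestrict _ hm)) (by
              intro a b hab
              exact Subtype.ext (Subtype.ext
                (LinearMap.ker_eq_bot.1 hDk (congrArg Subtype.val hab))))
        exact hinj.trans (finrank_span_le_card _ |>.trans (by simp))
      · have hm : ∀ y : LinearMap.ker (C' - 1),
            ((y : LinearMap.ker f) : V) ∈ LinearMap.ker (C - 1) := by
          intro y
          have h0 := hD' y
          rw [LinearMap.mem_ker.1 y.2] at h0
          have h1 : f ((C - 1) (y : LinearMap.ker f)) • w ∈ LinearMap.range (C - 1) := by
            refine ⟨y - f ((C - 1) (y : LinearMap.ker f)) • w, ?_⟩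
            rw [map_sub, map_smul, eq_comm]
            have h00 : (0 : V) = _ := h0
            linear_combination (norm := module) h00
          have h3 : f ((C - 1) (y : LinearMap.ker f)) = 0 := by
            by_contra h
            exact hw4 hDk ((Submodule.smul_mem_iff _ h).1 h1)
          rw [h3, zero_smul, sub_zero] at h0
          exact h0.symm
        have hinj := LinearMap.finrank_le_finrank_of_injective
          (f := (((LinearMap.ker f).subtype ∘ₗ
            (LinearMap.ker (C' - 1)).subtype).codRestrict _ hm)) (by
              intro a b hab
              exact Subtype.ext (Subtype.ext (congrArg (LinearMap.ker (C - 1)).subtype hab)))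
        exact hinj.trans hk
    · by_contra! h
      obtain ⟨γ, hγ⟩ := exists_smul_of_forall_eigenvector h
      refine hns ⟨γ, fun y hy => ?_⟩
      rw [← hD' ⟨y, hy⟩, hγ]
      rfl
    · intro h
      have hm : ∀ y : LinearMap.ker f, ∃ a : F, (C - 1) (y : V) =
          f ((C - 1) y) • (w + (C - 1) w) + a • (C - 1) w := by
        intro y
        obtain ⟨a, ha⟩ := Submodule.mem_span_singleton.1 (h ⟨y, rfl⟩)
        refine ⟨a, ?_⟩
        have h0 := hD' y
        rw [← ha, Submodule.coe_smul] at h0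
        linear_combination (norm := module) -h0
      by_cases hDk : LinearMap.ker (C - 1) = ⊥
      · have h1 : (⊤ : Submodule F V) ≤ Submodule.span F {w, (C - 1) w} := by
          rw [← (LinearMap.ker_eq_bot_iff_range_eq_top.1 hDk)]
          rintro _ ⟨y, rfl⟩
          obtain ⟨a, ha⟩ := hm ⟨y - f y • w, by simp [hfw]⟩
          refine Submodule.mem_span_pair.2 ⟨f ((C - 1) (y - f y • w)),
            f ((C - 1) (y - f y • w)) + a + f y, ?_⟩
          have hms : (C - 1) (y - f y • w) = (C - 1) y - f y • (C - 1) w := by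
            rw [map_sub, map_smul]
          simp only [hms] at ha ⊢
          linear_combination (norm := module) -ha
        have h3 := Submodule.finrank_mono h1
        rw [finrank_top, hV] at h3
        classical
        have h4 := finrank_span_finset_le_card (R := F) {w, (C - 1) w}
        rw [Finset.coe_pair] at h4
        have h5 := Finset.card_le_two (a := w) (b := (C - 1) w)
        rw [Set.finrank] at h4
        lia
      · refine hf0 (LinearMap.ext fun y => ?_)
        obtain ⟨a, ha⟩ := hm y
        rw [LinearMap.zero_apply, LinearMap.comp_apply, LinearMap.comp_apply,
          Submodule.subtype_apply]
        by_contra h0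
        refine hw4 hDk ((Submodule.smul_mem_iff _ h0).1 ⟨y - (f ((C - 1) y) + a) • w, ?_⟩)
        rw [map_sub, map_smul]
        linear_combination (norm := module) ha
    exact HasRegularFactorization.of_splitting hfw hd hC' hψ1 hψ2 huw hfv
      fun hC _ hu _ hv => HasRegularFactorization.step hC hu hv hih

end Splitting

section SimDet

variable {F : Type u} [Field F] {V W : Type u} [AddCommGroup V] [Module F V] [AddCommGroup W]
  [Module F W]

theorem Sim.det_eq {f : Module.End F V} {g : Module.End F W} (h : Sim f g) :
    LinearMap.det f = LinearMap.det g := by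
  obtain ⟨φ, h⟩ := h
  rw [← LinearMap.det_conj f φ]
  congr 1
  refine LinearMap.ext fun x => ?_
  simp [h]

theorem isUnit_sub_one_of_eq_smul {i : F} (hii : i * i = -1) {A C : Module.End F V} (hA : A = i • C)
    (h1 : IsUnit (A - i • 1)) (hs : ∀ c : F, A ≠ c • 1) :
    i ≠ 0 ∧ IsUnit (C - 1) ∧ ∀ c : F, C ≠ c • 1 := by
  have i0 : i ≠ 0 := by
    rintro rfl
    simp at hii
  refine ⟨i0, ?_, fun c hc => hs (i * c) (by rw [hA, hc, smul_smul])⟩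
  have e : C - 1 = (i⁻¹ • (1 : Module.End F V)) * (A - i • 1) := by
    refine LinearMap.ext fun x => ?_
    simp [hA, i0, smul_sub]
  rw [e]
  exact (isUnit_smul_one (inv_ne_zero i0)).mul h1

end SimDet

section Determinant

variable {F : Type u} [Field F] {V W : Type u} [AddCommGroup V] [Module F V] [AddCommGroup W]
  [Module F W] [FiniteDimensional F V] [FiniteDimensional F W]

theorem det_eq_one_of_sub_pow {U : Module.End F V} {k : ℕ} (h : (U - (1 : F) • 1) ^ k = 0) :
    LinearMap.det U = 1 := by
  have h1 : IsNilpotent (U - (1 : F) • 1) := ⟨k, h⟩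
  have h2 := LinearMap.eval_charpoly (U - (1 : F) • 1) (-1)
  rw [h1.charpoly_eq_X_pow_finrank] at h2
  have e : algebraMap F (Module.End F V) (-1) - (U - (1 : F) • 1) = -U := by
    refine LinearMap.ext fun x => ?_
    simp
    abel
  rw [e, ← neg_one_smul F U, LinearMap.det_smul] at h2
  simp only [Polynomial.eval_pow, Polynomial.eval_X] at h2
  exact (mul_eq_left₀ (pow_ne_zero _ (neg_ne_zero.2 one_ne_zero))).1 h2.symm

theorem IsRegularFactorization.det_eq {m : ℕ} {C : Module.End F (W × F)} {L R : Module.End F W}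
    {l : W →ₗ[F] F} {c : F →ₗ[F] W} {ρ : F} (h : IsRegularFactorization m C L R l c ρ) :
    LinearMap.det C = ρ := by
  have e : (blk R c 0 (ρ • 1) : Module.End F (W × F)) =
      ((1 : Module.End F W).prodMap (ρ • 1) : Module.End F (W × F)) * blk R c 0 1 := by
    refine LinearMap.ext fun x => Prod.ext ?_ ?_ <;> simp
  have hR : (blk R c 0 1 - (1 : F) • 1 : Module.End F (W × F)) ^ (m + 1 + 1) = 0 := by
    have e2 : (blk R c 0 1 - (1 : F) • 1 : Module.End F (W × F)) = blk (R - (1 : F) • 1) c 0 0 := by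
      refine LinearMap.ext fun x => Prod.ext ?_ ?_ <;> simp
      abel
    rw [e2, blk_upper_pow, pow_succ, h.right.2.1, zero_mul, LinearMap.zero_comp, blk_zero]
  rw [h.eq, e, map_mul, map_mul, det_eq_one_of_sub_pow h.left.2.1, det_eq_one_of_sub_pow hR,
    LinearMap.det_prodMap, map_one, one_mul, one_mul, mul_one, LinearMap.det_smul, map_one]
  simp

/-- The conclusion of `exists_isRegularFactorization` for a nonscalar endomorphism without
eigenvalue `1`. -/
theorem exists_isRegularFactorization_of_nonscalar {i : F} (h2 : (2 : F) ≠ 0) (hii : i * i = -1)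
    {C : Module.End F V} (hC : LinearMap.det C ≠ 0) (h1 : IsUnit (C - 1))
    (hs : ∀ c : F, C ≠ c • 1) :
    ∃ (m : ℕ) (W : Type u) (_ : AddCommGroup W) (_ : Module F W) (_ : FiniteDimensional F W)
      (C' : Module.End F (W × F)) (L R : Module.End F W) (l : W →ₗ[F] F) (c : F →ₗ[F] W),
      Sim C C' ∧ IsRegularFactorization m C' L R l c (LinearMap.det C) := by
  obtain ⟨z, hz⟩ : ∃ z, ∀ c : F, (C - 1) z ≠ c • z := by
    by_contra! h
    obtain ⟨c, hc⟩ := exists_smul_of_forall_eigenvector h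
    refine hs (c + 1) ?_
    rw [add_smul, one_smul, ← hc, sub_add_cancel]
  have hz0 : z ≠ 0 := by
    rintro rfl
    exact hz 0 (by simp)
  have hker : LinearMap.ker (C - 1) = ⊥ := LinearMap.ker_eq_bot.2
    ((Module.End.isUnit_iff _).1 h1).injective
  have hspan : ¬ LinearMap.range (C - 1) ≤ F ∙ z := by
    intro h
    obtain ⟨c, hc⟩ := Submodule.mem_span_singleton.1 (h ⟨z, rfl⟩)
    exact hz c hc.symm
  have hdim : 1 < Module.finrank F V := by
    by_contra! h
    have h3 : Module.finrank F (F ∙ z) = 1 := finrank_span_singleton hz0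
    have h4 := Submodule.finrank_le (F ∙ z)
    refine hspan (le_top.trans_eq (Submodule.eq_top_of_finrank_eq ?_).symm)
    lia
  obtain ⟨m, hm⟩ := Nat.exists_eq_add_of_le' hdim
  have hz1 : z ∉ F ∙ (0 : V) := by simpa using hz0
  obtain ⟨u, -, hu, -⟩ := exists_functional h2 hii hz1 hz1 hz1
  obtain ⟨W, _, _, _, C', L, R, l, c, ρ, hsim, hreg⟩ :=
    (exists_hasRegularFactorization h2 hii m V C u z (by lia)
      (fun x hx => by
        exact LinearMap.ker_eq_bot'.1
          (by_contra fun h => hC (LinearMap.det_eq_zero_iff_ker_ne_bot.2 h)) x hx)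
      (by rw [hker, finrank_bot]; exact zero_le_one) ⟨z, hz⟩ (by rintro rfl; simp at hu) hz0
      hspan).exists_isRegularFactorization
  refine ⟨m, W, _, _, ‹_›, C', L, R, l, c, hsim, ?_⟩
  rwa [hsim.det_eq, hreg.det_eq]

theorem isSUU_nonscalar_even {i : F} (h2 : (2 : F) ≠ 0) (hii : i * i = -1)
    {A C : Module.End F V} (hA : A = i • C) (h1 : IsUnit (A - i • 1)) (hs : ∀ c : F, A ≠ c • 1)
    (hdet : LinearMap.det C = 1 ∨ LinearMap.det C = -1) :
    IsSUU (A.prodMap (i • 1) : Module.End F (V × V)) := by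
  obtain ⟨-, hC1, hCs⟩ := isUnit_sub_one_of_eq_smul hii hA h1 hs
  obtain ⟨m, W, _, _, _, C', L, R, l, c, hsim, hreg⟩ :=
    exists_isRegularFactorization_of_nonscalar h2 hii
      (by rcases hdet with h | h <;> simp [h]) hC1 hCs
  have hsimA : Sim A (i • C') := hA ▸ hsim.smul i
  have hu : IsUnit (i • C' - i • 1) := hsimA.symm.isUnit_sub h1
  have hfin : Module.finrank F V = Module.finrank F (W × F) := by
    obtain ⟨φ, -⟩ := hsim
    exact φ.finrank_eq
  refine IsSUU.sim (hsimA.prodMap (Sim.smul_one hfin i)).symm ?_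
  rcases hdet with h | h
  · rw [h] at hreg
    exact hreg.isSUU_one h2 hii hu
  · rw [h] at hreg
    exact hreg.isSUU_neg_one h2 hii hu

theorem isSUU_nonscalar_odd {i : F} (h2 : (2 : F) ≠ 0) (hii : i * i = -1)
    {A C : Module.End F V} (hA : A = i • C) (h1 : IsUnit (A - i • 1)) (hs : ∀ c : F, A ≠ c • 1)
    (hdet : LinearMap.det C = i ∨ LinearMap.det C = -i) :
    IsSUU (A.prodMap (i • 1) : Module.End F (V × (V × F))) := by
  obtain ⟨hC0, hC1, hCs⟩ := isUnit_sub_one_of_eq_smul hii hA h1 hs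
  obtain ⟨m, W, _, _, _, C', L, R, l, c, hsim, hreg⟩ :=
    exists_isRegularFactorization_of_nonscalar h2 hii
      (by rcases hdet with h | h <;> simp [h, hC0]) hC1 hCs
  have hsimA : Sim A (i • C') := hA ▸ hsim.smul i
  have hu : IsUnit (i • C' - i • 1) := hsimA.symm.isUnit_sub h1
  have hfin : Module.finrank F (V × F) = Module.finrank F ((W × F) × F) := by
    obtain ⟨φ, -⟩ := hsim
    exact (φ.prodCongr (LinearEquiv.refl F F)).finrank_eq
  refine IsSUU.sim (hsimA.prodMap (Sim.smul_one hfin i)).symm ?_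
  exact hreg.isSUU_odd h2 hii hdet hu

end Determinant

section Reduction

variable {F : Type u} [Field F] {V W Y Z Z' : Type u} [AddCommGroup V] [Module F V]
  [AddCommGroup W] [Module F W] [AddCommGroup Y] [Module F Y] [AddCommGroup Z] [Module F Z]
  [AddCommGroup Z'] [Module F Z']

/-- Up to similarity, `α I_a ⊕ i I_b` is the product of an involution and `T`. -/
def Reduces (α i : F) (a b : ℕ) (T : Module.End F Z) : Prop :=
  ∃ s : Module.End F Z, s * s = 1 ∧
    Sim ((α • (1 : Module.End F (Fin a → F))).prodMap (i • (1 : Module.End F (Fin b → F))) :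
      Module.End F ((Fin a → F) × (Fin b → F))) (s * T)

variable {α i : F} {a b a' b' : ℕ}

theorem sim_scalar_prod (α i : F) [FiniteDimensional F V] [FiniteDimensional F W]
    (hV : Module.finrank F V = a) (hW : Module.finrank F W = b) :
    Sim ((α • (1 : Module.End F (Fin a → F))).prodMap (i • (1 : Module.End F (Fin b → F))) :
      Module.End F ((Fin a → F) × (Fin b → F)))
      ((α • (1 : Module.End F V)).prodMap (i • (1 : Module.End F W)) : Module.End F (V × W)) :=
  (Sim.smul_one (by simp [hV]) α).prodMap (Sim.smul_one (by simp [hW]) i)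

theorem Reduces.of_finrank [FiniteDimensional F V] [FiniteDimensional F W]
    (hV : Module.finrank F V = a) (hW : Module.finrank F W = b) {s T : Module.End F Z}
    (hs : s * s = 1)
    (h : Sim ((α • (1 : Module.End F V)).prodMap (i • (1 : Module.End F W)) :
      Module.End F (V × W)) (s * T)) : Reduces α i a b T :=
  ⟨s, hs, (sim_scalar_prod α i hV hW).trans h⟩

theorem Reduces.sim {T : Module.End F Z} {T' : Module.End F Z'} (h : Reduces α i a b T)
    (hT : Sim T T') : Reduces α i a b T' := by
  obtain ⟨s, hs, h⟩ := h
  obtain ⟨φ, hφ⟩ := hT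
  refine ⟨φ.conjRingEquiv s, by rw [← map_mul, hs, map_one], h.trans ⟨φ, fun x => ?_⟩⟩
  simp [← hφ]

theorem scalar_prod_add_sim (α i : F) (a b a' b' : ℕ) :
    Sim ((α • (1 : Module.End F (Fin (a + a') → F))).prodMap
        (i • (1 : Module.End F (Fin (b + b') → F))) :
          Module.End F ((Fin (a + a') → F) × (Fin (b + b') → F)))
      ((((α • (1 : Module.End F (Fin a → F))).prodMap (i • (1 : Module.End F (Fin b → F))) :
        Module.End F ((Fin a → F) × (Fin b → F)))).prodMap
      ((α • (1 : Module.End F (Fin a' → F))).prodMap (i • (1 : Module.End F (Fin b' → F))) :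
        Module.End F ((Fin a' → F) × (Fin b' → F))) : Module.End F
          (((Fin a → F) × (Fin b → F)) × ((Fin a' → F) × (Fin b' → F)))) := by
  refine (sim_scalar_prod (V := (Fin a → F) × (Fin a' → F)) (W := (Fin b → F) × (Fin b' → F)) α i
    (by simp) (by simp)).trans ?_
  rw [smul_one_prod, smul_one_prod]
  exact Sim.prodProdProdComm _ _ _ _

theorem Reduces.add {T : Module.End F Z} {T' : Module.End F Z'} (h : Reduces α i a b T)
    (h' : Reduces α i a' b' T') :
    Reduces α i (a + a') (b + b') (T.prodMap T' : Module.End F (Z × Z')) := by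
  obtain ⟨s, hs, h⟩ := h
  obtain ⟨s', hs', h'⟩ := h'
  refine ⟨s.prodMap s', by rw [LinearMap.prodMap_mul, hs, hs', LinearMap.prodMap_one], ?_⟩
  rw [LinearMap.prodMap_mul]
  exact (scalar_prod_add_sim α i a b a' b').trans (h.prodMap h')

theorem Reduces.zero : Reduces α i 0 0 (0 : Module.End F PUnit.{u + 1}) :=
  ⟨1, by simp, ⟨LinearEquiv.ofFinrankEq _ _ (by simp [Module.finrank_zero_of_subsingleton]),
    fun _ => rfl⟩⟩

theorem Reduces.left : Reduces α i 1 0 (α • 1 : Module.End F F) := by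
  refine ⟨1, by simp, ⟨LinearEquiv.prodUnique.trans (LinearEquiv.funUnique (Fin 1) F F),
    fun x => ?_⟩⟩
  simp

theorem Reduces.right : Reduces α i 0 1 (i • 1 : Module.End F F) := by
  refine ⟨1, by simp, ⟨LinearEquiv.uniqueProd.trans (LinearEquiv.funUnique (Fin 1) F F),
    fun x => ?_⟩⟩
  simp

theorem Reduces.isSUU {T : Module.End F Z} (h : Reduces α i a b T) {ε : F}
    (hε : ε = 1 ∨ ε = -1) (hT : IsUU (ε • T)) :
    IsSUU ((α • (1 : Module.End F (Fin a → F))).prodMap (i • (1 : Module.End F (Fin b → F))) :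
      Module.End F ((Fin a → F) × (Fin b → F))) := by
  obtain ⟨s, hs, h⟩ := h
  refine IsSUU.of_sim_mul h hs ?_
  rcases hε with rfl | rfl
  · exact Or.inl (by rwa [one_smul] at hT)
  · refine Or.inr ?_
    have e : -T = (-1 : F) • T := LinearMap.ext fun x => by simp
    rwa [e]

theorem smul_prodMap_end (c : F) (f : Module.End F V) (g : Module.End F W) :
    c • (f.prodMap g : Module.End F (V × W)) =
      ((c • f).prodMap (c • g) : Module.End F (V × W)) := by
  refine LinearMap.ext fun x => ?_
  simp

theorem IsUU.smul_prodMap_inv {ε : F} (hε : ε = 1 ∨ ε = -1) {E E' : Module.End F V}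
    (h : E * E' = 1) (h' : E' * E = 1) {c : F} {k : ℕ} (hE : (E - c • 1) ^ k = 0)
    (hc : ε * c ≠ -1) : IsUU (ε • (E.prodMap E' : Module.End F (V × V))) := by
  have hεε : ε * ε = 1 := by rcases hε with rfl | rfl <;> simp
  rw [smul_prodMap_end]
  refine IsUU.prodMap_inv ?_ ?_ (isUnit_one_add (isUnit_of_sub_pow hc (m := k) ?_))
  · rw [smul_mul_smul_comm, hεε, h, one_smul]
  · rw [smul_mul_smul_comm, hεε, h', one_smul]
  · have e : ε • E - (ε * c) • 1 = ε • (E - c • 1) := by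
      refine LinearMap.ext fun x => ?_
      simp [smul_sub, smul_smul]
    rw [e, smul_pow, hE, smul_zero]

theorem Reduces.pair [FiniteDimensional F Y] (hY : Module.finrank F Y = a) (hii : i * i = -1)
    {β : F} (hα : α = i * β) (hαi : α ≠ i) {X X' G : Module.End F Y} (h' : X' * X = 1)
    {x : F} {k : ℕ} (hX : (X - x • 1) ^ k = 0) (hG : Sim (β • X') G)
    (hu : IsUnit (G - x • 1)) : Reduces α i a a (X.prodMap G : Module.End F (Y × Y)) := by
  obtain ⟨s, hs, h⟩ := exists_factor (i := i) (A := α • (1 : Module.End F Y)) (e := X)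
    (f := α • 1 - X) (P := LinearMap.id) (σ := -1) h' (by simp) (isUnit_smul_one_sub hαi)
    (LinearMap.ext fun y => by simp) (LinearMap.ext fun y => by simp)
  refine Reduces.sim (Reduces.of_finrank hY hY hs h) ?_
  have e : i • (-1 * (1 + LinearMap.id ∘ₗ X' ∘ₗ (α • 1 - X))) = β • X' := by
    refine LinearMap.ext fun y => ?_
    have h1 : X' (X y) = y := LinearMap.congr_fun h' y
    simp only [LinearMap.smul_apply, Module.End.mul_apply, LinearMap.add_apply,
      LinearMap.comp_apply, LinearMap.sub_apply, LinearMap.neg_apply, Module.End.one_apply,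
      map_sub, map_smul, h1, LinearMap.id_apply, hα]
    linear_combination (norm := module) (-β * hii) • X' y
  rw [e]
  exact (Sim.upper_of_pow _ x hX (hG.isUnit_sub hu)).trans ((Sim.refl X).prodMap hG)

theorem Reduces.chain {a b : ℕ} {ε : F} {G G' : ℕ → Module.End F Y} (k : ℕ)
    (h : ∀ j < k, Reduces α i a b ((G' j).prodMap (G (j + 1)) : Module.End F (Y × Y)))
    (hu : ∀ j < k, IsUU (ε • ((G j).prodMap (G' j) : Module.End F (Y × Y)))) :
    ∃ (S R : Type u) (_ : AddCommGroup S) (_ : Module F S) (_ : AddCommGroup R) (_ : Module F R)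
      (T : Module.End F S) (U : Module.End F R),
      Reduces α i (k * a) (k * b) T ∧ IsUU (ε • U) ∧
      Sim ((G 0).prodMap T : Module.End F (Y × S)) (U.prodMap (G k) : Module.End F (R × Y)) := by
  induction k with
  | zero =>
    refine ⟨PUnit, PUnit, inferInstance, inferInstance, inferInstance, inferInstance, 0, 0, ?_,
      ⟨1, 1, by simp, by simp, Subsingleton.elim _ _⟩, Sim.prodComm _ _⟩
    simpa using Reduces.zero
  | succ k ih =>
    obtain ⟨S, R, _, _, _, _, T, U, hT, hU, hs⟩ :=
      ih (fun j hj => h j (by omega)) (fun j hj => hu j (by omega))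
    refine ⟨S × (Y × Y), R × (Y × Y), inferInstance, inferInstance, inferInstance, inferInstance,
      T.prodMap ((G' k).prodMap (G (k + 1))), U.prodMap ((G k).prodMap (G' k)), ?_, ?_, ?_⟩
    · rw [Nat.succ_mul, Nat.succ_mul]
      exact hT.add (h k (by omega))
    · rw [smul_prodMap_end]
      exact hU.prodMap (hu k (by omega))
    · refine (Sim.prodAssoc _ _ _).symm.trans ((hs.prodMap (Sim.refl _)).trans ?_)
      refine (Sim.prodAssoc _ _ _).trans (Sim.trans ?_ (Sim.prodAssoc _ _ _).symm)
      exact (Sim.refl U).prodMap (Sim.prodAssoc _ _ _).symm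

end Reduction

section JordanBlocks

variable {F : Type u} [Field F] {α i β : F}

/-- The Jordan block of size `2` with eigenvalue `c`. -/
def jordanTwo (c : F) : Module.End F (F × F) := blk (c • 1) 1 0 (c • 1)

theorem isJordan_smul_jordanTwo {b : F} (hb : b ≠ 0) (c : F) :
    IsJordan 1 (b • jordanTwo c - (b * c) • 1) := by
  have e : b • jordanTwo c - (b * c) • 1 = blk 0 (b • 1) 0 0 := by
    refine LinearMap.ext fun x => Prod.ext ?_ ?_ <;> simp [jordanTwo, mul_add, mul_assoc]
  rw [e]
  refine ⟨by simp, ?_, fun h => hb ?_⟩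
  · rw [pow_two, blk_mul, ← blk_zero]
    congr 1 <;> refine LinearMap.ext fun x => ?_ <;> simp
  · simpa using congrArg Prod.fst (LinearMap.congr_fun h (0, 1))

theorem isJordan_jordanTwo (c : F) : IsJordan 1 (jordanTwo c - c • 1) := by
  simpa using isJordan_smul_jordanTwo one_ne_zero c

theorem Reduces.mid (hii : i * i = -1) (hα : α = i * β) (hαi : α ≠ i) {x : F} (hx : x * x = β)
    (hx0 : x ≠ 0) (hαx : α ≠ x) : Reduces α i 1 1 (jordanTwo x) := by
  obtain ⟨s, hs, h⟩ := exists_factor (i := i) (A := α • (1 : Module.End F F)) (e := x • 1)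
    (e' := x⁻¹ • 1) (f := (α - x) • 1) (P := LinearMap.id) (σ := -1)
    (LinearMap.ext fun y => by simp [hx0]) (LinearMap.ext fun y => by simp; ring)
    (isUnit_smul_one_sub hαi)
    (LinearMap.ext fun y => by simp) (LinearMap.ext fun y => by simp)
  refine Reduces.sim (Reduces.of_finrank (by simp) (by simp) hs h) ?_
  refine IsJordan.sim_of_sub (m := 1) (c := x) ?_ (isJordan_jordanTwo x)
  have e : blk (x • 1) ((α - x) • 1) 0 (i • (-1 * (1 + LinearMap.id ∘ₗ (x⁻¹ • 1) ∘ₗ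
      ((α - x) • (1 : Module.End F F))))) - x • 1 =
        (blk 0 ((α - x) • 1) 0 0 : Module.End F (F × F)) := by
    refine LinearMap.ext fun y => Prod.ext ?_ ?_
    · simp
    · simp [hα]
      field_simp
      linear_combination (-β * hii - hx) * y.2
  rw [e]
  refine ⟨by simp, ?_, fun h => hαx ?_⟩
  · rw [pow_two, blk_mul, ← blk_zero]
    congr 1 <;> refine LinearMap.ext fun x => ?_ <;> simp
  · simpa [sub_eq_zero] using congrArg Prod.fst (LinearMap.congr_fun h (0, 1))

theorem Reduces.two_one (hαi : α ≠ i) (hα0 : α ≠ 0) (hαi' : α ≠ -i) :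
    Reduces α i 2 1 ((jordanTwo α).prodMap ((-i) • 1) : Module.End F ((F × F) × F)) := by
  obtain ⟨s, hs, h⟩ := exists_factor (i := i) (A := α • (1 : Module.End F (F × F)))
    (e := jordanTwo α) (e' := blk (α⁻¹ • 1) (-(α⁻¹ * α⁻¹) • 1) 0 (α⁻¹ • 1))
    (f := -LinearMap.inl F F F) (P := LinearMap.snd F F F) (σ := -1)
    (by
      rw [jordanTwo, blk_mul, ← blk_one]
      congr 1 <;> refine LinearMap.ext fun x => ?_ <;> (simp [hα0]; try field_simp; try ring))
    (by refine LinearMap.ext fun x => Prod.ext ?_ ?_ <;> simp [jordanTwo])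
    (isUnit_smul_one_sub hαi) (LinearMap.ext fun y => by simp) (LinearMap.ext fun y => by simp)
  refine Reduces.sim (Reduces.of_finrank (by simp) (by simp) hs h) ?_
  refine Sim.trans ?_ (Sim.upper_of_pow (-LinearMap.inl F F F) α (isJordan_jordanTwo α).2.1
    (isUnit_smul_one_sub hαi'.symm))
  have e : i • (-1 * (1 + LinearMap.snd F F F ∘ₗ
      (blk (α⁻¹ • 1) (-(α⁻¹ * α⁻¹) • 1) 0 (α⁻¹ • 1)) ∘ₗ (-LinearMap.inl F F F))) =
      (-i) • (1 : Module.End F F) := by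
    refine LinearMap.ext fun x => ?_
    simp
  rw [e]
  exact Sim.refl _

end JordanBlocks

section Scalar

variable {F : Type u} [Field F] {α i β : F}

/-- `α I_a ⊕ i I_b` is a product of an involution and two unipotents of index `2`. -/
def IsScalarSUU (α i : F) (a b : ℕ) : Prop :=
  IsSUU ((α • (1 : Module.End F (Fin a → F))).prodMap (i • (1 : Module.End F (Fin b → F))) :
      Module.End F ((Fin a → F) × (Fin b → F)))

theorem IsScalarSUU.add {a b a' b' : ℕ} (h : IsScalarSUU α i a b) (h' : IsScalarSUU α i a' b') :
    IsScalarSUU α i (a + a') (b + b') :=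
  IsSUU.sim (scalar_prod_add_sim α i a b a' b').symm (IsSUU.prodMap h h')

theorem Reduces.isScalarSUU {Z : Type u} [AddCommGroup Z] [Module F Z] {T : Module.End F Z}
    {a b a' b' : ℕ} (h : Reduces α i a b T) (ha : a = a') (hb : b = b') {ε : F}
    (hε : ε = 1 ∨ ε = -1) (hT : IsUU (ε • T)) : IsScalarSUU α i a' b' := by
  subst ha hb
  exact h.isSUU hε hT

theorem isScalarSUU_of_pow_eq_one (hii : i * i = -1) (hα : α = i * β) (hαi : α ≠ i) {n : ℕ}
    (hn : β ^ (n + 1) = 1) : IsScalarSUU α i (n + 1) (n + 1) := by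
  have hβ : β ≠ 0 := by rintro rfl; simp at hn
  let d : (Fin (n + 1) → F) → Module.End F (Fin (n + 1) → F) := fun v =>
    LinearMap.pi fun j => v j • LinearMap.proj j
  have hd : ∀ v x j, d v x j = v j * x j := fun v x j => rfl
  let e : Module.End F (Fin (n + 1) → F) := d fun j => (β ^ (j : ℕ))⁻¹
  let e' : Module.End F (Fin (n + 1) → F) := d fun j => β ^ (j : ℕ)
  have hs : Sim e' (β • e') := by
    refine ⟨LinearEquiv.funCongrLeft F F (finRotate (n + 1)), fun x => funext fun j => ?_⟩
    have h : β ^ ((finRotate (n + 1) j : Fin (n + 1)) : ℕ) = β * β ^ (j : ℕ) := by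
      rw [coe_finRotate, ← pow_succ']
      split_ifs with h
      · rw [h, Fin.val_last, hn, pow_zero]
      · rfl
    simp only [LinearEquiv.funCongrLeft_apply, LinearMap.funLeft_apply, LinearMap.smul_apply,
      Pi.smul_apply, smul_eq_mul, e', hd, h]
    ring
  obtain ⟨k, k', hk, hk', h⟩ := hs.exists_conj
  refine IsSUU.of_conj (e := e) (e' := e') hii ?_ ?_ hk hk' (isUnit_smul_one_sub hαi) ?_
  · refine LinearMap.ext fun x => funext fun j => ?_
    simp [e, e', hd, hβ]
  · refine LinearMap.ext fun x => funext fun j => ?_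
    simp [e, e', hd, hβ]
  · rw [← h, hα]
    refine LinearMap.ext fun x => ?_
    simp [mul_smul]

theorem exists_inv_jordanTwo {c : F} (hc : c ≠ 0) : ∃ X : Module.End F (F × F),
    jordanTwo c * X = 1 ∧ X * jordanTwo c = 1 ∧ IsJordan 1 (X - c⁻¹ • 1) := by
  obtain ⟨X, h1, h2⟩ := exists_inv_of_unit hc (isJordan_jordanTwo c).2.1
  exact ⟨X, h1, h2, (isJordan_jordanTwo c).inv (inv_mul_cancel₀ hc) h1 h2⟩

theorem smul_one_mul_smul_one {V : Type u} [AddCommGroup V] [Module F V] {c d : F} (h : c * d = 1) :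
    (c • 1 : Module.End F V) * (d • 1) = 1 := by
  rw [smul_mul_smul_comm, h, one_smul, one_mul]

/-- Chains of `1 × 1` blocks with eigenvalues `i β ^ j`. -/
theorem exists_chain_scalar (hii : i * i = -1) (hα : α = i * β) (hαi : α ≠ i) (hβ : β ≠ 0) {ε : F}
    (hε : ε = 1 ∨ ε = -1) (m k : ℕ) (h : ∀ j < k, β ^ (2 * (m + j) + 1) ≠ -1)
    (hu : ∀ j < k, ε * (i * β ^ (m + j)) ≠ -1) :
    ∃ (S R : Type u) (_ : AddCommGroup S) (_ : Module F S) (_ : AddCommGroup R) (_ : Module F R)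
      (T : Module.End F S) (U : Module.End F R),
      Reduces α i k k T ∧ IsUU (ε • U) ∧
      Sim (((i * β ^ m) • 1 : Module.End F F).prodMap T : Module.End F (F × S))
        (U.prodMap ((i * β ^ (m + k)) • 1) : Module.End F (R × F)) := by
  have hp : ∀ j, i * β ^ (m + j) * (-i * (β ^ (m + j))⁻¹) = 1 := fun j => by
    field_simp
    linear_combination -hii
  have := Reduces.chain (Y := F) (α := α) (i := i) (a := 1) (b := 1) (ε := ε)
    (G := fun j => (i * β ^ (m + j)) • 1)
    (G' := fun j => (-i * (β ^ (m + j))⁻¹) • 1) k (fun j hj => ?_) (fun j hj => ?_)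
  · simpa using this
  · refine Reduces.pair (by simp) hii hα hαi (X' := (i * β ^ (m + j)) • 1)
      (smul_one_mul_smul_one (hp j)) (x := -i * (β ^ (m + j))⁻¹) (k := 1) (by simp) ?_ ?_
    · have e : β • (i * β ^ (m + j)) • (1 : Module.End F F) = (i * β ^ (m + (j + 1))) • 1 := by
        rw [smul_smul, ← add_assoc, pow_succ]
        congr 1
        ring
      rw [e]
      exact Sim.refl _
    · refine isUnit_smul_one_sub fun h' => h j hj ?_
      have h1 := hp j
      rw [← h'] at h1
      linear_combination -h1 + β ^ (2 * (m + j) + 1) * hii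
  · exact IsUU.smul_prodMap_inv hε (smul_one_mul_smul_one (hp j))
      (smul_one_mul_smul_one ((mul_comm _ _).trans (hp j))) (c := i * β ^ (m + j)) (k := 1)
      (by simp) (hu j hj)

/-- Chains of Jordan blocks of size `2` with eigenvalues `i β ^ j`. -/
theorem exists_chain_jordan (hii : i * i = -1) (hα : α = i * β) (hαi : α ≠ i) (hβ : β ≠ 0)
    (m k : ℕ) (h : ∀ j < k, β ^ (2 * (m + j) + 1) ≠ -1)
    (hu : ∀ j < k, i * β ^ (m + j) ≠ -1) :
    ∃ (S R : Type u) (_ : AddCommGroup S) (_ : Module F S) (_ : AddCommGroup R) (_ : Module F R)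
      (T : Module.End F S) (U : Module.End F R),
      Reduces α i (k * 2) (k * 2) T ∧ IsUU U ∧
      Sim ((jordanTwo (i * β ^ m)).prodMap T : Module.End F ((F × F) × S))
        (U.prodMap (jordanTwo (i * β ^ (m + k))) : Module.End F (R × (F × F))) := by
  have hi0 : i ≠ 0 := by rintro rfl; simp at hii
  have hp : ∀ j, i * β ^ (m + j) ≠ 0 := fun j => by simp [hi0, hβ]
  choose X hX hX' hJ using fun j => exists_inv_jordanTwo (hp j)
  have := Reduces.chain (α := α) (i := i) (a := 2) (b := 2) (ε := 1)
    (G := fun j => jordanTwo (i * β ^ (m + j))) (G' := X) k (fun j hj => ?_) (fun j hj => ?_)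
  · simpa using this
  · have hs : Sim (β • jordanTwo (i * β ^ (m + j))) (jordanTwo (i * β ^ (m + (j + 1)))) := by
      refine IsJordan.sim_of_sub (m := 1) (c := β * (i * β ^ (m + j)))
        (isJordan_smul_jordanTwo hβ _) ?_
      have e : β * (i * β ^ (m + j)) = i * β ^ (m + (j + 1)) := by
        rw [← add_assoc, pow_succ]
        ring
      rw [e]
      exact isJordan_jordanTwo _
    refine Reduces.pair (by simp) hii hα hαi (hX j) (hJ j).2.1 hs ?_
    refine isUnit_of_sub_pow (fun h' => h j hj ?_) (isJordan_jordanTwo _).2.1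
    have h1 := mul_inv_cancel₀ (hp j)
    rw [← h'] at h1
    linear_combination -h1 + β ^ (2 * (m + j) + 1) * hii
  · exact IsUU.smul_prodMap_inv (Or.inl rfl) (hX j) (hX' j) (isJordan_jordanTwo _).2.1
      (by simpa using hu j hj)

end Scalar

section ScalarInduction

variable {F : Type u} [Field F] {α i β : F} {n : ℕ}

theorem eq_of_pow_eq_neg_one (hmin : ∀ m, 0 < m → m < n → β ^ m ≠ 1 ∧ β ^ m ≠ -1)
    (hn : β ^ n = -1) {m : ℕ} (h0 : 0 < m) (hm : m < 2 * n) (h : β ^ m = -1) : m = n := by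
  rcases lt_trichotomy m n with h1 | h1 | h1
  · exact absurd h (hmin m h0 h1).2
  · exact h1
  · refine absurd ?_ (hmin (m - n) (by omega) (by omega)).1
    have h2 : β ^ (m - n) * β ^ n = β ^ m := by rw [← pow_add]; congr 1; omega
    rw [hn, h] at h2
    linear_combination -h2

theorem exists_sign (h2 : (2 : F) ≠ 0) (hii : i * i = -1) (hβ : β ≠ 0)
    (hmin : ∀ m, 0 < m → m < n → β ^ m ≠ 1 ∧ β ^ m ≠ -1) :
    ∃ ε : F, (ε = 1 ∨ ε = -1) ∧ ∀ m, 0 < m → m < n → ε * (i * β ^ m) ≠ -1 := by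
  have key : ∀ l m, 0 < l → l < m → m < n → β ^ l ≠ -β ^ m := fun l m hl hlm hm h => by
    refine (hmin (m - l) (by omega) (by omega)).2 (mul_right_cancel₀ (pow_ne_zero l hβ) ?_)
    rw [← pow_add, Nat.sub_add_cancel hlm.le]
    rw [h]; ring
  by_cases h : ∀ m, 0 < m → m < n → (1 : F) * (i * β ^ m) ≠ -1
  · exact ⟨1, Or.inl rfl, h⟩
  · push Not at h
    obtain ⟨l, hl, hln, h⟩ := h
    refine ⟨-1, Or.inr rfl, fun m hm hmn h' => ?_⟩
    have e : β ^ l = -β ^ m := by linear_combination (-i) * h + i * h' + (β ^ l + β ^ m) * hii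
    have e' : β ^ m = -β ^ l := by rw [e, neg_neg]
    rcases lt_trichotomy l m with h1 | h1 | h1
    · exact key l m hl h1 hmn e
    · subst h1
      exact h2 (by linear_combination h + h')
    · exact key m l hm h1 hln e'

theorem isScalarSUU_of_pow_eq_neg_one_even (h2 : (2 : F) ≠ 0) (hii : i * i = -1) (hα : α = i * β)
    (hαi : α ≠ i) (hβ : β ≠ 0) (hmin : ∀ m, 0 < m → m < n → β ^ m ≠ 1 ∧ β ^ m ≠ -1)
    (hn : β ^ n = -1) (hn0 : 0 < n) (hev : Even n) : IsScalarSUU α i n n := by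
  obtain ⟨ε, hε, hε'⟩ := exists_sign h2 hii hβ hmin
  obtain ⟨k, rfl⟩ : ∃ k, n = 1 + k := ⟨n - 1, by omega⟩
  obtain ⟨S, R, _, _, _, _, T, U, hT, hU, hs⟩ := exists_chain_scalar hii hα hαi hβ hε 1 k
    (fun j hj h => by
      have := eq_of_pow_eq_neg_one hmin hn (by omega) (by omega) h
      obtain ⟨r, hr⟩ := hev
      omega)
    (fun j hj => hε' _ (by omega) (by omega))
  have hi : i ≠ -1 := fun h => h2 (by rw [h] at hii; linear_combination hii)
  have hi' : i ≠ 1 := fun h => h2 (by rw [h] at hii; linear_combination hii)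
  have hT' := ((Reduces.left (α := α) (i := i)).add hT).add Reduces.right
  refine (hT'.sim (T' := (U.prodMap
    (((-i) • 1 : Module.End F F).prodMap (i • 1 : Module.End F F) : Module.End F (F × F)) :
      Module.End F (R × (F × F)))) ?_).isScalarSUU (by ring) (by ring) hε ?_
  · refine Sim.trans (Sim.prodMap ?_ (Sim.refl _)) (Sim.prodAssoc _ _ _)
    have e1 : α = i * β ^ 1 := by rw [hα, pow_one]
    have e2 : -i = i * β ^ (1 + k) := by rw [hn]; ring
    rw [e1, e2]
    exact hs
  · rw [smul_prodMap_end]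
    refine hU.prodMap (IsUU.smul_prodMap_inv hε (smul_one_mul_smul_one ?_)
      (smul_one_mul_smul_one ?_) (c := -i) (k := 1) (by simp) ?_)
    · linear_combination -hii
    · linear_combination -hii
    · rcases hε with rfl | rfl
      · simpa using hi'
      · simpa using hi

theorem isScalarSUU_of_pow_eq_neg_one_odd (h2 : (2 : F) ≠ 0) (hii : i * i = -1) (hα : α = i * β)
    (hαi : α ≠ i) (hβ : β ≠ 0) {h : ℕ}
    (hmin : ∀ m, 0 < m → m < 2 * h + 1 → β ^ m ≠ 1 ∧ β ^ m ≠ -1)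
    (hn : β ^ (2 * h + 1) = -1) : IsScalarSUU α i (2 * h + 1) (2 * h + 1) := by
  have hi0 : i ≠ 0 := by rintro rfl; simp at hii
  have hi' : i ≠ 1 := fun h => h2 (by rw [h] at hii; linear_combination hii)
  have hii' : -i * i = 1 := by linear_combination -hii
  have hdiag : IsUU (((-i) • 1 : Module.End F F).prodMap (i • 1 : Module.End F F) :
      Module.End F (F × F)) := by
    refine IsUU.prodMap_inv (smul_one_mul_smul_one hii')
      (smul_one_mul_smul_one ((mul_comm _ _).trans hii')) (isUnit_one_add (isUnit_smul_one_sub ?_))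
    simpa using hi'
  rcases h with _ | h
  · have e : α = -i := by rw [hα]; linear_combination i * hn
    have hT := (Reduces.left (α := α) (i := i)).add Reduces.right
    refine hT.isScalarSUU (by rfl) (by rfl) (Or.inl rfl) ?_
    rw [one_smul, e]
    exact hdiag
  have hp : ∀ j ≤ h, i * β ^ (1 + j) ≠ -1 := fun j hj h' => by
    have h3 : β ^ (1 + j) = i := by linear_combination (-i) * h' + β ^ (1 + j) * hii
    have h4 : β ^ (2 * (1 + j)) = -1 := by rw [mul_comm, pow_mul, h3, pow_two, hii]
    have := eq_of_pow_eq_neg_one hmin hn (by omega) (by omega) h4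
    omega
  obtain ⟨S, R, _, _, _, _, T, U, hT, hU, hs⟩ := exists_chain_jordan hii hα hαi hβ 1 h
    (fun j hj h' => (hmin _ (by omega) (by omega)).2 h') (fun j hj => hp j hj.le)
  have hα0 : α ≠ 0 := by simp [hα, hi0, hβ]
  have hα1 : α ≠ -i := fun h => (hmin 1 (by omega) (by omega)).2
    (mul_left_cancel₀ hi0 (by rw [pow_one, ← hα, h]; ring))
  have hx0 : i * β ^ (h + 2) ≠ 0 := by simp [hi0, hβ]
  have hxx : i * β ^ (h + 2) * (i * β ^ (h + 2)) = β := by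
    have e : β ^ (h + 2) * β ^ (h + 2) = -β := by
      rw [← pow_add, show h + 2 + (h + 2) = 2 * (h + 1) + 1 + 1 by ring, pow_succ, hn]
      ring
    linear_combination β ^ (h + 2) * β ^ (h + 2) * hii - e
  have hαx : α ≠ i * β ^ (h + 2) := fun h' => by
    rw [hα] at h'
    have h3 := mul_left_cancel₀ hi0 h'
    refine (hmin (h + 1) (by omega) (by omega)).1 (mul_right_cancel₀ hβ ?_)
    rw [← pow_succ]
    linear_combination -h3
  obtain ⟨X, hX, hX', hXJ⟩ := exists_inv_jordanTwo (c := i * β ^ (1 + h)) (by simp [hi0, hβ])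
  have hinv : i * β ^ (h + 2) = (i * β ^ (1 + h))⁻¹ := by
    refine eq_inv_of_mul_eq_one_left ?_
    have e : β ^ (h + 2) * β ^ (1 + h) = -1 := by
      rw [← pow_add, ← hn]
      congr 1
      ring
    linear_combination i * i * e - hii
  have hsX : Sim (jordanTwo (i * β ^ (h + 2))) X := by
    refine IsJordan.sim_of_sub (m := 1) (c := i * β ^ (h + 2)) (isJordan_jordanTwo _) ?_
    rw [hinv]
    exact hXJ
  have hUX : IsUU ((jordanTwo (i * β ^ (1 + h))).prodMap X :
      Module.End F ((F × F) × (F × F))) := by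
    simpa using IsUU.smul_prodMap_inv (ε := 1) (Or.inl rfl) hX hX' (isJordan_jordanTwo _).2.1
      (by simpa using hp h le_rfl)
  have hT' := ((Reduces.two_one hαi hα0 hα1).add Reduces.right).add
    (hT.add (Reduces.mid hii hα hαi hxx hx0 hαx))
  refine (hT'.sim (T' := ((U.prodMap (((-i) • 1 : Module.End F F).prodMap (i • 1 : Module.End F F) :
      Module.End F (F × F)) : Module.End F (R × (F × F))).prodMap
        ((jordanTwo (i * β ^ (1 + h))).prodMap X : Module.End F ((F × F) × (F × F))) :
      Module.End F ((R × (F × F)) × ((F × F) × (F × F))))) ?_).isScalarSUU (by ring) (by ring)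
      (Or.inl rfl) ?_
  · refine ((Sim.prodAssoc _ _ _).prodMap (Sim.refl _)).trans ?_
    refine (Sim.prodProdProdComm _ _ _ _).trans (Sim.trans ?_ (Sim.prodProdProdComm _ _ _ _))
    refine Sim.prodMap ?_ ((Sim.refl _).prodMap hsX)
    have e1 : α = i * β ^ 1 := by rw [hα, pow_one]
    rw [e1]
    exact hs
  · rw [one_smul]
    exact (hU.prodMap hdiag).prodMap hUX

theorem isScalarSUU_of_pow_eq_or (h2 : (2 : F) ≠ 0) (hii : i * i = -1) (hα : α = i * β)
    (hαi : α ≠ i) (hβ : β ≠ 0) (hmin : ∀ m, 0 < m → m < n → β ^ m ≠ 1 ∧ β ^ m ≠ -1)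
    (hn0 : 0 < n) (hn : β ^ n = 1 ∨ β ^ n = -1) : IsScalarSUU α i n n := by
  rcases hn with hn | hn
  · obtain ⟨n, rfl⟩ : ∃ k, n = k + 1 := ⟨n - 1, by omega⟩
    exact isScalarSUU_of_pow_eq_one hii hα hαi hn
  · rcases Nat.even_or_odd n with hev | ⟨h, rfl⟩
    · exact isScalarSUU_of_pow_eq_neg_one_even h2 hii hα hαi hβ hmin hn hn0 hev
    · exact isScalarSUU_of_pow_eq_neg_one_odd h2 hii hα hαi hβ hmin hn

theorem isScalarSUU_succ_of_pow_eq_or (h2 : (2 : F) ≠ 0) (hii : i * i = -1) (hα : α = i * β)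
    (hαi : α ≠ i) (hβ : β ≠ 0) (hmin : ∀ m, 0 < m → m < n → β ^ m ≠ 1 ∧ β ^ m ≠ -1)
    (hmin' : ∀ m, 0 < m → m < n → β ^ m ≠ i ∧ β ^ m ≠ -i)
    (hn : β ^ n = i ∨ β ^ n = -i) : IsScalarSUU α i n (n + 1) := by
  have hi : i ≠ -1 := fun h => h2 (by rw [h] at hii; linear_combination hii)
  have hi' : i ≠ 1 := fun h => h2 (by rw [h] at hii; linear_combination hii)
  obtain ⟨ε, hε, hnε⟩ : ∃ ε : F, (ε = 1 ∨ ε = -1) ∧ β ^ n = -i * ε := by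
    rcases hn with h | h
    · exact ⟨-1, Or.inr rfl, by rw [h]; ring⟩
    · exact ⟨1, Or.inl rfl, by rw [h]; ring⟩
  obtain ⟨S, R, _, _, _, _, T, U, hT, hU, hs⟩ := exists_chain_scalar hii hα hαi hβ hε 0 n
    (fun j hj h => by
      rw [zero_add] at h
      rcases lt_trichotomy (2 * j + 1) n with h1 | h1 | h1
      · exact (hmin _ (by omega) h1).2 h
      · rw [← h1, h] at hn
        rcases hn with h | h
        · exact hi h.symm
        · exact hi' (by linear_combination h)
      · have h3 : β ^ (2 * j + 1 - n) * β ^ n = β ^ (2 * j + 1) := by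
          rw [← pow_add]; congr 1; omega
        have h4 := hmin' (2 * j + 1 - n) (by omega) (by omega)
        rw [h] at h3
        rcases hn with h5 | h5
        · rw [h5] at h3
          exact h4.1 (by linear_combination (-i) * h3 + β ^ (2 * j + 1 - n) * hii)
        · rw [h5] at h3
          exact h4.2 (by linear_combination i * h3 + β ^ (2 * j + 1 - n) * hii))
    (fun j hj h => by
      rw [zero_add] at h
      have h1 : β ^ j = i ∨ β ^ j = -i := by
        rcases hε with rfl | rfl
        · exact Or.inl (by linear_combination (-i) * h + β ^ j * hii)
        · exact Or.inr (by linear_combination i * h + β ^ j * hii)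
      rcases Nat.eq_zero_or_pos j with rfl | h0
      · rw [pow_zero] at h1
        rcases h1 with h | h
        · exact hi' h.symm
        · exact hi (by linear_combination h)
      · rcases h1 with h | h
        · exact (hmin' j h0 hj).1 h
        · exact (hmin' j h0 hj).2 h)
  have hεε : ε * ε = 1 := by rcases hε with rfl | rfl <;> simp
  refine (((Reduces.right (α := α) (i := i)).add hT).sim
    (T' := (U.prodMap (ε • 1 : Module.End F F) : Module.End F (R × F))) ?_).isScalarSUU
      (by ring) (by ring) hε ?_
  · have e1 : i = i * β ^ 0 := by simp
    have e2 : ε = i * β ^ (0 + n) := by rw [zero_add, hnε]; linear_combination ε * hii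
    rw [e2]
    nth_rewrite 1 [e1]
    exact hs
  · rw [smul_prodMap_end, smul_smul, hεε, one_smul]
    exact hU.prodMap IsUU.one

theorem isScalarSUU_of_pow (h2 : (2 : F) ≠ 0) (hii : i * i = -1) (hα : α = i * β)
    (hαi : α ≠ i) (hβ : β ≠ 0) (n : ℕ) :
    ((β ^ n = 1 ∨ β ^ n = -1) → IsScalarSUU α i n n) ∧
      ((β ^ n = i ∨ β ^ n = -i) → IsScalarSUU α i n (n + 1)) := by
  have hi0 : i ≠ 0 := by rintro rfl; simp at hii
  induction n using Nat.strong_induction_on with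
  | _ n ih =>
  by_cases hmin : ∀ m, 0 < m → m < n → β ^ m ≠ 1 ∧ β ^ m ≠ -1
  · refine ⟨fun hn => ?_, fun hn => ?_⟩
    · rcases Nat.eq_zero_or_pos n with rfl | hn0
      · exact Reduces.zero.isScalarSUU rfl rfl (Or.inl rfl)
          ⟨1, 1, by simp, by simp, Subsingleton.elim _ _⟩
      · exact isScalarSUU_of_pow_eq_or h2 hii hα hαi hβ hmin hn0 hn
    · by_cases hmin' : ∀ m, 0 < m → m < n → β ^ m ≠ i ∧ β ^ m ≠ -i
      · exact isScalarSUU_succ_of_pow_eq_or h2 hii hα hαi hβ hmin hmin' hn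
      · push Not at hmin'
        obtain ⟨m, hm, hmn, h⟩ := hmin'
        have h : β ^ m = i ∨ β ^ m = -i := or_iff_not_imp_left.2 h
        obtain ⟨k, rfl⟩ : ∃ k, n = k + m := ⟨n - m, by omega⟩
        have hk : β ^ k = 1 ∨ β ^ k = -1 := by
          rw [pow_add] at hn
          rcases h with h | h <;> rw [h] at hn <;> rcases hn with hn | hn
          · exact Or.inl (mul_right_cancel₀ hi0 (by linear_combination hn))
          · exact Or.inr (mul_right_cancel₀ hi0 (by linear_combination hn))
          · exact Or.inr (mul_right_cancel₀ hi0 (by linear_combination -hn))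
          · exact Or.inl (mul_right_cancel₀ hi0 (by linear_combination -hn))
        exact ((ih k (by omega)).1 hk).add ((ih m (by omega)).2 h)
  · push Not at hmin
    obtain ⟨m, hm, hmn, h⟩ := hmin
    have h : β ^ m = 1 ∨ β ^ m = -1 := or_iff_not_imp_left.2 h
    obtain ⟨k, rfl⟩ : ∃ k, n = m + k := ⟨n - m, by omega⟩
    refine ⟨fun hn => ((ih m (by omega)).1 h).add ((ih k (by omega)).1 ?_),
      fun hn => ((ih m (by omega)).1 h).add ((ih k (by omega)).2 ?_)⟩ <;>
    · rw [pow_add] at hn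
      rcases h with h | h <;> rw [h] at hn <;> simpa [neg_eq_iff_eq_neg, or_comm] using hn

end ScalarInduction

section Nilpotent

open Polynomial

variable {F : Type u} [Field F]

/-- `M` carries an additive involution that is semilinear with respect to `X ↦ -X`. -/
def HasSignInvolution (F : Type u) [Field F] (M : Type u) [AddCommGroup M] [Module F[X] M] : Prop :=
  ∃ t : M →+ M, (∀ (r : F[X]) (m : M), t (r • m) = (r.comp (-X)) • t m) ∧ ∀ m, t (t m) = m

theorem HasSignInvolution.quotient (k : ℕ) :
    HasSignInvolution F (F[X] ⧸ (Submodule.span F[X] {(X : F[X]) ^ k})) := by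
  let I : Ideal F[X] := Ideal.span {(X : F[X]) ^ k}
  have hI : I ≤ I.comap (compRingHom (-X : F[X])) := by
    rw [Ideal.span_le, Set.singleton_subset_iff]
    simp only [SetLike.mem_coe, Ideal.mem_comap, coe_compRingHom_apply, X_pow_comp, I]
    rw [neg_pow]
    exact Ideal.mul_mem_left _ _ (Ideal.mem_span_singleton_self _)
  refine ⟨(Ideal.quotientMap I (compRingHom (-X : F[X])) hI).toAddMonoidHom, fun r m => ?_,
    fun m => ?_⟩
  · obtain ⟨m, rfl⟩ := Ideal.Quotient.mk_surjective m
    change Ideal.quotientMap I (compRingHom (-X : F[X])) hI (Ideal.Quotient.mk I (r * m)) =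
      Ideal.Quotient.mk I (r.comp (-X)) * Ideal.quotientMap I (compRingHom (-X : F[X])) hI
        (Ideal.Quotient.mk I m)
    simp
  · obtain ⟨m, rfl⟩ := Ideal.Quotient.mk_surjective m
    change Ideal.quotientMap I (compRingHom (-X : F[X])) hI (Ideal.quotientMap I
      (compRingHom (-X : F[X])) hI (Ideal.Quotient.mk I m)) = Ideal.Quotient.mk I m
    simp [comp_assoc]

theorem HasSignInvolution.directSum {ι : Type} (M : ι → Type u)
    [∀ j, AddCommGroup (M j)] [∀ j, Module F[X] (M j)] (h : ∀ j, HasSignInvolution F (M j)) :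
    HasSignInvolution F (DirectSum ι M) := by
  choose t ht ht' using h
  refine ⟨DirectSum.map t, fun r m => DFinsupp.ext fun j => ?_, fun m => DFinsupp.ext fun j => ?_⟩
  · simp [DirectSum.map_apply, DirectSum.smul_apply, ht]
  · simp [DirectSum.map_apply, ht']

theorem HasSignInvolution.of_equiv {M M' : Type u} [AddCommGroup M] [Module F[X] M]
    [AddCommGroup M'] [Module F[X] M'] (φ : M ≃ₗ[F[X]] M') (h : HasSignInvolution F M') :
    HasSignInvolution F M := by
  obtain ⟨t, ht, ht'⟩ := h
  refine ⟨(φ.symm.toLinearMap.toAddMonoidHom.comp t).comp φ.toLinearMap.toAddMonoidHom,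
    fun r m => ?_, fun m => ?_⟩
  · simp [ht]
  · simp [ht']

variable {V : Type u} [AddCommGroup V] [Module F V] [FiniteDimensional F V]

theorem exists_involution_anticomm {N : Module.End F V} {k : ℕ} (hN : N ^ k = 0) :
    ∃ s : Module.End F V, s * s = 1 ∧ s * N = -(N * s) := by
  have htor : Module.IsTorsion' (Module.AEval' N) (Submonoid.powers (X : F[X])) := by
    intro m
    refine ⟨⟨X ^ k, k, rfl⟩, ?_⟩
    obtain ⟨m, rfl⟩ := (Module.AEval'.of N).surjective m
    refine (Module.AEval'.X_pow_smul_of N m k).trans ?_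
    simp [hN]
  obtain ⟨d, e, ⟨φ⟩⟩ := Module.torsion_by_prime_power_decomposition irreducible_X htor
  obtain ⟨t, ht, ht'⟩ := HasSignInvolution.of_equiv φ
    (HasSignInvolution.directSum _ fun j => HasSignInvolution.quotient (e j))
  refine ⟨{ toFun := fun x => (Module.AEval'.of N).symm (t (Module.AEval'.of N x))
            map_add' := fun x y => by simp
            map_smul' := fun c x => ?_ }, ?_, ?_⟩
  · have h := ht (C c) (Module.AEval'.of N x)
    rw [C_comp, Module.AEval.C_smul, Module.AEval.C_smul] at h
    simp [h]
  · refine LinearMap.ext fun x => ?_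
    simp [ht']
  · refine LinearMap.ext fun x => (Module.AEval'.of N).injective ?_
    have h := ht X (Module.AEval'.of N x)
    rw [Module.AEval'.X_smul_of, X_comp, neg_smul] at h
    have h2 := Module.AEval'.X_smul_of N ((Module.AEval'.of N).symm (t (Module.AEval'.of N x)))
    rw [LinearEquiv.apply_symm_apply] at h2
    simp [h, h2]

theorem exists_two_involutions (h2 : (2 : F) ≠ 0) {U : Module.End F V} {k : ℕ}
    (hU : (U - 1) ^ k = 0) :
    ∃ s s' : Module.End F V, s * s = 1 ∧ s' * s' = 1 ∧ U = s * s' := by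
  have hne : (1 : F) ≠ -1 := fun h => h2 (by linear_combination h)
  obtain ⟨⟨D, Q, hDQ, hQD⟩, hD⟩ : IsUnit (1 + U) :=
    isUnit_one_add (isUnit_of_sub_pow (c := (1 : F)) (m := k) hne (by rwa [one_smul]))
  replace hD : D = 1 + U := hD
  have hcomm : D * (U - 1) = (U - 1) * D := by rw [hD]; noncomm_ring
  have hUQ : Commute (U - 1) Q := by
    change (U - 1) * Q = Q * (U - 1)
    calc (U - 1) * Q = Q * D * (U - 1) * Q := by rw [hQD, one_mul]
      _ = Q * (U - 1) * (D * Q) := by rw [mul_assoc Q, hcomm]; noncomm_ring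
      _ = Q * (U - 1) := by rw [hDQ, mul_one]
  obtain ⟨s, hs, hsN⟩ := exists_involution_anticomm (N := (U - 1) * Q) (k := k) (by
    rw [hUQ.mul_pow, hU, zero_mul])
  obtain ⟨N, hN⟩ : ∃ N, N = (U - 1) * Q := ⟨_, rfl⟩
  rw [← hN] at hsN
  have hND : (1 - N) * D = 2 := by
    rw [hN, sub_mul, mul_assoc, hQD, hD]; noncomm_ring; rw [two_smul, one_add_one_eq_two]
  have hDN : D * (1 - N) = 2 := by
    rw [hN, mul_sub, ← mul_assoc, hcomm, mul_assoc, hDQ, hD]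
    noncomm_ring
    rw [two_smul, one_add_one_eq_two]
  have hDN' : (s * D * s) * (1 + N) = 2 := by
    have h1 : s * (1 + N) = (1 - N) * s := by rw [mul_add, hsN]; noncomm_ring
    calc (s * D * s) * (1 + N) = s * (D * (1 - N)) * s := by rw [mul_assoc, h1]; noncomm_ring
      _ = 2 * (s * s) := by rw [hDN]; noncomm_ring
      _ = 2 := by rw [hs, mul_one]
  have key : (2 : F) • (s * U * (s * U)) = (2 : F) • (1 : Module.End F V) := by
    have hU' : U = D - 1 := by rw [hD]; abel
    have e1 : 2 * (s * D * s) = (s * D * s) * ((1 - N) * D) := by rw [hND]; noncomm_ring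
    have e2 : 2 * D = (s * D * s) * (1 + N) * D := by rw [hDN']
    have e3 : s * U * (s * U) = s * D * s * D - s * D * s - (s * s) * D + s * s := by
      rw [hU']; noncomm_ring
    have e4 : 2 * (s * D * s) + 2 * D = 2 * (s * D * s * D) := by
      rw [e1, e2]; noncomm_ring
    rw [two_smul, two_smul, ← two_mul, e3, hs]
    have e5 : 2 * (s * D * s * D - s * D * s - 1 * D + 1) =
      2 * (s * D * s * D) - (2 * (s * D * s) + 2 * D) + 2 := by
      noncomm_ring; rw [two_smul ℤ (1 : Module.End F V), one_add_one_eq_two]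
    rw [e5, e4, sub_self, zero_add, one_add_one_eq_two]
  refine ⟨s, s * U, hs, smul_right_injective _ h2 key, ?_⟩
  rw [← mul_assoc, hs, one_mul]

theorem isSUU_unipotent {i : F} (h2 : (2 : F) ≠ 0) (hii : i * i = -1) {A : Module.End F V} {k : ℕ}
    (hA : (A - i • 1) ^ k = 0) : IsSUU (A.prodMap (i • 1) : Module.End F (V × V)) := by
  obtain ⟨s, s', hs, hs', hU⟩ := exists_two_involutions h2 (U := (-i) • A) (k := k) (by
    have e : (-i) • A - 1 = (-i) • (A - i • 1) := LinearMap.ext fun x => by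
      simp [smul_sub, smul_smul, hii]
    rw [e, _root_.smul_pow, hA, smul_zero])
  have hUU : IsUU ((i • s').prodMap ((-i) • s') : Module.End F (V × V)) := by
    have h1 : (i • s') * ((-i) • s') = 1 := by
      rw [smul_mul_smul_comm, hs']; simp [hii]
    have h1' : ((-i) • s') * (i • s') = 1 := by
      rw [smul_mul_smul_comm, hs']; simp [hii]
    have hX : (i • s') * (i • s') = -1 := by
      rw [smul_mul_smul_comm, hs', hii]; simp
    have h2' : (2⁻¹ : F) • (1 - -1 : Module.End F V) = 1 := by
      rw [sub_neg_eq_add, ← two_smul F (1 : Module.End F V), smul_smul, inv_mul_cancel₀ h2,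
        one_smul]
    refine IsUU.prodMap_inv h1 h1' ⟨⟨1 + i • s', (2⁻¹ : F) • (1 - i • s'), ?_, ?_⟩, rfl⟩
    · refine Eq.trans ?_ h2'
      rw [mul_smul_comm, ← hX]
      congr 1
      generalize i • s' = X
      noncomm_ring
    · refine Eq.trans ?_ h2'
      rw [smul_mul_assoc, ← hX]
      congr 1
      generalize i • s' = X
      noncomm_ring
  refine ⟨s.prodMap (-s'), _, ?_, hUU, ?_⟩
  · rw [LinearMap.prodMap_mul, hs, neg_mul_neg, hs', LinearMap.prodMap_one]
  · rw [LinearMap.prodMap_mul]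
    congr 1
    · rw [mul_smul_comm, ← hU, smul_smul]
      simp [hii]
    · rw [neg_mul, mul_smul_comm, hs']
      simp

end Nilpotent

section Assembly

variable {F : Type u} [Field F] {V W : Type u} [AddCommGroup V] [Module F V]
  [FiniteDimensional F V] [AddCommGroup W] [Module F W] [FiniteDimensional F W] {i : F}

theorem exists_scalar {B : Module.End F V} (h2 : (2 : F) ≠ 0) (hii : i * i = -1)
    (hu : IsUnit (B - i • 1)) (hdet : LinearMap.det ((-i) • B) ≠ 0) {c : F} (hc : B = c • 1) :
    ∃ c : F, c ≠ i ∧ c ≠ 0 ∧ B = c • 1 := by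
  have hi0 : i ≠ 0 := by rintro rfl; simp at hii
  rcases subsingleton_or_nontrivial V with hV | hV
  · refine ⟨-i, fun h => ?_, neg_ne_zero.2 hi0, Subsingleton.elim _ _⟩
    exact (mul_ne_zero h2 hi0) (by linear_combination -h)
  · refine ⟨c, ?_, ?_, hc⟩
    · rintro rfl
      rw [hc, sub_self] at hu
      exact not_isUnit_zero hu
    · rintro rfl
      rw [hc, zero_smul, smul_zero] at hdet
      exact hdet (LinearMap.det_zero'' (M := V))

theorem isSUU_of_isUnit_sub_even (h2 : (2 : F) ≠ 0) (hii : i * i = -1) {B : Module.End F V}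
    (hu : IsUnit (B - i • 1))
    (hdet : LinearMap.det ((-i) • B) = 1 ∨ LinearMap.det ((-i) • B) = -1) :
    IsSUU (B.prodMap (i • 1) : Module.End F (V × V)) := by
  by_cases hs : ∀ c : F, B ≠ c • 1
  · exact isSUU_nonscalar_even h2 hii
      (LinearMap.ext fun x => by simp [smul_smul, hii]) hu hs hdet
  · push Not at hs
    obtain ⟨c, hc⟩ := hs
    obtain ⟨c, hci, hc0, rfl⟩ := exists_scalar h2 hii hu
      (by rcases hdet with h | h <;> rw [h] <;> simp) hc
    have hβ : -i * c ≠ 0 := mul_ne_zero (neg_ne_zero.2 (by rintro rfl; simp at hii)) hc0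
    have e : (-i) • c • (1 : Module.End F V) = (-i * c) • 1 := smul_smul _ _ _
    rw [e, LinearMap.det_smul, map_one, mul_one] at hdet
    exact IsSUU.sim (sim_scalar_prod c i rfl rfl)
      ((isScalarSUU_of_pow h2 hii (by linear_combination c * hii) hci hβ _).1 hdet)

theorem isSUU_of_isUnit_sub_odd (h2 : (2 : F) ≠ 0) (hii : i * i = -1) {B : Module.End F V}
    (hu : IsUnit (B - i • 1))
    (hdet : LinearMap.det ((-i) • B) = i ∨ LinearMap.det ((-i) • B) = -i) :
    IsSUU (B.prodMap (i • 1) : Module.End F (V × (V × F))) := by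
  have hi0 : i ≠ 0 := by rintro rfl; simp at hii
  by_cases hs : ∀ c : F, B ≠ c • 1
  · exact isSUU_nonscalar_odd h2 hii
      (LinearMap.ext fun x => by simp [smul_smul, hii]) hu hs hdet
  · push Not at hs
    obtain ⟨c, hc⟩ := hs
    obtain ⟨c, hci, hc0, rfl⟩ := exists_scalar h2 hii hu
      (by rcases hdet with h | h <;> rw [h] <;> simp [hi0]) hc
    have e : (-i) • c • (1 : Module.End F V) = (-i * c) • 1 := smul_smul _ _ _
    rw [e, LinearMap.det_smul, map_one, mul_one] at hdet
    exact IsSUU.sim (sim_scalar_prod c i rfl (by simp))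
      ((isScalarSUU_of_pow h2 hii (by linear_combination c * hii) hci
        (mul_ne_zero (neg_ne_zero.2 hi0) hc0) _).2 hdet)

theorem IsSUU.combine {U V₁ V₂ W₁ W₂ Q : Type u} [AddCommGroup U] [Module F U]
    [AddCommGroup V₁] [Module F V₁] [AddCommGroup V₂] [Module F V₂]
    [AddCommGroup W₁] [Module F W₁] [FiniteDimensional F W₁] [AddCommGroup W₂]
    [Module F W₂] [FiniteDimensional F W₂] [AddCommGroup Q] [Module F Q] [FiniteDimensional F Q]
    {A : Module.End F U} {A₁ : Module.End F V₁} {A₂ : Module.End F V₂}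
    (hA : Sim A (A₁.prodMap A₂ : Module.End F (V₁ × V₂)))
    (h₁ : IsSUU (A₁.prodMap (i • 1) : Module.End F (V₁ × W₁)))
    (h₂ : IsSUU (A₂.prodMap (i • 1) : Module.End F (V₂ × W₂)))
    (hQ : IsSUU (i • 1 : Module.End F Q))
    (hW : Module.finrank F W = Module.finrank F W₁ + Module.finrank F W₂ + Module.finrank F Q) :
    IsSUU (A.prodMap (i • 1) : Module.End F (U × W)) := by
  refine IsSUU.sim (Sim.symm ?_) ((h₁.prodMap h₂).prodMap hQ)
  refine (hA.prodMap (Sim.smul_one (W := (W₁ × W₂) × Q) (by simp [hW]) i)).trans ?_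
  rw [smul_one_prod, smul_one_prod]
  exact (Sim.prodAssoc _ _ _).symm.trans ((Sim.prodProdProdComm _ _ _ _).prodMap (Sim.refl _))

theorem exists_fitting (A : Module.End F V) (c : F) :
    ∃ (V₁ V₂ : Type u) (_ : AddCommGroup V₁) (_ : Module F V₁) (_ : FiniteDimensional F V₁)
      (_ : AddCommGroup V₂) (_ : Module F V₂) (_ : FiniteDimensional F V₂)
      (A₁ : Module.End F V₁) (A₂ : Module.End F V₂) (k : ℕ),
      Sim A (A₁.prodMap A₂ : Module.End F (V₁ × V₂)) ∧ (A₁ - c • 1) ^ k = 0 ∧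
        IsUnit (A₂ - c • 1) := by
  obtain ⟨N, hN⟩ : ∃ N, N = A - c • 1 := ⟨_, rfl⟩
  obtain ⟨k, hk⟩ := Filter.eventually_atTop.mp (LinearMap.eventually_isCompl_ker_pow_range_pow N)
  have hc := hk (k + 1) k.le_succ
  have hAN : Commute A (N ^ (k + 1)) := by
    refine Commute.pow_right ?_ _
    rw [hN]
    exact (Commute.refl A).sub_right ((Commute.one_right A).smul_right c)
  have hAx : ∀ x, A ((N ^ (k + 1)) x) = (N ^ (k + 1)) (A x) := fun x =>
    LinearMap.congr_fun hAN.eq x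
  have hNx : ∀ x, N x = A x - c • x := fun x => by rw [hN]; rfl
  have hpow : ∀ (B : Module.End F V) (m : ℕ) (x : V), (B ^ (m + 1)) x = (B ^ m) (B x) :=
    fun B m x => by rw [pow_succ, Module.End.mul_apply]
  have hK : ∀ x ∈ LinearMap.ker (N ^ (k + 1)), A x ∈ LinearMap.ker (N ^ (k + 1)) := by
    intro x hx
    rw [LinearMap.mem_ker] at hx ⊢
    rw [← hAx, hx, map_zero]
  have hL : ∀ x ∈ LinearMap.range (N ^ (k + 1)), A x ∈ LinearMap.range (N ^ (k + 1)) := by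
    rintro _ ⟨x, rfl⟩
    exact ⟨A x, (hAx x).symm⟩
  refine ⟨LinearMap.ker (N ^ (k + 1)), LinearMap.range (N ^ (k + 1)), inferInstance, inferInstance,
    inferInstance, inferInstance, inferInstance, inferInstance, A.restrict hK, A.restrict hL, k + 1,
    Sim.symm ⟨Submodule.prodEquivOfIsCompl _ _ hc, fun x => ?_⟩, LinearMap.ext fun x => ?_, ?_⟩
  · simp
  · have hres : ∀ (m : ℕ) (y : LinearMap.ker (N ^ (k + 1))),
        (((A.restrict hK - c • 1) ^ m) y : V) = (N ^ m) (y : V) := by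
      intro m
      induction m with
      | zero => intro y; rfl
      | succ m ih =>
        intro y
        refine Eq.trans ?_ ((ih ((A.restrict hK - c • 1) y)).trans ?_)
        · exact congrArg Subtype.val (LinearMap.congr_fun (pow_succ (A.restrict hK - c • 1) m) y)
        · rw [hpow, hNx]
          rfl
    exact Subtype.ext ((hres (k + 1) x).trans x.2)
  · rw [LinearMap.isUnit_iff_ker_eq_bot, LinearMap.ker_eq_bot']
    intro x hx
    have hx0 : N (x : V) = 0 := by
      rw [hNx]
      exact congrArg Subtype.val hx
    refine Subtype.ext (Submodule.disjoint_def.1 hc.disjoint _ ?_ x.2)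
    rw [LinearMap.mem_ker, hpow, hx0, map_zero]

end Assembly

section Main

variable {F : Type u} [Field F] {V W : Type u} [AddCommGroup V] [Module F V]
  [FiniteDimensional F V] [AddCommGroup W] [Module F W] [FiniteDimensional F W] {i : F}

theorem isSUU_smul_one (h2 : (2 : F) ≠ 0) (hii : i * i = -1) (q : ℕ) :
    IsSUU (i • 1 : Module.End F ((Fin q → F) × (Fin q → F))) := by
  rw [smul_one_prod]
  exact isSUU_unipotent (k := 1) h2 hii (by simp)

theorem isSUU_prodMap_smul_one (h2 : (2 : F) ≠ 0) (hii : i * i = -1) (A : Module.End F V)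
    (hr : Module.finrank F V ≤ Module.finrank F W)
    (hdet : i ^ Module.finrank F W * LinearMap.det A = 1 ∨
      i ^ Module.finrank F W * LinearMap.det A = -1) :
    IsSUU (A.prodMap (i • 1) : Module.End F (V × W)) := by
  obtain ⟨V₁, V₂, _, _, _, _, _, _, A₁, A₂, k, hA, h₁, h₂⟩ := exists_fitting A i
  have hrank : Module.finrank F V = Module.finrank F V₁ + Module.finrank F V₂ := by
    obtain ⟨φ, -⟩ := hA
    rw [φ.finrank_eq, Module.finrank_prod]
  have hd₁ : LinearMap.det A₁ = i ^ Module.finrank F V₁ := by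
    have h : (((-i) • A₁) - (1 : F) • 1) ^ k = 0 := by
      have e : ((-i) • A₁) - (1 : F) • 1 = (-i) • (A₁ - i • 1) := by
        rw [smul_sub, smul_smul, neg_mul, hii, neg_neg]
      rw [e, smul_pow, h₁, smul_zero]
    have := det_eq_one_of_sub_pow h
    rw [LinearMap.det_smul] at this
    calc LinearMap.det A₁ = (i * -i) ^ Module.finrank F V₁ * LinearMap.det A₁ := by
          rw [mul_neg, hii, neg_neg, one_pow, one_mul]
      _ = _ := by rw [mul_pow, mul_assoc, this, mul_one]
  have hd₂ : LinearMap.det A₂ = i ^ Module.finrank F V₂ * LinearMap.det ((-i) • A₂) := by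
    rw [LinearMap.det_smul, ← mul_assoc, ← mul_pow, mul_neg, hii, neg_neg, one_pow, one_mul]
  have hd : LinearMap.det A = i ^ Module.finrank F V * LinearMap.det ((-i) • A₂) := by
    rw [hA.det_eq, LinearMap.det_prodMap, hd₁, hd₂, hrank, pow_add, mul_assoc]
  obtain ⟨d, hdd⟩ := Nat.exists_eq_add_of_le hr
  have hsq : (i ^ Module.finrank F V * i ^ Module.finrank F V = 1) ∨
      (i ^ Module.finrank F V * i ^ Module.finrank F V = -1) := by
    rw [← mul_pow, hii]
    exact neg_one_pow_eq_or F _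
  have hsq' : ∀ q : ℕ, i ^ (2 * q) = 1 ∨ i ^ (2 * q) = -1 := by
    intro q
    rw [pow_mul, pow_two, hii]
    exact neg_one_pow_eq_or F _
  obtain ⟨δ, hδ⟩ : ∃ δ, δ = LinearMap.det ((-i) • A₂) := ⟨_, rfl⟩
  have hδd : i ^ d * δ = 1 ∨ i ^ d * δ = -1 := by
    rw [hd, hdd, pow_add, ← hδ] at hdet
    rcases hsq with h | h <;> rcases hdet with h' | h'
    · left; linear_combination h' - i ^ d * δ * h
    · right; linear_combination h' - i ^ d * δ * h
    · right; linear_combination -h' + i ^ d * δ * h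
    · left; linear_combination -h' + i ^ d * δ * h
  rcases Nat.even_or_odd' d with ⟨q, rfl | rfl⟩
  · refine IsSUU.combine hA (isSUU_unipotent h2 hii h₁)
      (isSUU_of_isUnit_sub_even h2 hii h₂ ?_) (isSUU_smul_one h2 hii q) ?_
    · rw [← hδ]
      rcases hsq' q with h | h <;> rcases hδd with h' | h' <;> rw [h] at h'
      · left; linear_combination h'
      · right; linear_combination h'
      · right; linear_combination -h'
      · left; linear_combination -h'
    · rw [hdd, hrank]
      simp
      ring
  · refine IsSUU.combine hA (isSUU_unipotent h2 hii h₁)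
      (isSUU_of_isUnit_sub_odd h2 hii h₂ ?_) (isSUU_smul_one h2 hii q) ?_
    · rw [← hδ]
      rcases hsq' q with h | h <;> rcases hδd with h' | h' <;> rw [pow_succ, h] at h'
      · right; linear_combination -i * h' + δ * hii
      · left; linear_combination -i * h' + δ * hii
      · left; linear_combination i * h' + δ * hii
      · right; linear_combination i * h' + δ * hii
    · rw [hdd, hrank]
      simp
      ring

end Main

section Matrices

variable {F : Type u} [Field F]

theorem exists_reindex_fromBlocks_eq (hchar : ringChar F ≠ 2) {i : F} (hi : i ^ 2 = -1) {n : ℕ}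
    (A : Matrix (Fin n) (Fin n) F) {r : ℕ} (hr : n ≤ r)
    (hdet : i ^ r * A.det = 1 ∨ i ^ r * A.det = -1) :
    ∃ S U V : Matrix (Fin (n + r)) (Fin (n + r)) F, S * S = 1 ∧ (U - 1) * (U - 1) = 0 ∧
      (V - 1) * (V - 1) = 0 ∧ Matrix.reindex finSumFinEquiv finSumFinEquiv
        (Matrix.fromBlocks A 0 0 (i • (1 : Matrix (Fin r) (Fin r) F))) = S * (U * V) := by
  obtain ⟨s, t, hs, ⟨a, b, ha, hb, rfl⟩, h⟩ := isSUU_prodMap_smul_one (W := Fin r → F)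
    (Ring.two_ne_zero hchar) (by rw [← pow_two, hi]) (Matrix.toLin' A) (by simpa using hr)
    (by simpa [LinearMap.det_toLin'] using hdet)
  let v := (Pi.basisFun F (Fin n)).prod (Pi.basisFun F (Fin r))
  let Φ := (LinearMap.toMatrixAlgEquiv v).trans
    (Matrix.reindexAlgEquiv F F (finSumFinEquiv (m := n) (n := r)))
  refine ⟨Φ s, Φ a, Φ b, ?_, ?_, ?_, ?_⟩
  · rw [← map_mul, hs, map_one]
  · rw [← map_one Φ, ← map_sub, ← map_mul, ha, map_zero]
  · rw [← map_one Φ, ← map_sub, ← map_mul, hb, map_zero]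
  · rw [← map_mul, ← map_mul, ← h]
    change _ = Matrix.reindex _ _ (LinearMap.toMatrix v v _)
    rw [LinearMap.toMatrix_prodMap, map_smul, LinearMap.toMatrix_one,
      
      LinearMap.toMatrix_eq_toMatrix', LinearMap.toMatrix'_toLin']

end Matrices

end TwoUnipotents

/-- **Unnatural extensions, one involution and two U2-matrices in any prescribed order
(Theorem `skew1involution2unipotents`).**
Let `F` be a field of characteristic `≠ 2` containing an element `i` with `i² = −1`.
Let `A ∈ GLₙ(F)` and let `r ≥ n` be an integer such that `iʳ · det A = ±1`. Then, for any
prescribed position `k` of the involutory factor, `A ⊕ (i Iᵣ)` is a product of three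
matrices where the factor at position `k` is an involution and the other two are
U2-matrices. -/
theorem stmt9 {F : Type*} [Field F] (hchar : ringChar F ≠ 2)
    (i : F) (hi : i ^ 2 = -1)
    {n : ℕ} (A : Matrix (Fin n) (Fin n) F) (hA : IsUnit A)
    (r : ℕ) (hr : n ≤ r)
    (hdet : i ^ r * A.det = 1 ∨ i ^ r * A.det = -1) (k : Fin 3) :
    ∃ B : Fin 3 → Matrix (Fin (n + r)) (Fin (n + r)) F,
      B k * B k = 1 ∧
      (∀ j, j ≠ k → (B j - 1) * (B j - 1) = 0) ∧
      Matrix.reindex finSumFinEquiv finSumFinEquiv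
        (Matrix.fromBlocks A 0 0 (i • (1 : Matrix (Fin r) (Fin r) F))) = B 0 * B 1 * B 2 := by
  obtain ⟨S, U, V, hS, hU, hV, h⟩ := TwoUnipotents.exists_reindex_fromBlocks_eq hchar hi A hr hdet
  have conj : ∀ X : Matrix (Fin (n + r)) (Fin (n + r)) F, (X - 1) * (X - 1) = 0 →
      (S * X * S - 1) * (S * X * S - 1) = 0 := by
    intro X hX
    have e : S * X * S - 1 = S * (X - 1) * S := by rw [mul_sub, sub_mul, mul_one, hS]
    calc (S * X * S - 1) * (S * X * S - 1) = S * (X - 1) * (S * S) * (X - 1) * S := by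
          rw [e]; simp only [mul_assoc]
      _ = S * ((X - 1) * (X - 1)) * S := by rw [hS, mul_one]; simp only [mul_assoc]
      _ = 0 := by rw [hX, mul_zero, zero_mul]
  have hSS : ∀ X : Matrix (Fin (n + r)) (Fin (n + r)) F, S * (S * X) = X := fun X => by
    rw [← mul_assoc, hS, one_mul]
  rw [h]
  fin_cases k
  · refine ⟨![S, U, V], hS, fun j hj => ?_, by simp [mul_assoc]⟩
    fin_cases j
    exacts [absurd rfl hj, hU, hV]
  · refine ⟨![S * U * S, S, V], hS, fun j hj => ?_, by simp [mul_assoc, hSS]⟩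
    fin_cases j
    exacts [conj U hU, absurd rfl hj, hV]
  · refine ⟨![S * U * S, S * V * S, S], hS, fun j hj => ?_, by simp [mul_assoc, hSS, hS]⟩
    fin_cases j
    exacts [conj U hU, conj V hV, absurd rfl hj]
end

section
/- Let F be a field, let A ∈ GL_n(F) be an invertible matrix that is cyclic (i.e., some vector X ∈ Fⁿ satisfies that (A^k X)_{k∈ℕ} spans Fⁿ), and let p ∈ F[t] be a monic polynomial of degree n with N(p) = det A or N(p) = −det A. If n is odd or N(p) = −det A, then there exists an involution S ∈ GL_n(F) such that SA is similar to the companion matrix C(p). -/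
open Matrix Polynomial

/-- The companion matrix of a monic polynomial `p = tᵈ − Σ_{k<d} aₖ tᵏ`: ones on the
subdiagonal and the coefficients `aₖ = −p.coeff k` in the last column. -/
noncomputable def companion {F : Type*} [Field F] (p : Polynomial F) :
    Matrix (Fin p.natDegree) (Fin p.natDegree) F :=
  Matrix.of fun i j =>
    (if (i : ℕ) = (j : ℕ) + 1 then (1 : F) else 0) +
    (if (j : ℕ) = p.natDegree - 1 then -(p.coeff (i : ℕ)) else 0)

/-- The norm `N(p) = (−1)^{d−1} a₀` of a monic polynomial `p = tᵈ − Σ_{k<d} aₖ tᵏ`. -/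
noncomputable def polyNorm {F : Type*} [Field F] (p : Polynomial F) : F :=
  (-1) ^ (p.natDegree - 1) * (-(p.coeff 0))

/-- Similarity of square matrices: `B = P⁻¹ * A * P` for some invertible `P`. -/
def SimilarMat {F : Type*} [Field F] {ι : Type*} [Fintype ι] [DecidableEq ι]
    (A B : Matrix ι ι F) : Prop :=
  ∃ P : Matrix ι ι F, IsUnit P ∧ A * P = P * B

/-- `X` is a cyclic vector for `A` when the iterates `(Aᵏ X)` span the whole space. -/
def IsCyclicVec {F : Type*} [Field F] {n : ℕ} (A : Matrix (Fin n) (Fin n) F)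
    (X : Fin n → F) : Prop :=
  Submodule.span F (Set.range fun k : ℕ => (A ^ k) *ᵥ X) = ⊤

/-- A matrix is cyclic when it admits a cyclic vector. -/
def IsCyclicMat {F : Type*} [Field F] {n : ℕ} (A : Matrix (Fin n) (Fin n) F) : Prop :=
  ∃ X : Fin n → F, IsCyclicVec A X

/-- The companion matrix of `tⁿ + Σ_{k<n} cₖ tᵏ`, as a function of the coefficients. -/
def coeffCompanion {F : Type*} [Field F] {n : ℕ} (c : Fin n → F) : Matrix (Fin n) (Fin n) F :=
  Matrix.of fun i j =>
    (if (i : ℕ) = (j : ℕ) + 1 then (1 : F) else 0) + (if (j : ℕ) = n - 1 then -c i else 0)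

theorem reindex_companion {F : Type*} [Field F] {n : ℕ} (p : Polynomial F)
    (hdeg : p.natDegree = n) :
    Matrix.reindex (finCongr hdeg) (finCongr hdeg) (companion p) =
      coeffCompanion fun i : Fin n => p.coeff i := by
  subst hdeg
  rfl

/-- Right multiplication by a companion matrix shifts columns. -/
theorem mul_coeffCompanion_apply {F : Type*} [Field F] {m : ℕ} (c : Fin (m + 1) → F)
    (P : Matrix (Fin (m + 1)) (Fin (m + 1)) F) (v : ℕ → F) (i : Fin (m + 1))
    (hP : ∀ k, P i k = v k) (hv : v (m + 1) = -∑ k, c k * v k) (j : Fin (m + 1)) :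
    (P * coeffCompanion c) i j = v (j + 1) := by
  simp only [Matrix.mul_apply, coeffCompanion, Matrix.of_apply, mul_add, Finset.sum_add_distrib,
    hP, Nat.add_sub_cancel]
  by_cases hj : (j : ℕ) = m
  · have h1 : ∀ k : Fin (m + 1), (k : ℕ) ≠ m + 1 := fun k => k.isLt.ne
    simp [hj, h1, hv, mul_comm]
  · have hlt : (j : ℕ) + 1 < m + 1 := by omega
    rw [Finset.sum_eq_single (⟨j + 1, hlt⟩ : Fin (m + 1))]
    · simp [hj]
    · intro b _ hb
      rw [if_neg (fun h => hb (Fin.ext h)), mul_zero]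
    · simp

theorem pow_card_mulVec_eq {F : Type*} [Field F] {n : ℕ} (A : Matrix (Fin n) (Fin n) F)
    (X : Fin n → F) :
    (A ^ n) *ᵥ X = -∑ k : Fin n, A.charpoly.coeff k • ((A ^ (k : ℕ)) *ᵥ X) := by
  have h := Matrix.aeval_self_charpoly A
  rw [Polynomial.aeval_eq_sum_range, Matrix.charpoly_natDegree_eq_dim, Fintype.card_fin,
    Finset.sum_range_succ] at h
  have hlead : A.charpoly.coeff n = 1 := by
    have := (Matrix.charpoly_monic A).coeff_natDegree
    rwa [Matrix.charpoly_natDegree_eq_dim, Fintype.card_fin] at this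
  rw [hlead, one_smul, add_comm] at h
  rw [eq_neg_of_add_eq_zero_left h, Matrix.neg_mulVec, Finset.sum_range, Matrix.sum_mulVec]
  simp only [Matrix.smul_mulVec]

/-- The first `n` iterates of a cyclic vector form an invertible matrix. -/
theorem IsCyclicVec.isUnit_krylov {F : Type*} [Field F] {m : ℕ}
    {A : Matrix (Fin (m + 1)) (Fin (m + 1)) F} {X : Fin (m + 1) → F} (hX : IsCyclicVec A X) :
    IsUnit (Matrix.of fun i j : Fin (m + 1) => ((A ^ (j : ℕ)) *ᵥ X) i) := by
  rw [← Matrix.linearIndependent_cols_iff_isUnit]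
  have hcol : (Matrix.of fun i j : Fin (m + 1) => ((A ^ (j : ℕ)) *ᵥ X) i).col =
      fun j : Fin (m + 1) => (A ^ (j : ℕ)) *ᵥ X := rfl
  rw [hcol]
  refine linearIndependent_of_top_le_span_of_card_eq_finrank ?_ (by simp)
  rw [← hX, Submodule.span_le]
  set W := Submodule.span F (Set.range fun j : Fin (m + 1) => (A ^ (j : ℕ)) *ᵥ X) with hW
  have hmem : ∀ j, j < m + 1 → (A ^ j) *ᵥ X ∈ W := fun j hj =>
    Submodule.subset_span ⟨⟨j, hj⟩, rfl⟩
  have hstep : W ≤ W.comap A.mulVecLin := by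
    rw [hW, Submodule.span_le, ← hW]
    rintro _ ⟨j, rfl⟩
    change A *ᵥ ((A ^ (j : ℕ)) *ᵥ X) ∈ W
    rw [Matrix.mulVec_mulVec, ← pow_succ']
    rcases Nat.lt_or_ge ((j : ℕ) + 1) (m + 1) with h | h
    · exact hmem _ h
    · rw [show (j : ℕ) + 1 = m + 1 by omega, pow_card_mulVec_eq]
      exact W.neg_mem (W.sum_mem fun k _ => W.smul_mem _ (hmem k k.isLt))
  rintro _ ⟨k, rfl⟩
  change (A ^ k) *ᵥ X ∈ W
  induction k with
  | zero => exact hmem 0 m.succ_pos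
  | succ k ih =>
    rw [pow_succ', ← Matrix.mulVec_mulVec]
    exact hstep ih

/-- A cyclic matrix is similar to the companion matrix of its characteristic polynomial. -/
theorem IsCyclicMat.similarMat_coeffCompanion {F : Type*} [Field F] {m : ℕ}
    {A : Matrix (Fin (m + 1)) (Fin (m + 1)) F} (hA : IsCyclicMat A) :
    SimilarMat A (coeffCompanion fun k => A.charpoly.coeff k) := by
  obtain ⟨X, hX⟩ := hA
  refine ⟨_, hX.isUnit_krylov, ?_⟩
  ext i j
  rw [mul_coeffCompanion_apply _ _ (fun k => ((A ^ k) *ᵥ X) i) i (fun _ => rfl)]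
  · rw [pow_succ', ← Matrix.mulVec_mulVec]
    rfl
  · simp [pow_card_mulVec_eq]

/-- Companion matrices with opposite nonzero constant coefficients differ by a left factor
that is an involution. -/
theorem exists_involution_mul_coeffCompanion {F : Type*} [Field F] {m : ℕ}
    (c d : Fin (m + 1) → F) (hc : c 0 ≠ 0) (hd : d 0 = -c 0) :
    ∃ T : Matrix (Fin (m + 1)) (Fin (m + 1)) F,
      T * T = 1 ∧ T * coeffCompanion c = coeffCompanion d := by
  set z : Fin (m + 1) → F := fun i => (d i - c i) / c 0 with hz
  have hz0 : z 0 = -2 := by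
    rw [hz]
    field_simp
    rw [hd]
    ring
  refine ⟨1 + Matrix.vecMulVec z (Pi.single 0 1), ?_, ?_⟩
  · rw [mul_add, add_mul, add_mul, one_mul, mul_one, one_mul, Matrix.vecMulVec_mul_vecMulVec,
      single_one_dotProduct, hz0]
    ext i j
    simp only [Matrix.add_apply, Matrix.vecMulVec_apply, Pi.smul_apply,
      smul_eq_mul]
    ring
  · ext i j
    rw [add_mul, one_mul, Matrix.vecMulVec_mul, Matrix.add_apply, Matrix.vecMulVec_apply,
      Matrix.single_one_vecMul]
    simp only [coeffCompanion, Matrix.of_apply, Matrix.row_apply, hz]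
    by_cases hj : (j : ℕ) = m
    · simp [hj]
      field_simp
      ring
    · simp [hj]

theorem exists_involution_of_polyNorm_eq_neg_det {F : Type*} [Field F] {n : ℕ}
    (A : Matrix (Fin n) (Fin n) F) (hA : IsUnit A) (hcyc : IsCyclicMat A)
    (p : Polynomial F) (hdeg : p.natDegree = n) (hnorm : polyNorm p = -A.det) :
    ∃ S : Matrix (Fin n) (Fin n) F, S * S = 1 ∧
      SimilarMat (S * A) (Matrix.reindex (finCongr hdeg) (finCongr hdeg) (companion p)) := by
  rw [reindex_companion]
  rcases n with _ | m
  · exact ⟨1, Subsingleton.elim _ _, 1, isUnit_one, Subsingleton.elim _ _⟩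
  have hdet := Matrix.det_eq_sign_charpoly_coeff A
  rw [Fintype.card_fin] at hdet
  have hunit : A.det ≠ 0 := ((Matrix.isUnit_iff_isUnit_det A).mp hA).ne_zero
  have hsign : ((-1 : F) ^ m) ≠ 0 := pow_ne_zero _ (neg_ne_zero.mpr one_ne_zero)
  have hc : A.charpoly.coeff 0 ≠ 0 := fun h => hunit (by rw [hdet, h, mul_zero])
  have hd : p.coeff 0 = -A.charpoly.coeff 0 := by
    rw [polyNorm, hdeg, hdet, Nat.add_sub_cancel] at hnorm
    apply mul_left_cancel₀ hsign
    linear_combination -hnorm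
  obtain ⟨T, hT, hTC⟩ := exists_involution_mul_coeffCompanion
    (fun k : Fin (m + 1) => A.charpoly.coeff k) (fun k => p.coeff k) hc hd
  obtain ⟨P, hP, hAP⟩ := hcyc.similarMat_coeffCompanion
  have hPdet := (Matrix.isUnit_iff_isUnit_det P).mp hP
  refine ⟨P * T * P⁻¹, ?_, P, hP, ?_⟩
  · calc P * T * P⁻¹ * (P * T * P⁻¹) = P * T * (P⁻¹ * P) * T * P⁻¹ := by
          simp only [Matrix.mul_assoc]
      _ = P * (T * T) * P⁻¹ := by
          rw [Matrix.nonsing_inv_mul P hPdet, Matrix.mul_one, Matrix.mul_assoc P T T]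
      _ = 1 := by rw [hT, Matrix.mul_one, Matrix.mul_nonsing_inv P hPdet]
  · rw [Matrix.mul_assoc, hAP, Matrix.mul_assoc, ← Matrix.mul_assoc P⁻¹,
      Matrix.nonsing_inv_mul P hPdet, Matrix.one_mul, Matrix.mul_assoc, hTC]

theorem IsCyclicMat.neg {F : Type*} [Field F] {n : ℕ} {A : Matrix (Fin n) (Fin n) F}
    (hA : IsCyclicMat A) : IsCyclicMat (-A) := by
  obtain ⟨X, hX⟩ := hA
  refine ⟨X, top_le_iff.mp ?_⟩
  rw [← hX, Submodule.span_le]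
  rintro _ ⟨k, rfl⟩
  have h : (A ^ k) *ᵥ X = (-1 : F) ^ k • (((-A) ^ k) *ᵥ X) := by
    rcases k.even_or_odd with hk | hk
    · simp [hk.neg_pow]
    · simp [hk.neg_pow, Matrix.neg_mulVec]
  change (A ^ k) *ᵥ X ∈ _
  rw [h]
  exact Submodule.smul_mem _ _ (Submodule.subset_span ⟨k, rfl⟩)

/-- **Proposition `cyclicfit1`.**
Let `A ∈ GLₙ(F)` be an invertible cyclic matrix and `p` a monic polynomial of degree `n`
with `N(p) = ± det A`. If `n` is odd or `N(p) = − det A`, then `A` is i-adjacent to `C(p)`: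
there is an involution `S` such that `S * A` is similar to the companion matrix `C(p)`. -/
theorem stmt11 {F : Type*} [Field F] {n : ℕ}
    (A : Matrix (Fin n) (Fin n) F) (hA : IsUnit A) (hcyc : IsCyclicMat A)
    (p : Polynomial F) (hp : p.Monic) (hdeg : p.natDegree = n)
    (hnorm : polyNorm p = A.det ∨ polyNorm p = -A.det)
    (hcond : Odd n ∨ polyNorm p = -A.det) :
    ∃ S : Matrix (Fin n) (Fin n) F, S * S = 1 ∧
      SimilarMat (S * A) (Matrix.reindex (finCongr hdeg) (finCongr hdeg) (companion p)) := by
  by_cases h : polyNorm p = -A.det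
  · exact exists_involution_of_polyNorm_eq_neg_det A hA hcyc p hdeg h
  · have hodd := hcond.resolve_right h
    obtain ⟨S, hS, hsim⟩ := exists_involution_of_polyNorm_eq_neg_det (-A) hA.neg hcyc.neg p hdeg
      (by rw [Matrix.det_neg, Fintype.card_fin, hodd.neg_one_pow, neg_one_mul, neg_neg]
          exact hnorm.resolve_right h)
    refine ⟨-S, by rw [neg_mul_neg, hS], ?_⟩
    rwa [neg_mul, ← mul_neg]
end

section
/- Let F be a field, let A ∈ GL_n(F) be an invertible cyclic matrix, and let p ∈ F[t] be a monic polynomial of degree n with N(p) = det A. Then there exists a U2-matrix U ∈ GL_n(F) such that UA is similar to the companion matrix C(p). -/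
open Matrix Polynomial

/-- The companion matrix pattern of size `n` built from the coefficients of `q`. -/
noncomputable def companionOfSize {F : Type*} [Field F] (n : ℕ) (q : Polynomial F) :
    Matrix (Fin n) (Fin n) F :=
  Matrix.of fun i j =>
    (if (i : ℕ) = (j : ℕ) + 1 then (1 : F) else 0) +
    (if (j : ℕ) = n - 1 then -(q.coeff (i : ℕ)) else 0)

/-- The Krylov matrix of `A` at `X`, whose `j`-th column is `A ^ j *ᵥ X`. -/
def krylovMatrix {F : Type*} [Field F] {n : ℕ} (A : Matrix (Fin n) (Fin n) F)
    (X : Fin n → F) : Matrix (Fin n) (Fin n) F :=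
  Matrix.of fun i j => ((A ^ (j : ℕ)) *ᵥ X) i

/-- By Cayley–Hamilton, `A` acts on its Krylov matrix through the companion matrix of its
characteristic polynomial. -/
theorem mul_krylovMatrix {F : Type*} [Field F] {n : ℕ} (A : Matrix (Fin n) (Fin n) F)
    (X : Fin n → F) :
    A * krylovMatrix A X = krylovMatrix A X * companionOfSize n A.charpoly := by
  ext r j
  have hL : (A * krylovMatrix A X) r j = ((A ^ ((j : ℕ) + 1)) *ᵥ X) r := by
    rw [pow_succ', ← Matrix.mulVec_mulVec]
    rfl
  rw [hL, Matrix.mul_apply]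
  simp only [krylovMatrix, companionOfSize, Matrix.of_apply]
  by_cases hj : (j : ℕ) = n - 1
  · have hn : (j : ℕ) + 1 = n := by have := j.isLt; omega
    have hCH := Matrix.aeval_self_charpoly A
    rw [Polynomial.aeval_eq_sum_range, Matrix.charpoly_natDegree_eq_dim, Fintype.card_fin,
      Finset.sum_range_succ] at hCH
    have hlead : A.charpoly.coeff n = 1 := by
      have h := (Matrix.charpoly_monic A).coeff_natDegree
      rwa [Matrix.charpoly_natDegree_eq_dim, Fintype.card_fin] at h
    rw [hlead, one_smul] at hCH
    rw [hn, eq_neg_of_add_eq_zero_right hCH, Matrix.neg_mulVec, Matrix.sum_mulVec,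
      Pi.neg_apply, Finset.sum_apply, Finset.sum_range, ← Finset.sum_neg_distrib]
    refine Finset.sum_congr rfl fun i _ => ?_
    have hi : (i : ℕ) ≠ n := i.isLt.ne
    simp [hj, hi, Matrix.smul_mulVec, mul_comm]
  · have hlt : (j : ℕ) + 1 < n := by have := j.isLt; omega
    rw [Finset.sum_eq_single (⟨(j : ℕ) + 1, hlt⟩ : Fin n)]
    · simp [hj]
    · intro b _ hb
      have : (b : ℕ) ≠ (j : ℕ) + 1 := fun h => hb (Fin.ext h)
      simp [hj, this]
    · simp

theorem isUnit_krylovMatrix {F : Type*} [Field F] {n : ℕ} (hn : 0 < n)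
    {A : Matrix (Fin n) (Fin n) F} {X : Fin n → F} (hX : IsCyclicVec A X) :
    IsUnit (krylovMatrix A X) := by
  rw [← Matrix.mulVec_surjective_iff_isUnit]
  have hmem : ∀ k : ℕ, (A ^ k) *ᵥ X ∈ LinearMap.range (krylovMatrix A X).mulVecLin := by
    intro k
    induction k with
    | zero =>
      refine ⟨Pi.single ⟨0, hn⟩ 1, ?_⟩
      ext i
      simp [krylovMatrix]
    | succ k ih =>
      obtain ⟨v, hv⟩ := ih
      refine ⟨companionOfSize n A.charpoly *ᵥ v, ?_⟩
      rw [Matrix.mulVecLin_apply] at hv ⊢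
      rw [Matrix.mulVec_mulVec, ← mul_krylovMatrix, ← Matrix.mulVec_mulVec, hv,
        Matrix.mulVec_mulVec, pow_succ']
  have htop : LinearMap.range (krylovMatrix A X).mulVecLin = ⊤ := by
    rw [eq_top_iff, ← hX, Submodule.span_le]
    rintro _ ⟨k, rfl⟩
    exact hmem k
  exact LinearMap.range_eq_top.mp htop

/-- Two companion matrices with the same nonzero constant coefficient differ by left
multiplication by an elementary U2-matrix. -/
theorem exists_mul_companionOfSize_eq {F : Type*} [Field F] {n : ℕ} (hn : 0 < n)
    (p q : Polynomial F) (hpq : p.coeff 0 = q.coeff 0) (hq : q.coeff 0 ≠ 0) :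
    ∃ W : Matrix (Fin n) (Fin n) F, W * W = 0 ∧
      (1 + W) * companionOfSize n q = companionOfSize n p := by
  let w : Fin n → F := fun i => (q.coeff 0)⁻¹ * (p.coeff i - q.coeff i)
  let e : Fin n → F := Pi.single ⟨0, hn⟩ 1
  refine ⟨Matrix.vecMulVec w e, ?_, ?_⟩
  · have : e ⬝ᵥ w = 0 := by simp [e, w, hpq]
    rw [Matrix.vecMulVec_mul_vecMulVec, this, zero_smul, Matrix.vecMulVec_zero]
  · ext i j
    rw [add_mul, one_mul, Matrix.vecMulVec_mul, Matrix.add_apply, Matrix.vecMulVec_apply]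
    simp only [e, w, Matrix.single_one_vecMul, companionOfSize, Matrix.of_apply, Matrix.row_apply]
    by_cases hj : (j : ℕ) = n - 1
    · simp [hj]
      field_simp
      ring
    · simp [hj]

/-- **Proposition `cyclicfit2`.**
Let `A ∈ GLₙ(F)` be an invertible cyclic matrix and `p` a monic polynomial of degree `n`
with `N(p) = det A`. Then `A` is u-adjacent to `C(p)`: there is a U2-matrix `U` such that
`U * A` is similar to the companion matrix `C(p)`. -/
theorem stmt12 {F : Type*} [Field F] {n : ℕ}
    (A : Matrix (Fin n) (Fin n) F) (hA : IsUnit A) (hcyc : IsCyclicMat A)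
    (p : Polynomial F) (hp : p.Monic) (hdeg : p.natDegree = n)
    (hnorm : polyNorm p = A.det) :
    ∃ U : Matrix (Fin n) (Fin n) F, (U - 1) * (U - 1) = 0 ∧
      SimilarMat (U * A) (Matrix.reindex (finCongr hdeg) (finCongr hdeg) (companion p)) := by
  obtain ⟨X, hX⟩ := hcyc
  have hcomp : Matrix.reindex (finCongr hdeg) (finCongr hdeg) (companion p)
      = companionOfSize n p := by
    subst hdeg
    rfl
  rw [hcomp]
  rcases Nat.eq_zero_or_pos n with hn | hn
  · subst hn
    exact ⟨1, by simp, 1, isUnit_one, Subsingleton.elim _ _⟩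
  have hdet : A.det ≠ 0 := ((Matrix.isUnit_iff_isUnit_det A).mp hA).ne_zero
  have hsign := Matrix.det_eq_sign_charpoly_coeff A
  rw [Fintype.card_fin] at hsign
  have hpq : p.coeff 0 = A.charpoly.coeff 0 := by
    rw [hsign, polyNorm, hdeg] at hnorm
    obtain ⟨m, rfl⟩ := Nat.exists_eq_succ_of_ne_zero hn.ne'
    have hne : (-1 : F) ^ (m + 1) ≠ 0 := pow_ne_zero _ (neg_ne_zero.mpr one_ne_zero)
    apply mul_left_cancel₀ hne
    rw [← hnorm, Nat.succ_sub_one]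
    ring
  have hq : A.charpoly.coeff 0 ≠ 0 := by
    intro h
    rw [h, mul_zero] at hsign
    exact hdet hsign
  obtain ⟨W, hW, hWC⟩ := exists_mul_companionOfSize_eq hn p A.charpoly hpq hq
  have hP := isUnit_krylovMatrix hn hX
  have hAP := mul_krylovMatrix A X
  generalize krylovMatrix A X = P at hP hAP
  obtain ⟨P, rfl⟩ := hP
  refine ⟨P * (1 + W) * (↑P⁻¹ : Matrix (Fin n) (Fin n) F), ?_, P, P.isUnit, ?_⟩
  · have hU : (P : Matrix (Fin n) (Fin n) F) * (1 + W) * (↑P⁻¹ : Matrix (Fin n) (Fin n) F) - 1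
        = P * W * (↑P⁻¹ : Matrix (Fin n) (Fin n) F) := by
      rw [mul_add, add_mul, mul_one, Units.mul_inv, add_sub_cancel_left]
    rw [hU]
    simp only [mul_assoc, Units.inv_mul_cancel_left]
    rw [← mul_assoc W, hW, zero_mul, mul_zero]
  · rw [mul_assoc, hAP, mul_assoc, Units.inv_mul_cancel_left, mul_assoc, hWC]
end
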